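/- Let f : D^I_{p,q} → D^I_{p',q'} be a proper holomorphic map, where p ≥ q ≥ 2 and q' < min{p, 2q−1}. If q = q' or p = p', then f is standard, i.e. equivalent to the standard embedding Z ↦ [[Z,0],[0,0]]. -/

import Mathlib

open Matrix
open scoped ComplexOrder

attribute [local instance] Matrix.normedAddCommGroup Matrix.normedSpace

/-- The type-I irreducible bounded symmetric domain `D^I_{m,n}`,
realized as the set of complex `m × n` matrices `Z` with `I - Zᴴ Z` positive definite. -/
def typeIDomain (m n : ℕ) : Set (Matrix (Fin m) (Fin n) ℂ) :=
  {Z | (1 - Zᴴ * Z).PosDef}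

/-- `f` maps `D` into `D'` and the `f`-preimage of every compact subset of `D'`
is a compact subset of `D`. -/
def ProperOn {E F : Type*} [TopologicalSpace E] [TopologicalSpace F]
    (f : E → F) (D : Set E) (D' : Set F) : Prop :=
  Set.MapsTo f D D' ∧ ∀ K : Set F, K ⊆ D' → IsCompact K → IsCompact (D ∩ f ⁻¹' K)

/-- `Φ` is a (biholomorphic) automorphism of the type-I domain `D^I_{m,n}`. -/
def IsAutOf {m n : ℕ} (Φ : Matrix (Fin m) (Fin n) ℂ → Matrix (Fin m) (Fin n) ℂ) : Prop :=
  Set.MapsTo Φ (typeIDomain m n) (typeIDomain m n) ∧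
  DifferentiableOn ℂ Φ (typeIDomain m n) ∧
  ∃ Ψ, Set.MapsTo Ψ (typeIDomain m n) (typeIDomain m n) ∧
    DifferentiableOn ℂ Ψ (typeIDomain m n) ∧
    (∀ Z ∈ typeIDomain m n, Ψ (Φ Z) = Z) ∧
    (∀ Z ∈ typeIDomain m n, Φ (Ψ Z) = Z)

/-- The block-diagonal matrix `[[Z, 0], [0, W]]`, reindexed to size `p' × q'`. -/
def diagBlock {p q a b p' q' : ℕ} (hp : p + a = p') (hq : q + b = q')
    (Z : Matrix (Fin p) (Fin q) ℂ) (W : Matrix (Fin a) (Fin b) ℂ) :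
    Matrix (Fin p') (Fin q') ℂ :=
  Matrix.reindex (finCongr hp) (finCongr hq)
    (Matrix.reindex finSumFinEquiv finSumFinEquiv (Matrix.fromBlocks Z 0 0 W))




set_option linter.unusedSectionVars false
set_option linter.unusedSimpArgs false
set_option linter.deprecated false
set_option linter.unusedVariables false

open Metric Complex in
/-- maximum principle -/
theorem mp_zero {F : Type*} [NormedAddCommGroup F] [NormedSpace ℂ F] (h : ℂ → F)
    (hd : DifferentiableOn ℂ h (ball 0 1))
    (hb : ∀ ε > 0, ∃ ρ < (1:ℝ), ∀ z : ℂ, ‖z‖ < 1 → ρ < ‖z‖ → ‖h z‖ ≤ ε) :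
    ∀ z : ℂ, ‖z‖ < 1 → h z = 0 := by
  intro z hz
  rw [← norm_le_zero_iff]
  refine le_of_forall_pos_le_add fun ε hε => ?_
  obtain ⟨ρ, hρ, H⟩ := hb ε hε
  obtain ⟨r, hr1, hr2⟩ := exists_between (max_lt hρ hz)
  have hr0 : 0 < r := lt_of_le_of_lt (norm_nonneg z) (lt_of_le_of_lt (le_max_right _ _) hr1)
  have hsub : closedBall (0:ℂ) r ⊆ ball 0 1 := closedBall_subset_ball hr2
  have := Complex.norm_le_of_forall_mem_frontier_norm_le (f := h) (U := ball 0 r) (C := ε)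
    isBounded_ball ?_ ?_ (z := z) ?_
  · simpa using this
  · apply DifferentiableOn.diffContOnCl
    rw [closure_ball _ hr0.ne']
    exact hd.mono hsub
  · intro w hw
    rw [frontier_ball _ hr0.ne'] at hw
    have hw' : ‖w‖ = r := by simpa using hw
    exact H w (by rw [hw']; exact hr2) (by rw [hw']; exact lt_of_le_of_lt (le_max_left _ _) hr1)
  · apply subset_closure
    simpa using lt_of_le_of_lt (le_max_right _ _) hr1

open Metric Complex in
/-- Schwarz–Pick type estimate -/
theorem sp_est {H : Type*} [NormedAddCommGroup H] [InnerProductSpace ℂ H] (h : ℂ → H)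
    (hd : DifferentiableOn ℂ h (ball 0 1)) (hb : ∀ t : ℂ, ‖t‖ < 1 → ‖h t‖ ≤ 1) (t : ℂ) (ht : ‖t‖ < 1) :
    ‖h t - h 0‖ ^ 2 ≤ 2 * (1 - ‖h 0‖ ^ 2) * ((1 + ‖t‖) / (1 - ‖t‖)) := by
  set a := h 0 with ha
  have ha1 : ‖a‖ ≤ 1 := hb 0 (by simp)
  set φ : ℂ → ℂ := fun t => inner ℂ a (h t) - 1 with hφ
  have hφd : DifferentiableOn ℂ φ (ball 0 1) := by
    have : DifferentiableOn ℂ (fun t => innerSL ℂ a (h t)) (ball 0 1) :=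
      (innerSL ℂ a).differentiable.comp_differentiableOn hd
    exact (this.sub_const 1)
  have hφ0 : ‖φ 0‖ = 1 - ‖a‖ ^ 2 := by
    have : φ 0 = -((1 - ‖a‖ ^ 2 : ℝ) : ℂ) := by
      simp only [hφ, ← ha, inner_self_eq_norm_sq_to_K]; push_cast; simp
    rw [this, norm_neg, Complex.norm_real, Real.norm_of_nonneg]
    nlinarith [norm_nonneg a]
  have hre : ∀ s : ℂ, ‖s‖ < 1 → (φ s).re ≤ 0 := by
    intro s hs
    have h1 : ‖inner ℂ a (h s)‖ ≤ ‖a‖ * ‖h s‖ := norm_inner_le_norm _ _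
    have h2 : (inner ℂ a (h s)).re ≤ ‖inner ℂ a (h s)‖ := Complex.re_le_norm _
    have h3 := hb s hs
    simp only [hφ, Complex.sub_re, Complex.one_re]
    nlinarith [norm_nonneg a, norm_nonneg (h s)]
  have hbc : ‖φ t‖ ≤ ‖φ 0‖ * ((1 + ‖t‖) / (1 - ‖t‖)) := by
    have key : ∀ M : ℝ, 0 < M → ‖φ t‖ ≤ 2 * M * ‖t‖ / (1 - ‖t‖) + ‖φ 0‖ * (1 + ‖t‖) / (1 - ‖t‖) := by
      intro M hM
      apply Complex.borelCaratheodory hM hφd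
      · intro s hs
        have := hre s (by simpa using hs)
        simp only [Set.mem_ofPred_eq]; linarith
      · norm_num
      · simpa using ht
    have h1t : 0 < 1 - ‖t‖ := by linarith
    refine le_of_forall_pos_le_add fun ε hε => ?_
    have hk := key (ε * (1 - ‖t‖) / 2) (by positivity)
    have e1 : 2 * (ε * (1 - ‖t‖) / 2) * ‖t‖ / (1 - ‖t‖) = ε * ‖t‖ := by field_simp
    rw [e1] at hk
    have : ε * ‖t‖ ≤ ε := by nlinarith
    rw [mul_div_assoc] at hk
    linarith
  have e : ‖h t - a‖ ^ 2 ≤ 2 * ‖φ t‖ := by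
    rw [@norm_sub_sq ℂ]
    have h1 : RCLike.re (inner ℂ (h t) a) = (φ t).re + 1 := by
      simp only [hφ, Complex.sub_re, Complex.one_re, sub_add_cancel]
      exact inner_re_symm (𝕜 := ℂ) _ _
    have h2 : -(φ t).re ≤ ‖φ t‖ := by
      have := Complex.re_le_norm (-φ t); simpa using this
    have h3 := hb t ht
    rw [h1]
    nlinarith [norm_nonneg a, norm_nonneg (h t)]
  rw [hφ0] at hbc
  nlinarith

open Metric Complex in
theorem one_var_real_zero {F : Type*} [NormedAddCommGroup F] [NormedSpace ℂ F] [CompleteSpace F]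
    (h : ℂ → F) (r : ℝ) (hr : 0 < r) (hd : DifferentiableOn ℂ h (ball 0 r))
    (hz : ∀ a : ℝ, |a| < r → h a = 0) : ∀ z : ℂ, ‖z‖ < r → h z = 0 := by
  intro z hz'
  have han : AnalyticOnNhd ℂ h (ball 0 r) := hd.analyticOnNhd isOpen_ball
  have := han.eqOn_of_preconnected_of_frequently_eq (g := 0) analyticOnNhd_const
    (convex_ball _ _).isPreconnected (z₀ := 0) (by simpa using hr) ?_
  · exact this (by simpa using hz')
  · rw [frequently_nhdsWithin_iff]
    have h1 : Filter.Tendsto (fun n : ℕ => (((1:ℝ) / ((n:ℝ) + 1) : ℝ) : ℂ)) Filter.atTop (nhds 0) := by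
      have := (Complex.continuous_ofReal.tendsto 0).comp tendsto_one_div_add_atTop_nhds_zero_nat
      simpa [Function.comp_def] using this
    refine h1.frequently (Filter.Eventually.frequently ?_)
    have h2 := tendsto_one_div_add_atTop_nhds_zero_nat (𝕜 := ℝ)
    filter_upwards [h2.eventually (gt_mem_nhds hr)] with n hn
    have hp : (0:ℝ) < 1 / ((n:ℝ) + 1) := by positivity
    refine ⟨?_, ?_⟩
    · simp only [Pi.zero_apply]
      exact hz _ (by rwa [abs_of_pos hp])
    · simp only [Set.mem_compl_iff, Set.mem_singleton_iff, Complex.ofReal_eq_zero]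
      exact hp.ne'

open Metric Complex in
/-- polarization -/
theorem polar_zero {F : Type*} [NormedAddCommGroup F] [NormedSpace ℂ F] [CompleteSpace F]
    (H : ℂ × ℂ → F) (r : ℝ) (hr : 0 < r) (hd : DifferentiableOn ℂ H (ball 0 r))
    (hz : ∀ t : ℂ, ‖t‖ < r → H (t, (starRingEnd ℂ) t) = 0) :
    ∀ t s : ℂ, ‖t‖ < r / 2 → ‖s‖ < r / 2 → H (t, s) = 0 := by
  have mem : ∀ a b : ℂ, ‖a‖ < r / 2 → ‖b‖ < r / 2 → (a + I * b, a - I * b) ∈ ball (0 : ℂ × ℂ) r := by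
    intro a b ha hb
    have h1 : ‖I * b‖ = ‖b‖ := by simp
    have h2 := norm_add_le a (I * b)
    have h3 := norm_sub_le a (I * b)
    rw [mem_ball_zero_iff, Prod.norm_def, max_lt_iff]
    constructor <;> simp only <;> linarith
  have st1 : ∀ a : ℝ, |a| < r / 2 → ∀ b : ℂ, ‖b‖ < r / 2 → H ((a:ℂ) + I * b, a - I * b) = 0 := by
    intro a ha
    apply one_var_real_zero (fun b => H ((a:ℂ) + I * b, a - I * b)) (r / 2) (by linarith)
    · refine hd.comp (f := fun b : ℂ => ((a:ℂ) + I * b, (a:ℂ) - I * b)) ?_ ?_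
      · fun_prop
      · intro b hb
        exact mem _ _ (by simpa using ha) (by simpa using hb)
    · intro b hb
      have := hz (a + I * b) (by
        have := mem a b (by simpa using ha) (by simpa using hb)
        rw [mem_ball_zero_iff, Prod.norm_def, max_lt_iff] at this
        exact this.1)
      simpa [sub_eq_add_neg] using this
  have st2 : ∀ b : ℂ, ‖b‖ < r / 2 → ∀ a : ℂ, ‖a‖ < r / 2 → H (a + I * b, a - I * b) = 0 := by
    intro b hb
    apply one_var_real_zero (fun a => H ((a:ℂ) + I * b, a - I * b)) (r / 2) (by linarith)
    · refine hd.comp (f := fun a : ℂ => ((a:ℂ) + I * b, (a:ℂ) - I * b)) ?_ ?_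
      · fun_prop
      · intro a ha
        exact mem _ _ (by simpa using ha) hb
    · intro a ha
      exact st1 a ha b hb
  intro t s ht hs
  have := st2 ((t - s) / (2 * I)) (by
      have := norm_sub_le t s
      rw [norm_div]; simp; linarith) ((t + s) / 2) (by
      have := norm_add_le t s
      rw [norm_div]; simp; linarith)
  convert this using 3 <;> field_simp <;> ring

open Metric InnerProductSpace

theorem exists_fin_rows {ι E F : Type*} [AddCommGroup E] [Module ℂ E] [FiniteDimensional ℂ E]
    [AddCommGroup F] [Module ℂ F] (φ : ι → E →ₗ[ℂ] F) (h : ∀ v, (∀ i, φ i v = 0) → v = 0) :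
    ∃ s : Finset ι, ∀ v, (∀ i ∈ s, φ i v = 0) → v = 0 := by
  classical
  have key : ∀ n : ℕ, ∀ s : Finset ι, Module.finrank ℂ (⨅ i ∈ s, LinearMap.ker (φ i) : Submodule ℂ E) ≤ n →
      ∃ s : Finset ι, ∀ v, (∀ i ∈ s, φ i v = 0) → v = 0 := by
    intro n
    induction n with
    | zero =>
      intro s hs
      refine ⟨s, fun v hv => ?_⟩
      have h0 : (⨅ i ∈ s, LinearMap.ker (φ i) : Submodule ℂ E) = ⊥ :=
        Submodule.finrank_eq_zero.1 (by omega)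
      have : v ∈ (⨅ i ∈ s, LinearMap.ker (φ i) : Submodule ℂ E) := by
        simpa [Submodule.mem_iInf] using hv
      rw [h0] at this
      simpa using this
    | succ n ih =>
      intro s hs
      by_cases hc : ∀ v, (∀ i ∈ s, φ i v = 0) → v = 0
      · exact ⟨s, hc⟩
      · push Not at hc
        obtain ⟨v, hv, hv0⟩ := hc
        have : ∃ i, φ i v ≠ 0 := by
          by_contra hcon
          push Not at hcon
          exact hv0 (h v hcon)
        obtain ⟨i, hi⟩ := this
        apply ih (insert i s)
        have hlt : (⨅ j ∈ insert i s, LinearMap.ker (φ j) : Submodule ℂ E) <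
            (⨅ j ∈ s, LinearMap.ker (φ j) : Submodule ℂ E) := by
          refine lt_of_le_of_ne ?_ ?_
          · rw [Finset.iInf_insert]; exact inf_le_right
          · intro heq
            have : v ∈ (⨅ j ∈ s, LinearMap.ker (φ j) : Submodule ℂ E) := by
              simpa [Submodule.mem_iInf] using hv
            rw [← heq, Finset.iInf_insert] at this
            exact hi (by simpa using this.1)
        have := Submodule.finrank_lt_finrank_of_lt hlt
        omega
  exact key _ ∅ le_rfl

theorem det_differentiableOn {E : Type*} [NormedAddCommGroup E] [NormedSpace ℂ E]
    [FiniteDimensional ℂ E] {G : Type*} [NormedAddCommGroup G] [NormedSpace ℂ G] (A : G → E →L[ℂ] E)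
    (s : Set G) (hd : DifferentiableOn ℂ A s) :
    DifferentiableOn ℂ (fun z => LinearMap.det (A z : E →ₗ[ℂ] E)) s := by
  let b := Module.finBasis ℂ E
  have : (fun z => LinearMap.det (A z : E →ₗ[ℂ] E)) =
      fun z => ∑ σ : Equiv.Perm (Fin (Module.finrank ℂ E)), ((Equiv.Perm.sign σ : ℤ) : ℂ) *
        ∏ i, (b.coord (σ i)).toContinuousLinearMap (A z (b i)) := by
    funext z
    rw [← LinearMap.det_toMatrix b, Matrix.det_apply']
    simp [LinearMap.toMatrix_apply]
  rw [this]
  apply DifferentiableOn.fun_sum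
  intro σ _
  apply DifferentiableOn.const_mul
  have hi : ∀ i, DifferentiableOn ℂ (fun y => (LinearMap.toContinuousLinearMap (b.coord (σ i))) ((A y) (b i))) s := by
    intro i
    fun_prop
  intro y hy
  exact (HasFDerivWithinAt.finsetProd (u := Finset.univ) (g := fun i y => (LinearMap.toContinuousLinearMap (b.coord (σ i))) ((A y) (b i)))
    (fun i _ => (hi i y hy).hasFDerivWithinAt)).differentiableWithinAt

theorem det_lemma {E : Type*} [NormedAddCommGroup E] [InnerProductSpace ℂ E] [FiniteDimensional ℂ E]
    (A : ℂ → E →L[ℂ] E) (hd : DifferentiableOn ℂ A (ball 0 1)) (R : ℝ)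
    (hR : ∀ z : ℂ, ‖z‖ < 1 → ‖A z‖ ≤ R)
    (he : ∀ ε > 0, ∃ ρ < (1:ℝ), ∀ z : ℂ, ‖z‖ < 1 → ρ < ‖z‖ → ∃ e : E, ‖e‖ = 1 ∧ ‖A z e‖ ≤ ε) :
    ∃ v ≠ 0, A 0 v = 0 := by
  have hdd := det_differentiableOn A _ hd
  have hz : LinearMap.det (A 0 : E →ₗ[ℂ] E) = 0 := by
    refine mp_zero _ hdd ?_ 0 (by simp)
    intro ε hε
    have hK : IsCompact (closedBall (0 : E →L[ℂ] E) (R + 1)) := isCompact_closedBall _ _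
    have hcont : Continuous (fun B : E →L[ℂ] E => LinearMap.det (B : E →ₗ[ℂ] E)) :=
      continuousOn_univ.1 ((det_differentiableOn (fun B : E →L[ℂ] E => B) Set.univ
        differentiableOn_id).continuousOn)
    have hu := hK.uniformContinuousOn_of_continuous hcont.continuousOn
    rw [Metric.uniformContinuousOn_iff] at hu
    obtain ⟨δ, hδ, H⟩ := hu ε hε
    obtain ⟨ρ, hρ, H2⟩ := he (min (δ / 2) 1) (by positivity)
    refine ⟨ρ, hρ, fun z hz1 hz2 => ?_⟩
    obtain ⟨e, he1, he2⟩ := H2 z hz1 hz2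
    set A' := A z - rankOne ℂ (A z e) e with hA'
    have hn : ‖A z - A'‖ ≤ min (δ / 2) 1 := by
      rw [hA', sub_sub_cancel, norm_rankOne, he1, mul_one]; exact he2
    have hA'e : A' e = 0 := by
      simp [hA', he1]
    have hdet : LinearMap.det (A' : E →ₗ[ℂ] E) = 0 := by
      by_contra hne
      have hinj : Function.Injective (A' : E →ₗ[ℂ] E) := by
        rw [← LinearMap.ker_eq_bot]
        have := LinearMap.bot_lt_ker_of_det_eq_zero (f := (A' : E →ₗ[ℂ] E))
        by_contra hcon
        exact hne (LinearMap.det_eq_zero_iff_ker_ne_bot.2 hcon)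
      have : e = 0 := hinj (by simpa using hA'e)
      rw [this] at he1; simp at he1
    have h1 : A z ∈ closedBall (0 : E →L[ℂ] E) (R + 1) := by
      rw [mem_closedBall_zero_iff]; linarith [hR z hz1]
    have h2 : A' ∈ closedBall (0 : E →L[ℂ] E) (R + 1) := by
      rw [mem_closedBall_zero_iff]
      have := norm_sub_norm_le A' (A z)
      have h3 := norm_sub_rev A' (A z)
      linarith [hR z hz1, min_le_right (δ / 2) 1]
    have := H _ h1 _ h2 (by rw [dist_eq_norm]; linarith [min_le_left (δ / 2) 1])
    simp only [hdet, dist_zero_right] at this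
    exact this.le
  have hker : LinearMap.ker (A 0 : E →ₗ[ℂ] E) ≠ ⊥ :=
    (LinearMap.bot_lt_ker_of_det_eq_zero hz).ne'
  obtain ⟨v, hv, hv0⟩ := Submodule.exists_mem_ne_zero_of_ne_bot hker
  exact ⟨v, hv0, by simpa using hv⟩

section Blocks
variable {V W : Type*} [NormedAddCommGroup V] [InnerProductSpace ℂ V]
  [NormedAddCommGroup W] [InnerProductSpace ℂ W] [FiniteDimensional ℂ V]

theorem blk_norm_lt (Z Y : V →L[ℂ] W) (K : Submodule ℂ V) (hZ : ‖Z‖ < 1) (hY : ‖Y‖ < 1)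
    (h1 : ∀ k ∈ K, Y k = 0) (h2 : ∀ k ∈ Kᗮ, Z k = 0) (h3 : ∀ v v', inner ℂ (Z v) (Y v') = 0) :
    ‖Z + Y‖ < 1 := by
  set c := max ‖Z‖ ‖Y‖ with hc
  have hc0 : 0 ≤ c := le_trans (norm_nonneg Z) (le_max_left _ _)
  refine lt_of_le_of_lt (ContinuousLinearMap.opNorm_le_bound _ hc0 fun v => ?_) (max_lt hZ hY)
  obtain ⟨a, ha, b, hb, hab⟩ := K.exists_add_mem_mem_orthogonal v
  have hin : inner ℂ a b = 0 := hb a ha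
  have e1 : (Z + Y) v = Z a + Y b := by
    rw [hab]; simp [h1 a ha, h2 b hb]
  have hva : ‖v‖ * ‖v‖ = ‖a‖ * ‖a‖ + ‖b‖ * ‖b‖ := by
    rw [hab]; exact norm_add_sq_eq_norm_sq_add_norm_sq_of_inner_eq_zero _ _ hin
  have hzv : ‖Z a + Y b‖ * ‖Z a + Y b‖ = ‖Z a‖ * ‖Z a‖ + ‖Y b‖ * ‖Y b‖ :=
    norm_add_sq_eq_norm_sq_add_norm_sq_of_inner_eq_zero _ _ (h3 a b)
  rw [e1]
  have hZa : ‖Z a‖ ≤ c * ‖a‖ := (Z.le_opNorm a).trans (by gcongr; exact le_max_left _ _)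
  have hYb : ‖Y b‖ ≤ c * ‖b‖ := (Y.le_opNorm b).trans (by gcongr; exact le_max_right _ _)
  have q1 : ‖Z a‖ * ‖Z a‖ ≤ (c * ‖a‖) * (c * ‖a‖) := by gcongr
  have q2 : ‖Y b‖ * ‖Y b‖ ≤ (c * ‖b‖) * (c * ‖b‖) := by gcongr
  refine abs_le_of_sq_le_sq' ?_ (by positivity) |>.2
  have e2 : (c * ‖v‖) ^ 2 = (c * ‖a‖) * (c * ‖a‖) + (c * ‖b‖) * (c * ‖b‖) := by
    rw [mul_pow, sq ‖v‖, hva]; ring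
  rw [e2, sq, hzv]
  linarith

end Blocks

open Metric InnerProductSpace

theorem diffOn_clm {G E F : Type*} [NormedAddCommGroup G] [NormedSpace ℂ G] [NormedAddCommGroup E]
    [NormedSpace ℂ E] [FiniteDimensional ℂ E] [NormedAddCommGroup F] [NormedSpace ℂ F]
    (g : G → E →L[ℂ] F) (s : Set G) (h : ∀ v, DifferentiableOn ℂ (fun z => g z v) s) :
    DifferentiableOn ℂ g s := by
  let b := Module.finBasis ℂ E
  have : g = fun z => ∑ i, ContinuousLinearMap.smulRightL ℂ E F
      (LinearMap.toContinuousLinearMap (b.coord i)) (g z (b i)) := by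
    funext z
    ext v
    have e : g z v = ∑ i, (b.repr v) i • (g z) (b i) := by
      conv_lhs => rw [← b.sum_repr v]
      rw [map_sum]
      simp only [map_smul]
    simpa [ContinuousLinearMap.sum_apply] using e
  rw [this]
  apply DifferentiableOn.fun_sum
  intro i _
  exact (ContinuousLinearMap.differentiable _).comp_differentiableOn (h (b i))

section PHdef
variable {V W V' W' : Type} [NormedAddCommGroup V] [InnerProductSpace ℂ V] [FiniteDimensional ℂ V]
  [NormedAddCommGroup W] [InnerProductSpace ℂ W] [FiniteDimensional ℂ W]
  [NormedAddCommGroup V'] [InnerProductSpace ℂ V'] [FiniteDimensional ℂ V']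
  [NormedAddCommGroup W'] [InnerProductSpace ℂ W'] [FiniteDimensional ℂ W']

/-- proper holomorphic maps between operator balls -/
structure PH (f : (V →L[ℂ] W) → (V' →L[ℂ] W')) : Prop where
  diff : DifferentiableOn ℂ f (ball 0 1)
  maps : ∀ Z, ‖Z‖ < 1 → ‖f Z‖ < 1
  prop : ∀ r < (1:ℝ), ∃ ρ < (1:ℝ), ∀ Z, ‖Z‖ < 1 → ρ < ‖Z‖ → r < ‖f Z‖

/-- operators killing `K` with range in `T` -/
def NS (K : Submodule ℂ V) (T : Submodule ℂ W) (Z : V →L[ℂ] W) : Prop :=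
  (∀ k ∈ K, Z k = 0) ∧ ∀ v, Z v ∈ T

/-- common kernel of `f Z` for `Z` in `NS K T` -/
def MS (f : (V →L[ℂ] W) → (V' →L[ℂ] W')) (K : Submodule ℂ V) (T : Submodule ℂ W) :
    Submodule ℂ V' where
  carrier := {m | ∀ Z, ‖Z‖ < 1 → NS K T Z → f Z m = 0}
  add_mem' := by
    intro a b ha hb Z hZ hN
    rw [map_add, ha Z hZ hN, hb Z hZ hN, add_zero]
  zero_mem' := by intro Z _ _; simp
  smul_mem' := by
    intro c a ha Z hZ hN
    rw [map_smul, ha Z hZ hN, smul_zero]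

theorem mem_MS {f : (V →L[ℂ] W) → (V' →L[ℂ] W')} {K : Submodule ℂ V} {T : Submodule ℂ W} {m : V'} :
    m ∈ MS f K T ↔ ∀ Z, ‖Z‖ < 1 → NS K T Z → f Z m = 0 := Iff.rfl

theorem NS.mono {K K' : Submodule ℂ V} {T T' : Submodule ℂ W} {Z : V →L[ℂ] W}
    (h : NS K' T Z) (hK : K ≤ K') (hT : T ≤ T') : NS K T' Z :=
  ⟨fun k hk => h.1 k (hK hk), fun v => hT (h.2 v)⟩

theorem MS_mono (f : (V →L[ℂ] W) → (V' →L[ℂ] W')) {K K' : Submodule ℂ V} {T T' : Submodule ℂ W}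
    (hK : K ≤ K') (hT : T' ≤ T) : MS f K T ≤ MS f K' T' :=
  fun _ hm Z hZ hN => hm Z hZ (hN.mono hK hT)

theorem exists_unit_near (A : V →L[ℂ] W) (M : Submodule ℂ V) (hM : ∀ m ∈ M, A m = 0) (r : ℝ)
    (hr0 : 0 ≤ r) (hr : r < ‖A‖) : ∃ e ∈ Mᗮ, ‖e‖ = 1 ∧ r < ‖A e‖ := by
  obtain ⟨v, hv⟩ : ∃ v, r * ‖v‖ < ‖A v‖ := by
    by_contra hcon
    push Not at hcon
    exact absurd (ContinuousLinearMap.opNorm_le_bound A hr0 hcon) (not_le.2 hr)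
  obtain ⟨a, ha, b, hb, hab⟩ := M.exists_add_mem_mem_orthogonal v
  have hAb : A v = A b := by rw [hab, map_add, hM a ha, zero_add]
  have hbv : ‖b‖ ≤ ‖v‖ := by
    have : ‖v‖ * ‖v‖ = ‖a‖ * ‖a‖ + ‖b‖ * ‖b‖ := by
      rw [hab]; exact norm_add_sq_eq_norm_sq_add_norm_sq_of_inner_eq_zero _ _ (hb a ha)
    nlinarith [norm_nonneg a, norm_nonneg b, norm_nonneg v]
  have hb2 : r * ‖b‖ < ‖A b‖ := by
    rw [← hAb]; exact lt_of_le_of_lt (by gcongr) hv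
  have hb0 : b ≠ 0 := by rintro rfl; simp at hb2
  have hbp : 0 < ‖b‖ := norm_pos_iff.2 hb0
  refine ⟨((‖b‖⁻¹ : ℝ) : ℂ) • b, Submodule.smul_mem _ _ hb, ?_, ?_⟩
  · rw [norm_smul, Complex.norm_real, norm_inv, norm_norm, inv_mul_cancel₀ hbp.ne']
  · rw [map_smul, norm_smul, Complex.norm_real, norm_inv, norm_norm, lt_inv_mul_iff₀ hbp]
    linarith

/-- Schwarz–Pick on line segments -/
theorem PH.sp {f : (V →L[ℂ] W) → (V' →L[ℂ] W')} (hf : PH f) (Z Y : V →L[ℂ] W)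
    (hY : ∀ t : ℂ, ‖t‖ < 1 → ‖Z + t • Y‖ < 1) (e : V') (he : ‖e‖ = 1) (t : ℂ) (ht : ‖t‖ < 1) :
    ‖f (Z + t • Y) e - f Z e‖ ^ 2 ≤ 2 * (1 - ‖f Z e‖ ^ 2) * ((1 + ‖t‖) / (1 - ‖t‖)) := by
  have := sp_est (fun t : ℂ => f (Z + t • Y) e) ?_ ?_ t ht
  · simpa using this
  · have h1 : DifferentiableOn ℂ (fun t : ℂ => f (Z + t • Y)) (ball 0 1) := by
      refine hf.diff.comp (f := fun t : ℂ => Z + t • Y) (by fun_prop) ?_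
      intro s hs
      simpa using hY s (by simpa using hs)
    exact h1.clm_apply (differentiableOn_const e)
  · intro s hs
    have := hf.maps _ (hY s hs)
    calc _ ≤ ‖f (Z + s • Y)‖ * ‖e‖ := ContinuousLinearMap.le_opNorm _ _
      _ ≤ 1 := by rw [he]; linarith

theorem rk_blk {u : W} {x : V} (hu : ‖u‖ = 1) (hx : ‖x‖ = 1) {z : ℂ} (hz : ‖z‖ < 1)
    {Y : V →L[ℂ] W} (hY : ‖Y‖ < 1) (hN : NS (ℂ ∙ x) (ℂ ∙ u)ᗮ Y) :
    ‖z • rankOne ℂ u x + Y‖ < 1 := by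
  apply blk_norm_lt _ _ (ℂ ∙ x) _ hY hN.1
  · intro k hk
    rw [Submodule.mem_orthogonal_singleton_iff_inner_right] at hk
    simp [hk]
  · intro v v'
    have := hN.2 v'
    rw [Submodule.mem_orthogonal_singleton_iff_inner_right] at this
    simp [inner_smul_left, this]
  · rw [norm_smul, norm_rankOne, hu, hx]; simpa using hz

theorem rk_norm {u : W} {x : V} (hu : ‖u‖ = 1) (hx : ‖x‖ = 1) (z : ℂ) :
    ‖z • rankOne ℂ u x‖ = ‖z‖ := by
  rw [norm_smul, norm_rankOne, hu, hx]; simp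

theorem rk_NS (u : W) (x : V) (z : ℂ) : NS (ℂ ∙ x)ᗮ (ℂ ∙ u) (z • rankOne ℂ u x) := by
  constructor
  · intro k hk
    rw [Submodule.mem_orthogonal_singleton_iff_inner_right] at hk
    simp [hk]
  · intro v
    simp only [ContinuousLinearMap.smul_apply, rankOne_apply]
    exact Submodule.smul_mem _ _ (Submodule.smul_mem _ _ (Submodule.mem_span_singleton_self u))

/-- the boundary estimate used throughout: differences tend to zero -/
theorem PH.diff_small {f : (V →L[ℂ] W) → (V' →L[ℂ] W')} (hf : PH f) {u : W} {x : V} (hu : ‖u‖ = 1)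
    (hx : ‖x‖ = 1) {Y : V →L[ℂ] W} (hY : ‖Y‖ < 1) (hN : NS (ℂ ∙ x) (ℂ ∙ u)ᗮ Y) (ε : ℝ) (hε : 0 < ε) :
    ∃ r < (1:ℝ), 0 ≤ r ∧ ∀ (z : ℂ), ‖z‖ < 1 → ∀ e : V', ‖e‖ = 1 → r < ‖f (z • rankOne ℂ u x) e‖ →
      ‖f (z • rankOne ℂ u x + Y) e - f (z • rankOne ℂ u x) e‖ ≤ ε := by
  obtain ⟨ρ, hρ1, hρ2⟩ := exists_between hY
  have hρ0 : 0 < ρ := lt_of_le_of_lt (norm_nonneg _) hρ1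
  set C := (1 + ρ) / (1 - ρ) with hC
  have hC0 : 0 < C := by have : 0 < 1 - ρ := by linarith
                         positivity
  set δ := min (ε ^ 2 / (4 * C)) 1 with hδ
  have hδ0 : 0 < δ := by positivity
  have hδ1 : δ ≤ 1 := min_le_right _ _
  refine ⟨1 - δ, by linarith, by linarith, ?_⟩
  intro z hz e he hr
  have h1 := hf.sp (z • rankOne ℂ u x) ((ρ⁻¹ : ℂ) • Y) ?_ e he (ρ:ℂ) (by
    rw [Complex.norm_real, Real.norm_of_nonneg hρ0.le]; exact hρ2)
  · rw [smul_smul, mul_inv_cancel₀ (by exact_mod_cast hρ0.ne'), one_smul, Complex.norm_real,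
      Real.norm_of_nonneg hρ0.le, ← hC] at h1
    refine abs_le_of_sq_le_sq' (h1.trans ?_) hε.le |>.2
    set a := ‖f (z • rankOne ℂ u x) e‖
    have hd : δ * (4 * C) ≤ ε ^ 2 := by
      have : δ ≤ ε ^ 2 / (4 * C) := min_le_left _ _
      rwa [le_div_iff₀ (by positivity)] at this
    have : 1 - a ^ 2 ≤ 2 * δ := by nlinarith
    nlinarith
  · intro t ht
    apply rk_blk hu hx hz
    · rw [smul_smul, norm_smul, norm_mul, norm_inv, Complex.norm_real, Real.norm_of_nonneg hρ0.le]
      have : ρ⁻¹ * ‖Y‖ ≤ 1 := by rw [inv_mul_le_iff₀ hρ0]; linarith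
      have h0 : 0 ≤ ρ⁻¹ * ‖Y‖ := by positivity
      calc ‖t‖ * ρ⁻¹ * ‖Y‖ = ‖t‖ * (ρ⁻¹ * ‖Y‖) := by ring
        _ ≤ ‖t‖ * 1 := by gcongr
        _ < 1 := by linarith
    · refine ⟨fun k hk => by simp [hN.1 k hk], fun v => ?_⟩
      simp only [ContinuousLinearMap.smul_apply]
      exact Submodule.smul_mem _ _ (Submodule.smul_mem _ _ (hN.2 v))

theorem PH.diffOn_line {f : (V →L[ℂ] W) → (V' →L[ℂ] W')} (hf : PH f) {u : W} {x : V} (hu : ‖u‖ = 1)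
    (hx : ‖x‖ = 1) {Y : V →L[ℂ] W} (hY : ‖Y‖ < 1) (hN : NS (ℂ ∙ x) (ℂ ∙ u)ᗮ Y) :
    DifferentiableOn ℂ (fun z : ℂ => f (z • rankOne ℂ u x + Y)) (ball 0 1) := by
  refine hf.diff.comp (f := fun t : ℂ => t • rankOne ℂ u x + Y) (by fun_prop) ?_
  intro s hs
  simpa using rk_blk hu hx (by simpa using hs) hY hN

theorem NS_zero (K : Submodule ℂ V) (T : Submodule ℂ W) : NS K T (0 : V →L[ℂ] W) :=
  ⟨by simp, by simp⟩

/-- Key lemma -/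
theorem KL_unit {f : (V →L[ℂ] W) → (V' →L[ℂ] W')} (hf : PH f) (f0 : f 0 = 0) {u : W} {x : V}
    (hu : ‖u‖ = 1) (hx : ‖x‖ = 1) :
    ∃ m ≠ 0, m ∈ MS f (ℂ ∙ x) (ℂ ∙ u)ᗮ ∧ m ∈ (MS f (ℂ ∙ x)ᗮ (ℂ ∙ u))ᗮ := by
  classical
  by_contra hcon
  push Not at hcon
  set E := (MS f (ℂ ∙ x)ᗮ (ℂ ∙ u))ᗮ with hE
  let ι := {Y : V →L[ℂ] W // ‖Y‖ < 1 ∧ NS (ℂ ∙ x) (ℂ ∙ u)ᗮ Y}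
  obtain ⟨s, hs⟩ := exists_fin_rows (ι := ι) (E := E) (F := W')
    (fun Y => ((f Y.1).comp E.subtypeL : E →L[ℂ] W')) (by
      intro v hv
      by_contra hv0
      refine hcon v (by simpa using hv0) ?_ v.2
      intro Z hZ hN
      simpa using hv ⟨Z, hZ, hN⟩)
  let Δ : ℂ → E →L[ℂ] (s → W') := fun z => ContinuousLinearMap.pi fun k =>
    (f (z • rankOne ℂ u x + k.1.1) - f (z • rankOne ℂ u x + 0)).comp E.subtypeL
  have hΔ0 : Function.Injective (Δ 0 : E →ₗ[ℂ] (s → W')) := by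
    rw [← LinearMap.ker_eq_bot, LinearMap.ker_eq_bot']
    intro v hv
    apply hs v
    intro i hi
    have := congrFun hv ⟨i, hi⟩
    simpa [Δ, f0] using this
  obtain ⟨B, hB⟩ := LinearMap.exists_leftInverse_of_injective _ (LinearMap.ker_eq_bot.2 hΔ0)
  let Bc : (s → W') →L[ℂ] E := LinearMap.toContinuousLinearMap B
  have hdiffΔ : DifferentiableOn ℂ Δ (ball 0 1) := by
    have h1 : ∀ k : s, DifferentiableOn ℂ (fun z : ℂ => (f (z • rankOne ℂ u x + k.1.1) -
        f (z • rankOne ℂ u x + 0)).comp E.subtypeL) (ball 0 1) := by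
      intro k
      have a1 := hf.diffOn_line hu hx k.1.2.1 k.1.2.2
      have a2 := hf.diffOn_line hu hx (Y := 0) (by simp) (NS_zero _ _)
      exact (a1.sub a2).clm_comp (differentiableOn_const _)
    apply diffOn_clm
    intro v
    rw [differentiableOn_pi]
    intro k
    exact (h1 k).clm_apply (differentiableOn_const v)
  have hbd : ∀ z : ℂ, ‖z‖ < 1 → ‖Δ z‖ ≤ 2 := by
    intro z hz
    refine ContinuousLinearMap.opNorm_le_bound _ (by norm_num) fun v => ?_
    rw [pi_norm_le_iff_of_nonneg (by positivity)]
    intro k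
    have b1 := hf.maps _ (rk_blk hu hx hz k.1.2.1 k.1.2.2)
    have b2 := hf.maps _ (rk_blk hu hx hz (Y := 0) (by simp) (NS_zero _ _))
    have b3 : ‖(f (z • rankOne ℂ u x + k.1.1) - f (z • rankOne ℂ u x + 0))‖ ≤ 2 :=
      (norm_sub_le _ _).trans (by linarith)
    have b4 := ContinuousLinearMap.le_opNorm
      (f (z • rankOne ℂ u x + k.1.1) - f (z • rankOne ℂ u x + 0)) (v : V')
    exact b4.trans (mul_le_mul_of_nonneg_right b3 (norm_nonneg (v : V')))
  obtain ⟨v, hv0, hv⟩ := det_lemma (fun z => Bc.comp (Δ z))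
    ((differentiableOn_const Bc).clm_comp hdiffΔ) (‖Bc‖ * 2) (by
      intro z hz
      exact (ContinuousLinearMap.opNorm_comp_le _ _).trans (by gcongr; exact hbd z hz)) (by
    intro ε hε
    have : ∀ k : s, ∃ r < (1:ℝ), 0 ≤ r ∧ ∀ (z : ℂ), ‖z‖ < 1 → ∀ e : V', ‖e‖ = 1 →
      r < ‖f (z • rankOne ℂ u x) e‖ →
      ‖f (z • rankOne ℂ u x + k.1.1) e - f (z • rankOne ℂ u x) e‖ ≤ ε / (‖Bc‖ + 1) := fun k =>
      hf.diff_small hu hx k.1.2.1 k.1.2.2 _ (by positivity)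
    choose r hr1 hr0 hr using this
    obtain ⟨R, hR1, hR0, hR⟩ : ∃ R < (1:ℝ), 0 ≤ R ∧ ∀ k, r k ≤ R := by
      rcases isEmpty_or_nonempty s with hse | hse
      · exact ⟨0, by norm_num, le_rfl, fun k => hse.elim k⟩
      · obtain ⟨k0, hk0⟩ := Finite.exists_max r
        exact ⟨r k0, hr1 k0, hr0 k0, hk0⟩
    obtain ⟨ρ, hρ, H⟩ := hf.prop R hR1
    refine ⟨ρ, hρ, fun z hz1 hz2 => ?_⟩
    have hZn := rk_norm hu hx z
    have hlt := H (z • rankOne ℂ u x) (by rw [hZn]; exact hz1) (by rw [hZn]; exact hz2)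
    obtain ⟨e, heE, he1, hre⟩ := exists_unit_near _ (MS f (ℂ ∙ x)ᗮ (ℂ ∙ u)) (fun m hm =>
      hm (z • rankOne ℂ u x) (by rw [hZn]; exact hz1) (rk_NS u x z)) R hR0 hlt
    refine ⟨⟨e, heE⟩, by simpa using he1, ?_⟩
    have hΔe : ‖Δ z ⟨e, heE⟩‖ ≤ ε / (‖Bc‖ + 1) := by
      rw [pi_norm_le_iff_of_nonneg (by positivity)]
      intro k
      have := hr k z hz1 e he1 (lt_of_le_of_lt (hR k) hre)
      simpa [Δ] using this
    calc ‖Bc (Δ z ⟨e, heE⟩)‖ ≤ ‖Bc‖ * ‖Δ z ⟨e, heE⟩‖ := ContinuousLinearMap.le_opNorm _ _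
      _ ≤ ‖Bc‖ * (ε / (‖Bc‖ + 1)) := by gcongr
      _ ≤ (‖Bc‖ + 1) * (ε / (‖Bc‖ + 1)) := by gcongr; linarith
      _ = ε := by field_simp)
  apply hv0
  have : B (Δ 0 v) = v := LinearMap.congr_fun hB v
  rw [← this]; exact hv

theorem KL {f : (V →L[ℂ] W) → (V' →L[ℂ] W')} (hf : PH f) (f0 : f 0 = 0) {u : W} {x : V}
    (hu : u ≠ 0) (hx : x ≠ 0) :
    ∃ m ≠ 0, m ∈ MS f (ℂ ∙ x) (ℂ ∙ u)ᗮ ∧ m ∈ (MS f (ℂ ∙ x)ᗮ (ℂ ∙ u))ᗮ := by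
  have hu' : IsUnit ((‖u‖⁻¹ : ℝ) : ℂ) := by simp [hu]
  have hx' : IsUnit ((‖x‖⁻¹ : ℝ) : ℂ) := by simp [hx]
  have := KL_unit hf f0 (u := ((‖u‖⁻¹ : ℝ) : ℂ) • u) (x := ((‖x‖⁻¹ : ℝ) : ℂ) • x)
    (by rw [norm_smul, Complex.norm_real, norm_inv, norm_norm, inv_mul_cancel₀ (norm_ne_zero_iff.2 hu)])
    (by rw [norm_smul, Complex.norm_real, norm_inv, norm_norm, inv_mul_cancel₀ (norm_ne_zero_iff.2 hx)])
  rwa [Submodule.span_singleton_smul_eq hu', Submodule.span_singleton_smul_eq hx'] at this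

theorem finrank_inf_orth (T : Submodule ℂ W) {u : W} (hu : u ≠ 0) :
    Module.finrank ℂ T ≤ Module.finrank ℂ (T ⊓ (ℂ ∙ u)ᗮ : Submodule ℂ W) + 1 := by
  have h1 := Submodule.finrank_sup_add_finrank_inf_eq T (ℂ ∙ u)ᗮ
  have h2 := Submodule.finrank_add_finrank_orthogonal (ℂ ∙ u)
  have h3 := finrank_span_singleton (K := ℂ) hu
  have h4 := Submodule.finrank_le (T ⊔ (ℂ ∙ u)ᗮ)
  omega

theorem RI_aux {f : (V →L[ℂ] W) → (V' →L[ℂ] W')} (hf : PH f) (f0 : f 0 = 0) (n : ℕ) :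
    ∀ (K : Submodule ℂ V) (T : Submodule ℂ W), n + Module.finrank ℂ K ≤ Module.finrank ℂ V →
      n ≤ Module.finrank ℂ T → Module.finrank ℂ (MS f K T) + n ≤ Module.finrank ℂ V' := by
  induction n with
  | zero => intro K T _ _; simpa using Submodule.finrank_le _
  | succ n ih =>
    intro K T h1 h2
    obtain ⟨x, hx, hx0⟩ : ∃ x ∈ Kᗮ, x ≠ 0 := by
      apply Submodule.exists_mem_ne_zero_of_ne_bot
      intro h
      have := Submodule.finrank_add_finrank_orthogonal K
      rw [h, finrank_bot] at this
      omega
    obtain ⟨u, hu, hu0⟩ : ∃ u ∈ T, u ≠ 0 := by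
      apply Submodule.exists_mem_ne_zero_of_ne_bot
      intro h
      rw [h, finrank_bot] at h2
      omega
    obtain ⟨m, hm0, hm1, hm2⟩ := KL hf f0 hu0 hx0
    have hlt : MS f K T < MS f (K ⊔ (ℂ ∙ x)) (T ⊓ (ℂ ∙ u)ᗮ) := by
      refine lt_of_le_of_ne (MS_mono f le_sup_left inf_le_left) ?_
      intro heq
      have hmem : m ∈ MS f K T := by
        rw [heq]; exact MS_mono f le_sup_right inf_le_right hm1
      have hmem2 : m ∈ MS f (ℂ ∙ x)ᗮ (ℂ ∙ u) := by
        refine MS_mono f ?_ ?_ hmem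
        · intro k hk
          rw [Submodule.mem_orthogonal_singleton_iff_inner_left]
          exact hx k hk
        · simpa using hu
      exact hm0 (inner_self_eq_zero.1 (hm2 m hmem2))
    have l1 := Submodule.finrank_lt_finrank_of_lt hlt
    have l2 := ih (K ⊔ (ℂ ∙ x)) (T ⊓ (ℂ ∙ u)ᗮ) (by
      have := Submodule.finrank_add_le_finrank_add_finrank K (ℂ ∙ x)
      have := finrank_span_singleton (K := ℂ) hx0
      omega) (by
      have := finrank_inf_orth T hu0
      omega)
    omega

end PHdef

open Metric InnerProductSpace

theorem convex_ident {G F : Type*} [NormedAddCommGroup G] [NormedSpace ℂ G]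
    [NormedAddCommGroup F] [NormedSpace ℂ F] [CompleteSpace F] (g : G → F) (S : Set G)
    (hS : IsOpen S) (hc : Convex ℝ S) (hd : DifferentiableOn ℂ g S) (c : G) (hcS : c ∈ S)
    (h0 : ∀ᶠ y in nhds c, g y = 0) : ∀ y ∈ S, g y = 0 := by
  intro y hy
  let l : ℂ → G := fun t => c + t • (y - c)
  have hl : Continuous l := by fun_prop
  set D : Set ℂ := l ⁻¹' S with hD
  have hDo : IsOpen D := hS.preimage hl
  have hDc : Convex ℝ D := by
    intro a ha b hb s t hs ht hst
    have := hc ha hb hs ht hst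
    show l (s • a + t • b) ∈ S
    convert this using 1
    simp only [l]
    have e : s • c + t • c = c := by rw [← add_smul, hst, one_smul]
    calc c + (s • a + t • b) • (y - c) = (s • c + t • c) + (s • a + t • b) • (y - c) := by rw [e]
      _ = _ := by
        simp only [smul_add, add_smul, smul_assoc]
        abel
  have hdl : DifferentiableOn ℂ (fun t => g (l t)) D := by
    refine hd.comp (f := l) (by fun_prop) ?_
    intro t ht; exact ht
  have han : AnalyticOnNhd ℂ (fun t => g (l t)) D := hdl.analyticOnNhd hDo
  have := han.eqOn_of_preconnected_of_eventuallyEq (g := 0) analyticOnNhd_const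
    hDc.isPreconnected (z₀ := 0) (by simpa [hD, l] using hcS) (by
      have ht : Filter.Tendsto l (nhds 0) (nhds c) := by
        have := hl.tendsto 0
        simpa [l] using this
      exact ht.eventually h0)
  have h1 := this (x := 1) (by simpa [hD, l] using hy)
  simpa [l] using h1

theorem lin_of_half {G F : Type*} [NormedAddCommGroup G] [NormedSpace ℂ G]
    [NormedAddCommGroup F] [NormedSpace ℂ F] (g : G → F) (T : G →L[ℂ] F) (hT : HasFDerivAt g T 0)
    (r : ℝ) (h : ∀ y, ‖y‖ < r → g ((1 / 2 : ℂ) • y) = (1 / 2 : ℂ) • g y) (y : G) (hy : ‖y‖ < r) :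
    g y = T y := by
  have hr : 0 < r := lt_of_le_of_lt (norm_nonneg _) hy
  have g0 : g 0 = 0 := by
    have := h 0 (by simpa using hr)
    rw [smul_zero] at this
    have h2 : (1 / 2 : ℂ) • g 0 = 0 := by
      have : (1 / 2 : ℂ) • g 0 + (1 / 2 : ℂ) • g 0 = (1 / 2 : ℂ) • g 0 := by
        rw [← add_smul]; norm_num; simpa using this
      simpa using this
    simpa using h2
  have hn : ∀ n : ℕ, g (((1 / 2 : ℂ) ^ n) • y) = ((1 / 2 : ℂ) ^ n) • g y := by
    intro n
    induction n with
    | zero => simp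
    | succ n ih =>
      rw [pow_succ', mul_smul, h _ ?_, ih, mul_smul]
      rw [norm_smul, norm_pow]
      have : ‖(1 / 2 : ℂ)‖ ^ n ≤ 1 := pow_le_one₀ (norm_nonneg _) (by norm_num)
      nlinarith [norm_nonneg y]
  have h1 := hT.comp_hasDerivAt_of_eq (0:ℂ) (f := fun t : ℂ => t • y) (by
    simpa using (hasDerivAt_id (0:ℂ)).smul_const y) (by simp)
  rw [hasDerivAt_iff_tendsto_slope] at h1
  have hseq : Filter.Tendsto (fun n : ℕ => (1 / 2 : ℂ) ^ n) Filter.atTop (nhdsWithin 0 {0}ᶜ) := by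
    rw [tendsto_nhdsWithin_iff]
    refine ⟨tendsto_pow_atTop_nhds_zero_of_norm_lt_one (by norm_num), ?_⟩
    filter_upwards with n
    simp
  have h2 := h1.comp hseq
  have h3 : ∀ n : ℕ, slope (g ∘ fun t : ℂ => t • y) 0 ((1 / 2 : ℂ) ^ n) = g y := by
    intro n
    rw [slope_def_module]
    simp only [Function.comp, zero_smul, g0, sub_zero, hn n]
    rw [smul_smul, inv_mul_cancel₀ (by positivity), one_smul]
  have h4 : Filter.Tendsto (fun n : ℕ => g y) Filter.atTop (nhds (T y)) := by
    refine h2.congr ?_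
    intro n; exact h3 n
  exact tendsto_nhds_unique tendsto_const_nhds h4

theorem sesq_prop {X Y : Type*} [AddCommGroup X] [Module ℂ X] [AddCommGroup Y] [Module ℂ Y]
    (S1 S2 : X →ₗ⋆[ℂ] Y →ₗ[ℂ] ℂ) (h : ∀ η θ, S1 η θ = 0 → S2 η θ = 0) :
    ∃ κ : ℂ, ∀ η θ, S2 η θ = κ * S1 η θ := by
  have hA : ∀ η θ θ', S2 η θ * S1 η θ' = S2 η θ' * S1 η θ := by
    intro η θ θ'
    have := h η (S1 η θ • θ' - S1 η θ' • θ) (by simp [mul_comm])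
    simp only [map_sub, map_smul, smul_eq_mul, sub_eq_zero] at this
    linear_combination -this
  have hB : ∀ η η' θ, S2 η θ * S1 η' θ = S2 η' θ * S1 η θ := by
    intro η η' θ
    have := h ((starRingEnd ℂ) (S1 η θ) • η' - (starRingEnd ℂ) (S1 η' θ) • η) θ (by simp [mul_comm])
    simp [sub_eq_zero] at this
    linear_combination -this
  by_cases hz : ∀ η θ, S1 η θ = 0
  · exact ⟨0, fun η θ => by rw [h η θ (hz η θ), zero_mul]⟩
  push Not at hz
  obtain ⟨e, e', he⟩ := hz
  refine ⟨S2 e e' / S1 e e', fun η θ => ?_⟩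
  -- first along e
  have h1 : ∀ θ, S2 e θ = S2 e e' / S1 e e' * S1 e θ := by
    intro θ; field_simp; exact hA e θ e'
  have h1' : ∀ η, S2 η e' = S2 e e' / S1 e e' * S1 η e' := by
    intro η; field_simp; exact hB η e e'
  -- general
  by_cases hθ : S1 e θ ≠ 0
  · have := hB η e θ
    rw [h1 θ] at this
    apply mul_right_cancel₀ hθ
    linear_combination this
  · push Not at hθ
    have hθ' : S1 e (θ + e') ≠ 0 := by rw [map_add, hθ, zero_add]; exact he
    have := hB η e (θ + e')
    rw [h1 (θ + e')] at this
    have h3 : S2 η (θ + e') = S2 e e' / S1 e e' * S1 η (θ + e') := by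
      apply mul_right_cancel₀ hθ'
      linear_combination this
    rw [map_add, map_add, h1' η] at h3
    linear_combination h3

section FL
variable {V W V' W' : Type} [NormedAddCommGroup V] [InnerProductSpace ℂ V] [FiniteDimensional ℂ V]
  [NormedAddCommGroup W] [InnerProductSpace ℂ W] [FiniteDimensional ℂ W]
  [NormedAddCommGroup V'] [InnerProductSpace ℂ V'] [FiniteDimensional ℂ V']
  [NormedAddCommGroup W'] [InnerProductSpace ℂ W'] [FiniteDimensional ℂ W']

theorem exists_orth_unit (h2 : 2 ≤ Module.finrank ℂ W) (u : W) : ∃ w : W, ‖w‖ = 1 ∧ inner ℂ u w = 0 := by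
  obtain ⟨x, hx, hx0⟩ : ∃ x ∈ (ℂ ∙ u)ᗮ, x ≠ 0 := by
    apply Submodule.exists_mem_ne_zero_of_ne_bot
    intro h
    have h1 := Submodule.finrank_add_finrank_orthogonal (ℂ ∙ u)
    rw [h, finrank_bot] at h1
    have h3 := finrank_span_le_card (R := ℂ) ({u} : Set W)
    simp at h3
    omega
  rw [Submodule.mem_orthogonal_singleton_iff_inner_right] at hx
  refine ⟨((‖x‖⁻¹ : ℝ) : ℂ) • x, ?_, ?_⟩
  · rw [norm_smul, Complex.norm_real, norm_inv, norm_norm, inv_mul_cancel₀ (norm_ne_zero_iff.2 hx0)]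
  · rw [inner_smul_right, hx, mul_zero]

theorem smul_unit (y : W) (hy : y ≠ 0) : ∃ u : W, ‖u‖ = 1 ∧ y = ((‖y‖ : ℝ) : ℂ) • u := by
  refine ⟨((‖y‖⁻¹ : ℝ) : ℂ) • y, ?_, ?_⟩
  · rw [norm_smul, Complex.norm_real, norm_inv, norm_norm, inv_mul_cancel₀ (norm_ne_zero_iff.2 hy)]
  · rw [smul_smul]; push_cast
    rw [mul_inv_cancel₀ (by exact_mod_cast norm_ne_zero_iff.2 hy), one_smul]

/-- `f (y v^*)` kills the orthogonal complement of `v` -/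
theorem FL_kill {f : (V →L[ℂ] W) → (V →L[ℂ] W')}
    (hW : 2 ≤ Module.finrank ℂ W) (hM : ∀ x u, u ≠ 0 → x ∈ MS f (ℂ ∙ x) (ℂ ∙ u)ᗮ)
    (v w : V) (hvw : inner ℂ v w = 0) (y : W) (hn : ‖y‖ * ‖v‖ < 1) : f (rankOne ℂ y v) w = 0 := by
  obtain ⟨u, hu, huy⟩ := exists_orth_unit hW y
  refine hM w u (by rintro rfl; simp at hu) _ (by rw [norm_rankOne]; exact hn) ⟨?_, ?_⟩
  · intro k hk
    obtain ⟨c, rfl⟩ := Submodule.mem_span_singleton.1 hk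
    simp [inner_smul_right, hvw]
  · intro k
    rw [Submodule.mem_orthogonal_singleton_iff_inner_right, rankOne_apply, inner_smul_right,
      inner_eq_zero_symm.1 huy, mul_zero]

theorem FL_near {f : (V →L[ℂ] W) → (V →L[ℂ] W')} (hf : PH f)
    (hW : 2 ≤ Module.finrank ℂ W) (hM : ∀ x u, u ≠ 0 → x ∈ MS f (ℂ ∙ x) (ℂ ∙ u)ᗮ)
    {v : V} {u : W} (hv : ‖v‖ = 1) (hu : ‖u‖ = 1) (r : ℝ) (hr0 : 0 ≤ r) (hr : r < 1) :
    ∃ ρ < (1:ℝ), ∀ z : ℂ, ‖z‖ < 1 → ρ < ‖z‖ → r < ‖f (z • rankOne ℂ u v) v‖ := by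
  obtain ⟨ρ, hρ, H⟩ := hf.prop r hr
  refine ⟨ρ, hρ, fun z h1 h2 => ?_⟩
  have hn := rk_norm hu hv z
  have hrz := H _ (by rw [hn]; exact h1) (by rw [hn]; exact h2)
  obtain ⟨e, he, he1, he2⟩ := exists_unit_near _ (ℂ ∙ v)ᗮ (fun m hm => by
    rw [Submodule.mem_orthogonal_singleton_iff_inner_right] at hm
    have := FL_kill hW hM v m hm (z • u) (by rw [norm_smul, hu, hv]; simpa using h1)
    rwa [map_smul] at this) r hr0 hrz
  rw [Submodule.orthogonal_orthogonal] at he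
  obtain ⟨c, rfl⟩ := Submodule.mem_span_singleton.1 he
  rw [norm_smul, hv, mul_one] at he1
  rwa [map_smul, norm_smul, he1, one_mul] at he2

theorem FL_star {f : (V →L[ℂ] W) → (V →L[ℂ] W')} (hf : PH f)
    (hW : 2 ≤ Module.finrank ℂ W) (hM : ∀ x u, u ≠ 0 → x ∈ MS f (ℂ ∙ x) (ℂ ∙ u)ᗮ)
    {v : V} {y : W} (hv : ‖v‖ = 1) (hy0 : y ≠ 0) (hy : ‖y‖ < 1) (Y : V →L[ℂ] W) (hY : ‖Y‖ < 1)
    (hYv : Y v = 0) (hYy : ∀ w, inner ℂ y (Y w) = 0) : f (rankOne ℂ y v + Y) v = f (rankOne ℂ y v) v := by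
  obtain ⟨u, hu, hyu⟩ := smul_unit y hy0
  have hN : NS (ℂ ∙ v) (ℂ ∙ u)ᗮ Y := by
    constructor
    · intro k hk
      obtain ⟨c, rfl⟩ := Submodule.mem_span_singleton.1 hk
      simp [hYv]
    · intro w
      rw [Submodule.mem_orthogonal_singleton_iff_inner_right]
      have := hYy w
      rw [hyu, inner_smul_left] at this
      simpa [hy0] using this
  have key := mp_zero (fun z : ℂ => f (z • rankOne ℂ u v + Y) v - f (z • rankOne ℂ u v + 0) v) (by
    have a1 := hf.diffOn_line hu hv hY hN
    have a2 := hf.diffOn_line hu hv (Y := 0) (by simp) (NS_zero _ _)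
    exact (a1.clm_apply (differentiableOn_const v)).sub (a2.clm_apply (differentiableOn_const v))) (by
    intro ε hε
    obtain ⟨r, hr1, hr0, hr⟩ := hf.diff_small hu hv hY hN ε hε
    obtain ⟨ρ, hρ, H⟩ := FL_near hf hW hM hv hu r hr0 hr1
    refine ⟨ρ, hρ, fun z h1 h2 => ?_⟩
    simp only [add_zero]
    exact hr z h1 v hv (H z h1 h2)) (‖y‖ : ℝ) (by simpa using hy)
  simp only [add_zero] at key
  have e : (((‖y‖ : ℝ) : ℂ)) • rankOne ℂ u v = rankOne ℂ y v := by
    conv_rhs => rw [hyu]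
    ext w; simp
  rw [e] at key
  exact sub_eq_zero.1 key


theorem FL_claim2 {f : (V →L[ℂ] W) → (V →L[ℂ] W')} (hf : PH f)
    (hW : 2 ≤ Module.finrank ℂ W) (hM : ∀ x u, u ≠ 0 → x ∈ MS f (ℂ ∙ x) (ℂ ∙ u)ᗮ)
    {v v' : V} {y : W} (hv : ‖v‖ = 1) (hv' : ‖v'‖ ≤ 1) (hvv : inner ℂ v v' = 0) (hy : ‖y‖ < 1 / 10) :
    f (rankOne ℂ y (v + v')) v = f (rankOne ℂ y v) v := by
  by_cases hy0 : y = 0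
  · subst hy0; simp
  obtain ⟨y1, hy1, hyy1⟩ := exists_orth_unit hW y
  set w := ((‖y‖ : ℝ) : ℂ) • y1 with hw
  have hyw : inner ℂ y w = 0 := by rw [hw, inner_smul_right, hyy1, mul_zero]
  have hwn : ‖w‖ = ‖y‖ := by rw [hw, norm_smul, hy1]; simp
  set u := (1 / 2 : ℂ) • (y + w) with hu
  set u' := (1 / 2 : ℂ) • (y - w) with hu'
  have hyu : y = u + u' := by
    rw [hu, hu', ← smul_add]; simp only [add_add_sub_cancel]
    rw [← two_smul ℂ y, smul_smul]; norm_num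
  have hun : ‖u‖ ≤ ‖y‖ := by
    rw [hu, norm_smul]; have := norm_add_le y w; rw [hwn] at this
    norm_num; linarith
  have hun' : ‖u'‖ ≤ ‖y‖ := by
    rw [hu', norm_smul]; have := norm_sub_le y w; rw [hwn] at this
    norm_num; linarith
  have huu : inner ℂ u u' = 0 := by
    rw [hu, hu', inner_smul_left, inner_smul_right, inner_add_left, inner_sub_right, inner_sub_right,
      hyw, inner_eq_zero_symm.1 hyw, inner_self_eq_norm_sq_to_K, inner_self_eq_norm_sq_to_K, hwn]
    simp
  have huu2 : inner ℂ u u = inner ℂ u' u' := by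
    rw [hu, hu', inner_smul_left, inner_smul_right, inner_smul_left, inner_smul_right]
    simp only [inner_add_left, inner_add_right, inner_sub_right, inner_sub_left, hyw, inner_eq_zero_symm.1 hyw]
    ring
  clear_value u u' w
  have hne : ∀ t : ℂ, u + t • u' ≠ 0 := by
    intro t h
    have h1 : inner ℂ u (u + t • u') = 0 := by rw [h, inner_zero_right]
    rw [inner_add_right, inner_smul_right, huu, mul_zero, add_zero] at h1
    have h2 := h1
    rw [huu2] at h2
    rw [inner_self_eq_zero] at h1 h2
    rw [h1, h2, add_zero] at hyu
    exact hy0 hyu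
  have hyt : ∀ t : ℂ, ‖t‖ < 4 → ‖u + t • u'‖ < 1 / 2 := by
    intro t ht
    have := norm_add_le u (t • u')
    rw [norm_smul] at this
    nlinarith [norm_nonneg u']
  have hys : ∀ t : ℂ, ‖t‖ < 4 → ‖u' - t • u‖ < 1 / 2 := by
    intro t ht
    have := norm_sub_le u' (t • u)
    rw [norm_smul] at this
    nlinarith [norm_nonneg u]
  have hbd : ∀ t s : ℂ, ‖t‖ < 4 → ‖s‖ < 4 →
      ‖rankOne ℂ (u + t • u') v + rankOne ℂ (u' - s • u) v'‖ < 1 := by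
    intro t s ht hs
    refine (norm_add_le _ _).trans_lt ?_
    rw [norm_rankOne, norm_rankOne, hv]
    nlinarith [hyt t ht, hys s hs, norm_nonneg (u' - s • u), norm_nonneg v']
  have key := polar_zero (fun p : ℂ × ℂ => f (rankOne ℂ (u + p.1 • u') v + rankOne ℂ (u' - p.2 • u) v') v
    - f (rankOne ℂ (u + p.1 • u') v) v) 4 (by norm_num) (by
      have hmem : ∀ p : ℂ × ℂ, p ∈ ball (0 : ℂ × ℂ) 4 → ‖p.1‖ < 4 ∧ ‖p.2‖ < 4 := by
        intro p hp
        rwa [mem_ball_zero_iff, Prod.norm_def, max_lt_iff] at hp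
      have hr1 : Differentiable ℂ (fun p : ℂ × ℂ => rankOne ℂ (u + p.1 • u') v) := by
        have : (fun p : ℂ × ℂ => rankOne ℂ (u + p.1 • u') v) =
          fun p : ℂ × ℂ => rankOne ℂ u v + p.1 • rankOne ℂ u' v := by
          funext p; simp
        rw [this]; fun_prop
      have hr2 : Differentiable ℂ (fun p : ℂ × ℂ => rankOne ℂ (u' - p.2 • u) v') := by
        have : (fun p : ℂ × ℂ => rankOne ℂ (u' - p.2 • u) v') =
          fun p : ℂ × ℂ => rankOne ℂ u' v' - p.2 • rankOne ℂ u v' := by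
          funext p; simp
        rw [this]; fun_prop
      have d1 := hf.diff.comp (t := ball 0 1) (s := ball (0 : ℂ × ℂ) 4)
        (f := fun p : ℂ × ℂ => rankOne ℂ (u + p.1 • u') v + rankOne ℂ (u' - p.2 • u) v')
        (hr1.add hr2).differentiableOn (fun p hp => by
          have := hmem p hp
          simpa using hbd p.1 p.2 this.1 this.2)
      have d2 := hf.diff.comp (t := ball 0 1) (s := ball (0 : ℂ × ℂ) 4)
        (f := fun p : ℂ × ℂ => rankOne ℂ (u + p.1 • u') v)
        hr1.differentiableOn (fun p hp => by
          have := hmem p hp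
          rw [mem_ball_zero_iff, norm_rankOne, hv]
          linarith [hyt _ this.1])
      exact (d1.clm_apply (differentiableOn_const v)).sub (d2.clm_apply (differentiableOn_const v))) (by
      intro t ht
      have ht' : ‖(starRingEnd ℂ) t‖ < 4 := by simpa using ht
      rw [sub_eq_zero]
      apply FL_star hf hW hM hv (hne t) ((hyt t ht).trans (by norm_num))
      · rw [norm_rankOne]
        nlinarith [hys _ ht', norm_nonneg (u' - (starRingEnd ℂ) t • u), norm_nonneg v']
      · rw [rankOne_apply, inner_eq_zero_symm.1 hvv, zero_smul]
      · intro k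
        rw [rankOne_apply, inner_smul_right]
        simp only [inner_add_left, inner_sub_right, inner_smul_left, inner_smul_right, huu,
          inner_eq_zero_symm.1 huu, huu2]
        ring) 1 (-1) (by norm_num) (by norm_num)
  simp only [one_smul, neg_smul, sub_neg_eq_add, sub_eq_zero] at key
  rw [← hyu, add_comm u' u, ← hyu] at key
  rw [← key]
  congr 2
  ext k; simp [inner_add_left, add_smul]

theorem FL_G {f : (V →L[ℂ] W) → (V →L[ℂ] W')} (hf : PH f)
    (hW : 2 ≤ Module.finrank ℂ W) (hM : ∀ x u, u ≠ 0 → x ∈ MS f (ℂ ∙ x) (ℂ ∙ u)ᗮ)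
    {v x : V} {y : W} (hv : ‖v‖ = 1) (hx : ‖x‖ = 1) (hvx : 1 / 2 ≤ ‖inner ℂ v x‖ ^ 2)
    (hy : ‖y‖ < 1 / 10) :
    f (rankOne ℂ ((inner ℂ x v) • y) v) v = (inner ℂ x v) • f (rankOne ℂ y x) x := by
  set a := inner ℂ v x with ha
  have ha0 : a ≠ 0 := by intro h; rw [h] at hvx; norm_num at hvx
  have hconj : inner ℂ x v = (starRingEnd ℂ) a := by rw [ha, inner_conj_symm]
  set v' := a⁻¹ • x - v with hv'
  have hvv : inner ℂ v v' = 0 := by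
    rw [hv', inner_sub_right, inner_smul_right, ← ha, inner_self_eq_norm_sq_to_K, hv,
      inv_mul_cancel₀ ha0]; simp
  have hxe : x = a • (v + v') := by
    rw [hv', add_sub_cancel, smul_smul, mul_inv_cancel₀ ha0, one_smul]
  have han : ‖a‖ ≤ 1 := by
    have := norm_inner_le_norm (𝕜 := ℂ) v x
    rwa [hv, hx, mul_one] at this
  have hv'n : ‖v'‖ ≤ 1 := by
    have h1 : ‖v + v'‖ * ‖v + v'‖ = ‖v‖ * ‖v‖ + ‖v'‖ * ‖v'‖ :=
      norm_add_sq_eq_norm_sq_add_norm_sq_of_inner_eq_zero _ _ hvv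
    have h2 : ‖a‖ * ‖v + v'‖ = 1 := by rw [← norm_smul, ← hxe, hx]
    have h3 : (‖a‖ * ‖v + v'‖) ^ 2 = 1 := by rw [h2]; norm_num
    rw [mul_pow, sq ‖v + v'‖, h1, hv] at h3
    nlinarith [norm_nonneg v']
  have c2 := FL_claim2 hf hW hM hv hv'n hvv (y := (starRingEnd ℂ) a • y) (by
    rw [norm_smul]; simp only [RCLike.norm_conj]; nlinarith [norm_nonneg y])
  rw [hconj, ← c2]
  have e1 : rankOne ℂ ((starRingEnd ℂ) a • y) (v + v') = rankOne ℂ y x := by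
    ext k
    simp only [rankOne_apply]
    conv_rhs => rw [hxe, inner_smul_left]
    rw [smul_smul, mul_comm]
  rw [e1]
  have e2 : f (rankOne ℂ y x) (v - (starRingEnd ℂ) a • x) = 0 := by
    apply FL_kill hW hM
    · rw [inner_sub_right, inner_smul_right, inner_self_eq_norm_sq_to_K, hx, hconj]; simp
    · rw [hx]; linarith
  rw [map_sub, map_smul, sub_eq_zero] at e2
  exact e2

end FL

open Metric InnerProductSpace

theorem clm_eq_of_small {G F : Type*} [NormedAddCommGroup G] [NormedSpace ℂ G]
    [NormedAddCommGroup F] [NormedSpace ℂ F] (S T : G →L[ℂ] F) (r : ℝ) (hr : 0 < r)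
    (h : ∀ y, ‖y‖ < r → S y = T y) : S = T := by
  ext y
  have hc : ((r / (‖y‖ + 1) : ℝ) : ℂ) ≠ 0 := by
    have : 0 < r / (‖y‖ + 1) := by positivity
    exact_mod_cast this.ne'
  have := h (((r / (‖y‖ + 1) : ℝ) : ℂ) • y) (by
    rw [norm_smul, Complex.norm_real, Real.norm_of_nonneg (by positivity), div_mul_eq_mul_div,
      div_lt_iff₀ (by positivity)]
    nlinarith)
  rw [map_smul, map_smul] at this
  exact smul_right_injective _ hc this

section FL
variable {V W V' W' : Type} [NormedAddCommGroup V] [InnerProductSpace ℂ V] [FiniteDimensional ℂ V]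
  [NormedAddCommGroup W] [InnerProductSpace ℂ W] [FiniteDimensional ℂ W]
  [NormedAddCommGroup V'] [InnerProductSpace ℂ V'] [FiniteDimensional ℂ V']
  [NormedAddCommGroup W'] [InnerProductSpace ℂ W'] [FiniteDimensional ℂ W']

theorem FL_diff {f : (V →L[ℂ] W) → (V →L[ℂ] W')} (hf : PH f) {v : V} (hv : ‖v‖ = 1) :
    DifferentiableOn ℂ (fun y => f (rankOne ℂ y v) v) (ball 0 1) := by
  have hr : Differentiable ℂ (fun y : W => rankOne ℂ y v) := by
    have : (fun y : W => rankOne ℂ y v) = fun y => (ContinuousLinearMap.smulRightL ℂ V W (innerSL ℂ v)) y := by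
      funext y; ext w; simp
    rw [this]; exact ContinuousLinearMap.differentiable _
  exact (hf.diff.comp (t := ball 0 1) hr.differentiableOn (fun y hy => by
    rw [mem_ball_zero_iff, norm_rankOne, hv, mul_one]; simpa using hy)).clm_apply (differentiableOn_const v)

theorem FL_T {f : (V →L[ℂ] W) → (V →L[ℂ] W')} (hf : PH f) (hV : 2 ≤ Module.finrank ℂ V)
    (hW : 2 ≤ Module.finrank ℂ W) (hM : ∀ x u, u ≠ 0 → x ∈ MS f (ℂ ∙ x) (ℂ ∙ u)ᗮ) :
    ∃ T : W →ₗᵢ[ℂ] W', ∀ v : V, ‖v‖ = 1 → ∀ y, ‖y‖ < 1 → f (rankOne ℂ y v) v = T y := by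
  set F : V → W → W' := fun v y => f (rankOne ℂ y v) v with hF
  have hFd : ∀ v, ‖v‖ = 1 → HasFDerivAt (F v) (fderiv ℂ (F v) 0) 0 := fun v hv =>
    ((FL_diff hf hv).differentiableAt (ball_mem_nhds 0 one_pos)).hasFDerivAt
  set c : ℂ := (((√2)⁻¹ : ℝ) : ℂ) with hc
  have hcc : c * c = 1 / 2 := by
    rw [hc, ← Complex.ofReal_mul, ← mul_inv, Real.mul_self_sqrt (by norm_num)]; norm_num
  have hcn : ‖c‖ ^ 2 = 1 / 2 := by
    rw [sq, ← norm_mul, hcc]; norm_num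
  have hcs : (starRingEnd ℂ) c = c := by rw [hc, Complex.conj_ofReal]
  have hpair : ∀ v w : V, ‖v‖ = 1 → ‖w‖ = 1 → inner ℂ v w = 0 → ‖c • (v + w)‖ = 1 ∧
      inner ℂ v (c • (v + w)) = c ∧ inner ℂ w (c • (v + w)) = c := by
    intro v w hv hw hvw
    refine ⟨?_, ?_, ?_⟩
    · have h1 : ‖v + w‖ * ‖v + w‖ = ‖v‖ * ‖v‖ + ‖w‖ * ‖w‖ :=
        norm_add_sq_eq_norm_sq_add_norm_sq_of_inner_eq_zero _ _ hvw
      have h2 : ‖c • (v + w)‖ ^ 2 = 1 := by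
        rw [norm_smul, mul_pow, hcn, sq, h1, hv, hw]; norm_num
      have h3 := norm_nonneg (c • (v + w))
      nlinarith
    · rw [inner_smul_right, inner_add_right, hvw, inner_self_eq_norm_sq_to_K, hv]; simp
    · rw [inner_smul_right, inner_add_right, inner_eq_zero_symm.1 hvw, inner_self_eq_norm_sq_to_K, hw]; simp
  have hlin : ∀ v, ‖v‖ = 1 → ∀ y, ‖y‖ < 1 / 10 → F v y = fderiv ℂ (F v) 0 y := by
    intro v hv y hy
    apply lin_of_half (F v) _ (hFd v hv) (1 / 10) _ y hy
    intro y hy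
    obtain ⟨w, hw, hvw⟩ := exists_orth_unit hV v
    obtain ⟨p1, p2, p3⟩ := hpair v w hv hw hvw
    have p4 : inner ℂ (c • (v + w)) v = c := by rw [← inner_conj_symm, p2, hcs]
    have g1 := FL_G hf hW hM hv p1 (by rw [p2, hcn]) (y := c • y) (by
      rw [norm_smul]; nlinarith [norm_nonneg c, norm_nonneg y])
    have g2 := FL_G hf hW hM p1 hv (by rw [p4, hcn]) hy
    rw [p4] at g1
    rw [p2] at g2
    rw [g2, smul_smul, smul_smul, hcc] at g1
    exact g1
  have hT1 : ∀ v x : V, ‖v‖ = 1 → ‖x‖ = 1 → 1 / 2 ≤ ‖inner ℂ v x‖ ^ 2 →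
      fderiv ℂ (F v) 0 = fderiv ℂ (F x) 0 := by
    intro v x hv hx hvx
    apply clm_eq_of_small _ _ (1 / 10) (by norm_num)
    intro y hy
    have h0 : inner ℂ x v ≠ 0 := by
      intro h
      rw [inner_eq_zero_symm.1 h] at hvx
      norm_num at hvx
    have hn : ‖inner ℂ x v‖ ≤ 1 := by
      have := norm_inner_le_norm (𝕜 := ℂ) x v
      rwa [hv, hx, mul_one] at this
    have g := FL_G hf hW hM hv hx hvx hy
    have l1 := hlin v hv ((inner ℂ x v) • y) (by
      rw [norm_smul]; nlinarith [norm_nonneg y])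
    have l2 := hlin x hx y hy
    have : (inner ℂ x v) • fderiv ℂ (F v) 0 y = (inner ℂ x v) • fderiv ℂ (F x) 0 y := by
      rw [← map_smul, ← l1, ← l2]; exact g
    exact smul_right_injective _ h0 this
  have hT2 : ∀ v w : V, ‖v‖ = 1 → ‖w‖ = 1 → inner ℂ v w = 0 →
      fderiv ℂ (F v) 0 = fderiv ℂ (F w) 0 := by
    intro v w hv hw hvw
    obtain ⟨p1, p2, p3⟩ := hpair v w hv hw hvw
    rw [hT1 v _ hv p1 (by rw [p2, hcn]), hT1 w _ hw p1 (by rw [p3, hcn])]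
  have hT3 : ∀ v x : V, ‖v‖ = 1 → ‖x‖ = 1 → fderiv ℂ (F v) 0 = fderiv ℂ (F x) 0 := by
    intro v x hv hx
    by_cases h : 1 / 2 ≤ ‖inner ℂ v x‖ ^ 2
    · exact hT1 v x hv hx h
    · push Not at h
      set a := inner ℂ v x with ha
      set r := x - a • v with hr
      have hvr : inner ℂ v r = 0 := by
        rw [hr, inner_sub_right, inner_smul_right, ← ha, inner_self_eq_norm_sq_to_K, hv]; simp
      have hxe : x = a • v + r := by rw [hr]; abel
      have hrn : 1 / 2 ≤ ‖r‖ ^ 2 := by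
        have h1 : ‖a • v + r‖ * ‖a • v + r‖ = ‖a • v‖ * ‖a • v‖ + ‖r‖ * ‖r‖ :=
          norm_add_sq_eq_norm_sq_add_norm_sq_of_inner_eq_zero _ _ (by rw [inner_smul_left, hvr, mul_zero])
        rw [← hxe, hx, norm_smul, hv] at h1
        nlinarith
      have hr0 : r ≠ 0 := by intro h; rw [h] at hrn; norm_num at hrn
      clear_value r a
      obtain ⟨w, hw, hrw⟩ := smul_unit r hr0
      have hvw : inner ℂ v w = 0 := by
        rw [hrw, inner_smul_right] at hvr
        simpa [hr0] using hvr
      have hwx : inner ℂ w x = ((‖r‖ : ℝ) : ℂ) := by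
        rw [hxe, inner_add_right, inner_smul_right, inner_eq_zero_symm.1 hvw]
        conv_lhs => rw [hrw]
        rw [inner_smul_right, inner_self_eq_norm_sq_to_K, hw]; simp
      rw [hT2 v w hv hw hvw]
      exact hT1 w x hw hx (by rw [hwx]; simpa using hrn)
  obtain ⟨v0, hv0, -⟩ := exists_orth_unit hV (0 : V)
  set T := fderiv ℂ (F v0) 0 with hT
  have hfull : ∀ v : V, ‖v‖ = 1 → ∀ y, ‖y‖ < 1 → F v y = T y := by
    intro v hv y hy
    have := convex_ident (fun y => F v y - T y) (ball 0 1) isOpen_ball (convex_ball _ _)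
      ((FL_diff hf hv).sub T.differentiable.differentiableOn) 0 (by simp) (by
        filter_upwards [ball_mem_nhds (0 : W) (show (0:ℝ) < 1 / 10 by norm_num)] with y hy
        rw [hlin v hv y (by simpa using hy), hT3 v v0 hv hv0, sub_self]) y (by simpa using hy)
    exact sub_eq_zero.1 this
  have hunit : ∀ u : W, ‖u‖ = 1 → ‖T u‖ = 1 := by
    intro u hu
    have hz : ∀ z : ℂ, ‖z‖ < 1 → f (z • rankOne ℂ u v0) v0 = z • T u := by
      intro z hz
      have := hfull v0 hv0 (z • u) (by rw [norm_smul, hu]; simpa using hz)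
      simp only [hF, map_smul] at this
      simpa using this
    apply le_antisymm
    · by_contra hcon
      push Not at hcon
      have h1 : ‖((‖T u‖⁻¹ : ℝ) : ℂ)‖ < 1 := by
        rw [Complex.norm_real, norm_inv, norm_norm]
        exact inv_lt_one_of_one_lt₀ hcon
      have h2 := hz _ h1
      have h3 := hf.maps (((‖T u‖⁻¹ : ℝ) : ℂ) • rankOne ℂ u v0) (by rw [rk_norm hu hv0]; exact h1)
      have h4 := ContinuousLinearMap.le_opNorm (f (((‖T u‖⁻¹ : ℝ) : ℂ) • rankOne ℂ u v0)) v0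
      rw [h2, norm_smul, Complex.norm_real, norm_inv, norm_norm, inv_mul_cancel₀ (by linarith), hv0] at h4
      linarith
    · by_contra hcon
      push Not at hcon
      obtain ⟨ρ, hρ, H⟩ := FL_near hf hW hM hv0 hu ‖T u‖ (norm_nonneg _) hcon
      obtain ⟨z, hz1, hz2⟩ := exists_between (max_lt hρ one_pos)
      have hz0 : 0 ≤ z := (le_max_right _ _).trans hz1.le
      have hzn : ‖(z : ℂ)‖ = z := by rw [Complex.norm_real, Real.norm_of_nonneg hz0]
      have := H z (by rw [hzn]; exact hz2) (by rw [hzn]; exact lt_of_le_of_lt (le_max_left _ _) hz1)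
      rw [hz _ (by rw [hzn]; exact hz2), norm_smul, hzn] at this
      nlinarith [norm_nonneg (T u)]
  refine ⟨⟨T, fun y => ?_⟩, hfull⟩
  by_cases hy : y = 0
  · simp [hy]
  · obtain ⟨u, hu, hyu⟩ := smul_unit y hy
    have h3 : ‖T y‖ = ‖y‖ := by
      conv_lhs => rw [hyu, map_smul, norm_smul, hunit u hu]
      simp
    exact h3

theorem FL_sing {f : (V →L[ℂ] W) → (V →L[ℂ] W')} (hf : PH f)
    (hW : 2 ≤ Module.finrank ℂ W) (hM : ∀ x u, u ≠ 0 → x ∈ MS f (ℂ ∙ x) (ℂ ∙ u)ᗮ)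
    (T : W →ₗᵢ[ℂ] W') (hT : ∀ v : V, ‖v‖ = 1 → ∀ y, ‖y‖ < 1 → f (rankOne ℂ y v) v = T y)
    (Z : V →L[ℂ] W) (hZ : ‖Z‖ < 1) (e : V) (he : Z e ≠ 0)
    (ho : ∀ v, inner ℂ e v = 0 → inner ℂ (Z e) (Z v) = 0) : f Z e = T (Z e) := by
  have main : ∀ e : V, ‖e‖ = 1 → Z e ≠ 0 → (∀ v, inner ℂ e v = 0 → inner ℂ (Z e) (Z v) = 0) →
      f Z e = T (Z e) := by
    intro e he1 he ho
    have hp : ∀ w, inner ℂ e (w - (inner ℂ e w) • e) = 0 := by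
      intro w
      rw [inner_sub_right, inner_smul_right, inner_self_eq_norm_sq_to_K, he1]; simp
    have hYw : ∀ w, (Z - rankOne ℂ (Z e) e) w = Z (w - (inner ℂ e w) • e) := by
      intro w; simp
    have hze : ‖Z e‖ < 1 := by
      have := Z.le_opNorm e
      rw [he1] at this; linarith
    have := FL_star hf hW hM he1 he hze (Z - rankOne ℂ (Z e) e) (by
      refine lt_of_le_of_lt (ContinuousLinearMap.opNorm_le_bound _ (norm_nonneg Z) fun w => ?_) hZ
      rw [hYw]
      refine (Z.le_opNorm _).trans ?_
      gcongr
      have h1 : ‖(inner ℂ e w) • e + (w - (inner ℂ e w) • e)‖ * ‖(inner ℂ e w) • e + (w - (inner ℂ e w) • e)‖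
        = _ := norm_add_sq_eq_norm_sq_add_norm_sq_of_inner_eq_zero _ _ (by rw [inner_smul_left, hp, mul_zero])
      rw [add_sub_cancel] at h1
      refine abs_le_of_sq_le_sq' ?_ (norm_nonneg w) |>.2
      nlinarith [mul_self_nonneg ‖(inner ℂ e w) • e‖]) (by rw [hYw]; simp [he1]) (by
      intro w; rw [hYw]; exact ho _ (hp w))
    rw [add_sub_cancel] at this
    rw [this, hT e he1 _ hze]
  have he0 : e ≠ 0 := by rintro rfl; simp at he
  obtain ⟨u, hu, heu⟩ := smul_unit e he0
  have hne : ((‖e‖ : ℝ) : ℂ) ≠ 0 := by exact_mod_cast norm_ne_zero_iff.2 he0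
  have hZe : Z e = ((‖e‖ : ℝ) : ℂ) • Z u := by rw [← map_smul, ← heu]
  have := main u hu (by rintro h; apply he; rw [hZe, h, smul_zero]) (by
    intro v hv
    have := ho v (by rw [heu, inner_smul_left, hv, mul_zero])
    rw [hZe, inner_smul_left] at this
    simpa [he0] using this)
  rw [hZe, map_smul, ← this, ← map_smul, ← heu]

theorem FL1 {f : (V →L[ℂ] W) → (V →L[ℂ] W')} (hf : PH f) (f0 : f 0 = 0) (hV : 2 ≤ Module.finrank ℂ V)
    (hW : 2 ≤ Module.finrank ℂ W) (hM : ∀ x u, u ≠ 0 → x ∈ MS f (ℂ ∙ x) (ℂ ∙ u)ᗮ) :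
    ∃ T : W →ₗᵢ[ℂ] W', ∀ Z, ‖Z‖ < 1 → ∀ v, f Z v = T (Z v) := by
  obtain ⟨T, hT⟩ := FL_T hf hV hW hM
  refine ⟨T, fun Z hZ => ?_⟩
  by_cases hZ0 : Z = 0
  · intro v; simp [hZ0, f0]
  have hsym : (ContinuousLinearMap.adjoint Z ∘L Z).toLinearMap.IsSymmetric := by
    intro a b
    simp [ContinuousLinearMap.adjoint_inner_left, ContinuousLinearMap.adjoint_inner_right]
  let b := hsym.eigenvectorBasis rfl
  have hb : ∀ i, ∀ v, inner ℂ (b i) v = 0 → inner ℂ (Z (b i)) (Z v) = 0 := by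
    intro i v hv
    have h1 := hsym.apply_eigenvectorBasis rfl i
    have h2 : inner ℂ (ContinuousLinearMap.adjoint Z (Z (b i))) v = 0 := by
      have h3 : ContinuousLinearMap.adjoint Z (Z (b i)) = _ := h1
      rw [h3, inner_smul_left]
      simp only [mul_eq_zero]
      right; exact hv
    rwa [ContinuousLinearMap.adjoint_inner_left] at h2
  have hbb : ∀ i, f Z (b i) = T (Z (b i)) := by
    intro i
    by_cases hi : Z (b i) ≠ 0
    · exact FL_sing hf hW hM T hT Z hZ (b i) hi (hb i)
    push Not at hi
    obtain ⟨j, hj⟩ : ∃ j, Z (b j) ≠ 0 := by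
      by_contra hcon
      push Not at hcon
      apply hZ0
      have : (Z : V →ₗ[ℂ] W) = 0 := b.toBasis.ext (fun i => by simpa using hcon i)
      ext v; exact LinearMap.congr_fun this v
    have hij : inner ℂ (b j) (b i) = 0 := by
      rw [orthonormal_iff_ite.1 b.orthonormal, if_neg]
      rintro rfl; exact hj hi
    have hbi : ‖b i‖ = 1 := b.orthonormal.1 i
    have hbj : ‖b j‖ = 1 := b.orthonormal.1 j
    set r : ℝ := (1 - ‖Z‖) with hr
    have hr0 : 0 < r := by rw [hr]; linarith
    have hzj : ‖Z (b j)‖ < 1 := by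
      have := Z.le_opNorm (b j)
      rw [hbj] at this; linarith
    have hnorm : ∀ σ : ℂ, ‖σ‖ < r → ‖Z + σ • rankOne ℂ (Z (b j)) (b i)‖ < 1 := by
      intro σ hσ
      refine (norm_add_le _ _).trans_lt ?_
      rw [norm_smul, norm_rankOne, hbi]
      nlinarith [norm_nonneg σ, norm_nonneg (Z (b j))]
    have key := polar_zero (fun p : ℂ × ℂ => f (Z + p.1 • rankOne ℂ (Z (b j)) (b i)) (b j + p.2 • b i) -
      T.toContinuousLinearMap ((Z + p.1 • rankOne ℂ (Z (b j)) (b i)) (b j + p.2 • b i))) r hr0 (by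
      have hmem : ∀ p : ℂ × ℂ, p ∈ ball (0 : ℂ × ℂ) r → ‖p.1‖ < r := by
        intro p hp
        rw [mem_ball_zero_iff, Prod.norm_def, max_lt_iff] at hp
        exact hp.1
      have d1 := hf.diff.comp (t := ball 0 1) (s := ball (0 : ℂ × ℂ) r)
        (f := fun p : ℂ × ℂ => Z + p.1 • rankOne ℂ (Z (b j)) (b i)) (by fun_prop) (fun p hp => by
          simpa using hnorm p.1 (hmem p hp))
      refine (d1.clm_apply (u := fun p : ℂ × ℂ => b j + p.2 • b i) (by fun_prop)).sub ?_
      fun_prop) (by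
      intro t ht
      rw [sub_eq_zero]
      refine FL_sing hf hW hM T hT _ (hnorm t ht) _ ?_ ?_
      · simp only [ContinuousLinearMap.add_apply, map_add, map_smul, hi, ContinuousLinearMap.smul_apply,
          rankOne_apply, inner_eq_zero_symm.1 hij, inner_self_eq_norm_sq_to_K, hbi]
        simp only [smul_zero, add_zero, zero_smul, zero_add, smul_smul]
        intro h
        have h2 : ((1 + ‖t‖ ^ 2 : ℝ) : ℂ) • Z (b j) = 0 := by
          rw [← h]
          have : (t * ((starRingEnd ℂ) t)) = ((‖t‖ ^ 2 : ℝ) : ℂ) := by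
            rw [Complex.mul_conj, Complex.normSq_eq_norm_sq]
          rw [Complex.ofReal_add, add_smul, ← this]; simp [smul_smul, mul_comm]
        rw [smul_eq_zero] at h2
        rcases h2 with h2 | h2
        · have : (1 + ‖t‖ ^ 2 : ℝ) = 0 := by exact_mod_cast h2
          nlinarith [norm_nonneg t]
        · exact hj h2
      · intro v hv
        rw [inner_add_left, inner_smul_left] at hv
        simp only [Complex.conj_conj] at hv
        -- split v along b j, b i
        have hv2 : inner ℂ (b j) v = - (t * inner ℂ (b i) v) := by linear_combination hv
        have e1 : inner ℂ (Z (b j)) (Z v) = inner ℂ (b j) v * inner ℂ (Z (b j)) (Z (b j)) := by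
          have := hb j (v - (inner ℂ (b j) v) • b j) (by
            rw [inner_sub_right, inner_smul_right, inner_self_eq_norm_sq_to_K, hbj]; simp)
          rw [map_sub, map_smul, inner_sub_right, inner_smul_right, sub_eq_zero] at this
          exact this
        have e2 : (Z + t • rankOne ℂ (Z (b j)) (b i)) (b j + (starRingEnd ℂ) t • b i) =
            (1 + t * (starRingEnd ℂ) t) • Z (b j) := by
          simp only [ContinuousLinearMap.add_apply, map_add, map_smul, hi, ContinuousLinearMap.smul_apply,
            rankOne_apply, inner_eq_zero_symm.1 hij, inner_self_eq_norm_sq_to_K, hbi]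
          simp [add_smul, smul_smul, mul_comm]
        rw [e2, inner_smul_left]
        simp only [ContinuousLinearMap.add_apply, ContinuousLinearMap.smul_apply, rankOne_apply,
          inner_add_right, inner_smul_right, e1, hv2]
        ring) 0 (r / 4 : ℝ) (by simpa using hr0) (by
          rw [Complex.norm_real, Real.norm_of_nonneg (by positivity)]; linarith)
    simp only [zero_smul, add_zero, map_add, map_smul, sub_eq_zero, hi, smul_zero] at key
    have hj2 := FL_sing hf hW hM T hT Z hZ (b j) hj (hb j)
    rw [hj2] at key
    simp only [LinearIsometry.coe_toContinuousLinearMap, add_eq_left] at key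
    rw [hi, map_zero]
    have hne : ((r / 4 : ℝ) : ℂ) ≠ 0 := by exact_mod_cast (by positivity : (r / 4) ≠ 0)
    exact (smul_eq_zero.1 key).resolve_left hne
  intro v
  have : (f Z : V →ₗ[ℂ] W') = T.toLinearMap ∘ₗ (Z : V →ₗ[ℂ] W) := b.toBasis.ext (fun i => by simpa using hbb i)
  exact LinearMap.congr_fun this v

end FL

open Metric InnerProductSpace

section
variable {V W V' W' : Type} [NormedAddCommGroup V] [InnerProductSpace ℂ V] [FiniteDimensional ℂ V]
  [NormedAddCommGroup W] [InnerProductSpace ℂ W] [FiniteDimensional ℂ W]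
  [NormedAddCommGroup V'] [InnerProductSpace ℂ V'] [FiniteDimensional ℂ V']
  [NormedAddCommGroup W'] [InnerProductSpace ℂ W'] [FiniteDimensional ℂ W']

theorem PH.comp_iso {V₂ : Type} [NormedAddCommGroup V₂] [InnerProductSpace ℂ V₂]
    {f : (V →L[ℂ] W) → (V' →L[ℂ] W')} (hf : PH f) (U : V₂ ≃ₗᵢ[ℂ] V') :
    PH (fun Z => (f Z).comp (U.toContinuousLinearEquiv : V₂ →L[ℂ] V')) := by
  have key : ∀ A : V' →L[ℂ] W', ‖A.comp (U.toContinuousLinearEquiv : V₂ →L[ℂ] V')‖ = ‖A‖ :=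
    fun A => ContinuousLinearMap.opNorm_comp_linearIsometryEquiv A U
  refine ⟨hf.diff.clm_comp (differentiableOn_const _), ?_, ?_⟩
  · intro Z hZ; rw [key]; exact hf.maps Z hZ
  · intro r hr
    obtain ⟨ρ, h1, h2⟩ := hf.prop r hr
    exact ⟨ρ, h1, fun Z hZ hZ' => by rw [key]; exact h2 Z hZ hZ'⟩

theorem exists_ne_orth (h : 2 ≤ Module.finrank ℂ V) (x : V) : ∃ w, w ≠ 0 ∧ inner ℂ x w = 0 := by
  obtain ⟨w, h1, h2⟩ := exists_orth_unit h x
  exact ⟨w, by rintro rfl; simp at h1, h2⟩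

/-- a bijection preserving orthogonality is a multiple of an isometry -/
theorem exists_iso_of_orth (P : V ≃ₗ[ℂ] V') (hV : 1 ≤ Module.finrank ℂ V)
    (h : ∀ x w, inner ℂ x w = 0 → inner ℂ (P x) (P w) = 0) :
    ∃ (c : ℂ) (_ : c ≠ 0) (U : V ≃ₗᵢ[ℂ] V'), ∀ v, U v = c • P v := by
  obtain ⟨κ, hκ⟩ := sesq_prop (innerₛₗ ℂ : V →ₗ⋆[ℂ] V →ₗ[ℂ] ℂ)
    (LinearMap.mk₂'ₛₗ (starRingEnd ℂ) (RingHom.id ℂ) (fun x w => inner ℂ (P x) (P w))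
      (by intros; simp [inner_add_left]) (by intros; simp [inner_smul_left, mul_comm])
      (by intros; simp [inner_add_right]) (by intros; simp [inner_smul_right]))
    (by intro x w hxw; exact h x w (by simpa using hxw))
  simp only [LinearMap.mk₂'ₛₗ_apply, innerₛₗ_apply_apply] at hκ
  have : Nontrivial V := Module.nontrivial_of_finrank_pos (R := ℂ) hV
  obtain ⟨x, hx⟩ := exists_ne (0 : V)
  have hx' : 0 < ‖x‖ := norm_pos_iff.2 hx
  have hPx : 0 < ‖P x‖ := norm_pos_iff.2 (by simpa using hx)
  have e1 := hκ x x
  rw [inner_self_eq_norm_sq_to_K, inner_self_eq_norm_sq_to_K] at e1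
  have hκ' : κ = ((‖P x‖ ^ 2 / ‖x‖ ^ 2 : ℝ) : ℂ) := by
    have : ((‖x‖ : ℝ) : ℂ) ≠ 0 := by exact_mod_cast hx'.ne'
    push_cast
    rw [eq_div_iff (by positivity)]
    exact e1.symm
  have hn : ∀ v, ‖P v‖ = ‖P x‖ / ‖x‖ * ‖v‖ := by
    intro v
    have e2 := hκ v v
    rw [inner_self_eq_norm_sq_to_K, inner_self_eq_norm_sq_to_K, hκ'] at e2
    have e3 : ‖P v‖ ^ 2 = ‖P x‖ ^ 2 / ‖x‖ ^ 2 * ‖v‖ ^ 2 := by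
      refine Complex.ofReal_injective ?_
      push_cast at e2 ⊢
      exact e2
    rw [← div_pow, ← mul_pow] at e3
    exact (pow_left_inj₀ (norm_nonneg _) (by positivity) two_ne_zero).1 e3
  have hc : ((‖x‖ / ‖P x‖ : ℝ) : ℂ) ≠ 0 := by
    have : 0 < ‖x‖ / ‖P x‖ := by positivity
    exact_mod_cast this.ne'
  refine ⟨((‖x‖ / ‖P x‖ : ℝ) : ℂ), hc,
    ⟨P.trans (LinearEquiv.smulOfNeZero ℂ V' _ hc), ?_⟩, ?_⟩
  · intro v
    simp only [LinearEquiv.trans_apply, LinearEquiv.smulOfNeZero_apply]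
    rw [norm_smul, Complex.norm_real, Real.norm_of_nonneg (by positivity), hn v]
    field_simp
  · intro v; rfl

theorem FL0 {f : (V →L[ℂ] W) → (V' →L[ℂ] W')} (hf : PH f) (f0 : f 0 = 0)
    (hV : 2 ≤ Module.finrank ℂ V) (hW : 2 ≤ Module.finrank ℂ W) (P : V ≃ₗ[ℂ] V')
    (hM : ∀ x u, u ≠ 0 → x ≠ 0 → MS f (ℂ ∙ x) (ℂ ∙ u)ᗮ = ℂ ∙ (P x)) :
    ∃ (T : W →ₗᵢ[ℂ] W') (U : V' ≃ₗᵢ[ℂ] V), ∀ Z, ‖Z‖ < 1 → ∀ m, f Z m = T (Z (U m)) := by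
  have : Nontrivial W := Module.nontrivial_of_finrank_pos (R := ℂ) (by omega)
  have horth : ∀ x w, inner ℂ x w = 0 → inner ℂ (P x) (P w) = 0 := by
    intro x w hxw
    by_cases hx : x = 0
    · simp [hx]
    by_cases hw : w = 0
    · simp [hw]
    obtain ⟨u, hu⟩ := exists_ne (0 : W)
    obtain ⟨v, hv, huv⟩ := exists_ne_orth hW u
    obtain ⟨m, hm0, hm1, hm2⟩ := KL hf f0 hu hx
    rw [hM x u hu hx] at hm1
    obtain ⟨c, rfl⟩ := Submodule.mem_span_singleton.1 hm1
    have hc : c ≠ 0 := by rintro rfl; simp at hm0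
    have h1 : P w ∈ MS f (ℂ ∙ x)ᗮ (ℂ ∙ u) := by
      refine MS_mono f (K := ℂ ∙ w) (T := (ℂ ∙ v)ᗮ) ?_ ?_ ?_
      · rw [Submodule.span_singleton_le_iff_mem, Submodule.mem_orthogonal_singleton_iff_inner_right]
        exact hxw
      · rw [Submodule.span_singleton_le_iff_mem, Submodule.mem_orthogonal_singleton_iff_inner_left]
        exact huv
      · rw [hM w v hv hw]; exact Submodule.mem_span_singleton_self _
    have h2 := hm2 _ h1
    rw [inner_smul_right, mul_eq_zero] at h2
    exact inner_eq_zero_symm.1 (h2.resolve_left hc)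
  obtain ⟨c, hc, U, hU⟩ := exists_iso_of_orth P (by omega) horth
  obtain ⟨T, hT⟩ := FL1 (hf.comp_iso U) (by simp [f0]) hV hW (by
    intro x u hu
    by_cases hx : x = 0
    · subst hx; exact Submodule.zero_mem _
    intro Z hZ hN
    have : P x ∈ MS f (ℂ ∙ x) (ℂ ∙ u)ᗮ := by
      rw [hM x u hu hx]; exact Submodule.mem_span_singleton_self _
    have := this Z hZ hN
    simp [hU, this])
  refine ⟨T, U.symm, fun Z hZ m => ?_⟩
  rw [← hT Z hZ]
  simp

end

open Metric InnerProductSpace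

section
variable {V W V' W' : Type} [NormedAddCommGroup V] [InnerProductSpace ℂ V] [FiniteDimensional ℂ V]
  [NormedAddCommGroup W] [InnerProductSpace ℂ W] [FiniteDimensional ℂ W]
  [NormedAddCommGroup V'] [InnerProductSpace ℂ V'] [FiniteDimensional ℂ V']
  [NormedAddCommGroup W'] [InnerProductSpace ℂ W'] [FiniteDimensional ℂ W']

/-- the indefinite hermitian form -/
noncomputable def hform (a b : V × W) : ℂ := inner ℂ a.1 b.1 - inner ℂ a.2 b.2

theorem norm_lt_one_of_pt (Z : V →L[ℂ] W) (h : ∀ v, v ≠ 0 → ‖Z v‖ < ‖v‖) : ‖Z‖ < 1 := by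
  by_cases hV : ∀ v : V, v = 0
  · have : Z = 0 := by ext v; simp [hV v]
    simp [this]
  push Not at hV
  obtain ⟨v0, hv0⟩ := hV
  have : ProperSpace V := FiniteDimensional.proper ℂ V
  have : Nontrivial V := ⟨v0, 0, hv0⟩
  have hc : IsCompact (sphere (0:V) 1) := isCompact_sphere _ _
  have hne : (sphere (0:V) 1).Nonempty := by
    obtain ⟨u, hu, -⟩ := smul_unit v0 hv0
    exact ⟨u, by simpa using hu⟩
  obtain ⟨u, hu, hmax⟩ := hc.exists_isMaxOn hne (f := fun v => ‖Z v‖) (by fun_prop)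
  have hu1 : ‖u‖ = 1 := by simpa using hu
  have hlt : ‖Z u‖ < 1 := by
    have := h u (by rintro rfl; simp at hu1)
    rwa [hu1] at this
  refine lt_of_le_of_lt (ContinuousLinearMap.opNorm_le_bound Z (norm_nonneg (Z u)) ?_) hlt
  intro v
  by_cases hv : v = 0
  · simp [hv]
  obtain ⟨w, hw, e⟩ := smul_unit v hv
  have := hmax (show w ∈ sphere (0:V) 1 by simpa using hw)
  simp only [Set.mem_ofPred_eq] at this
  conv_lhs => rw [e]
  rw [map_smul, norm_smul, Complex.norm_real, norm_norm, mul_comm]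
  gcongr

theorem pt_of_norm_lt_one {Z : V →L[ℂ] W} (h : ‖Z‖ < 1) {v : V} (hv : v ≠ 0) : ‖Z v‖ < ‖v‖ := by
  have := Z.le_opNorm v
  have := norm_pos_iff.2 hv
  nlinarith

/-- isometries of the indefinite form -/
def IsMob (g : (V × W) ≃L[ℂ] (V × W)) : Prop := ∀ a b, hform (g a) (g b) = hform a b

theorem IsMob.symm {g : (V × W) ≃L[ℂ] (V × W)} (hg : IsMob g) : IsMob g.symm := by
  intro a b
  have := hg (g.symm a) (g.symm b)
  simpa using this.symm

noncomputable def graphMap (Z : V →L[ℂ] W) : V →L[ℂ] V × W := (ContinuousLinearMap.id ℂ V).prod Z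

noncomputable def mobA (g : (V × W) ≃L[ℂ] (V × W)) (Z : V →L[ℂ] W) : V →L[ℂ] V :=
  (ContinuousLinearMap.fst ℂ V W).comp ((g : (V × W) →L[ℂ] (V × W)).comp
    ((ContinuousLinearMap.id ℂ V).prod Z))

noncomputable def mobC (g : (V × W) ≃L[ℂ] (V × W)) (Z : V →L[ℂ] W) : V →L[ℂ] W :=
  (ContinuousLinearMap.snd ℂ V W).comp ((g : (V × W) →L[ℂ] (V × W)).comp
    ((ContinuousLinearMap.id ℂ V).prod Z))

theorem mobA_apply (g : (V × W) ≃L[ℂ] (V × W)) (Z : V →L[ℂ] W) (v : V) :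
    mobA g Z v = (g (v, Z v)).1 := rfl

theorem mobC_apply (g : (V × W) ≃L[ℂ] (V × W)) (Z : V →L[ℂ] W) (v : V) :
    mobC g Z v = (g (v, Z v)).2 := rfl

noncomputable def act (g : (V × W) ≃L[ℂ] (V × W)) (Z : V →L[ℂ] W) : V →L[ℂ] W :=
  (mobC g Z).comp (Ring.inverse (mobA g Z))

theorem hform_self (a : V × W) : hform a a = ((‖a.1‖ ^ 2 - ‖a.2‖ ^ 2 : ℝ) : ℂ) := by
  unfold hform
  rw [inner_self_eq_norm_sq_to_K, inner_self_eq_norm_sq_to_K]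
  push_cast
  rfl

theorem IsMob.norms {g : (V × W) ≃L[ℂ] (V × W)} (hg : IsMob g) (a : V × W) :
    ‖(g a).1‖ ^ 2 - ‖(g a).2‖ ^ 2 = ‖a.1‖ ^ 2 - ‖a.2‖ ^ 2 := by
  have := hg a a
  rw [hform_self, hform_self] at this
  exact Complex.ofReal_injective this

theorem IsMob.inj {g : (V × W) ≃L[ℂ] (V × W)} (hg : IsMob g) {Z : V →L[ℂ] W} (hZ : ‖Z‖ < 1) :
    Function.Injective (mobA g Z) := by
  rw [injective_iff_map_eq_zero]
  intro v hv
  by_contra hv0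
  have h1 := hg.norms (v, Z v)
  have h2 := pt_of_norm_lt_one hZ hv0
  rw [mobA_apply] at hv
  rw [hv] at h1
  simp only [norm_zero] at h1
  nlinarith [norm_nonneg (Z v), norm_nonneg v, norm_nonneg ((g (v, Z v)).2)]

theorem isUnit_of_inj {A : V →L[ℂ] V} (h : Function.Injective A) : IsUnit A := by
  let e := LinearEquiv.ofInjectiveEndo (A : V →ₗ[ℂ] V) h
  exact ⟨ContinuousLinearEquiv.toUnit e.toContinuousLinearEquiv, by ext v; rfl⟩

theorem IsMob.isUnit {g : (V × W) ≃L[ℂ] (V × W)} (hg : IsMob g) {Z : V →L[ℂ] W} (hZ : ‖Z‖ < 1) :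
    IsUnit (mobA g Z) := isUnit_of_inj (hg.inj hZ)

theorem IsMob.surj {g : (V × W) ≃L[ℂ] (V × W)} (hg : IsMob g) {Z : V →L[ℂ] W} (hZ : ‖Z‖ < 1) :
    Function.Surjective (mobA g Z) :=
  LinearMap.surjective_of_injective (f := (mobA g Z : V →ₗ[ℂ] V)) (hg.inj hZ)

theorem IsMob.act_apply {g : (V × W) ≃L[ℂ] (V × W)} (hg : IsMob g) {Z : V →L[ℂ] W} (hZ : ‖Z‖ < 1)
    (v : V) : act g Z (g (v, Z v)).1 = (g (v, Z v)).2 := by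
  rw [← mobA_apply, ← mobC_apply]
  unfold act
  have : Ring.inverse (mobA g Z) (mobA g Z v) = v := by
    have := Ring.inverse_mul_cancel _ (hg.isUnit hZ)
    exact DFunLike.congr_fun this v
  simp [this]

theorem IsMob.act_eq {g : (V × W) ≃L[ℂ] (V × W)} (hg : IsMob g) {Z Y : V →L[ℂ] W} (hZ : ‖Z‖ < 1)
    (h : ∀ v, Y (g (v, Z v)).1 = (g (v, Z v)).2) : act g Z = Y := by
  ext m
  obtain ⟨v, rfl⟩ := hg.surj hZ m
  rw [mobA_apply, hg.act_apply hZ, h]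

/-- the graph transforms -/
theorem IsMob.graph_iff {g : (V × W) ≃L[ℂ] (V × W)} (hg : IsMob g) {Z : V →L[ℂ] W} (hZ : ‖Z‖ < 1)
    (a : V × W) : act g Z (g a).1 = (g a).2 ↔ Z a.1 = a.2 := by
  constructor
  · intro h
    obtain ⟨v, hv⟩ := hg.surj hZ (g a).1
    rw [mobA_apply] at hv
    rw [← hv, hg.act_apply hZ] at h
    have : g (v, Z v) = g a := Prod.ext hv h
    have := g.injective this
    rw [← this]
  · intro h
    have := hg.act_apply hZ a.1
    rw [h] at this
    exact this

theorem IsMob.maps {g : (V × W) ≃L[ℂ] (V × W)} (hg : IsMob g) {Z : V →L[ℂ] W} (hZ : ‖Z‖ < 1) :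
    ‖act g Z‖ < 1 := by
  apply norm_lt_one_of_pt
  intro m hm
  obtain ⟨v, rfl⟩ := hg.surj hZ m
  have hv : v ≠ 0 := by rintro rfl; simp at hm
  rw [mobA_apply, hg.act_apply hZ]
  have h1 := hg.norms (v, Z v)
  have h2 := pt_of_norm_lt_one hZ hv
  simp only at h1
  have h3 : ‖(g (v, Z v)).2‖ ^ 2 < ‖(g (v, Z v)).1‖ ^ 2 := by
    nlinarith [norm_nonneg (Z v), norm_nonneg v]
  exact lt_of_pow_lt_pow_left₀ 2 (norm_nonneg _) h3

theorem IsMob.symm_act {g : (V × W) ≃L[ℂ] (V × W)} (hg : IsMob g) {Z : V →L[ℂ] W} (hZ : ‖Z‖ < 1) :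
    act g.symm (act g Z) = Z := by
  apply hg.symm.act_eq (hg.maps hZ)
  intro m
  have := hg.graph_iff hZ (g.symm (m, act g Z m))
  simp only [ContinuousLinearEquiv.apply_symm_apply, true_iff] at this
  exact this

theorem IsMob.act_symm {g : (V × W) ≃L[ℂ] (V × W)} (hg : IsMob g) {Z : V →L[ℂ] W} (hZ : ‖Z‖ < 1) :
    act g (act g.symm Z) = Z := by
  have := hg.symm.symm_act hZ
  simpa using this

theorem mobA_diff (g : (V × W) ≃L[ℂ] (V × W)) : Differentiable ℂ (mobA g) := by
  have : mobA g = fun Z => (ContinuousLinearMap.compL ℂ V (V × W) V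
    ((ContinuousLinearMap.fst ℂ V W).comp (g : (V × W) →L[ℂ] (V × W))))
    ((ContinuousLinearMap.inl ℂ V W) + (ContinuousLinearMap.inr ℂ V W).comp Z) := by
    funext Z; ext v
    have : (v, Z v) = (v, 0) + ((0, Z v) : V × W) := by simp
    simp [mobA_apply]; rw [this, map_add]; rfl
  rw [this]
  fun_prop

theorem mobC_diff (g : (V × W) ≃L[ℂ] (V × W)) : Differentiable ℂ (mobC g) := by
  have : mobC g = fun Z => (ContinuousLinearMap.compL ℂ V (V × W) W
    ((ContinuousLinearMap.snd ℂ V W).comp (g : (V × W) →L[ℂ] (V × W))))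
    ((ContinuousLinearMap.inl ℂ V W) + (ContinuousLinearMap.inr ℂ V W).comp Z) := by
    funext Z; ext v
    have : (v, Z v) = (v, 0) + ((0, Z v) : V × W) := by simp
    simp [mobC_apply]; rw [this, map_add]; rfl
  rw [this]
  fun_prop

theorem IsMob.diffAt {g : (V × W) ≃L[ℂ] (V × W)} (hg : IsMob g) {Z : V →L[ℂ] W} (hZ : ‖Z‖ < 1) :
    DifferentiableAt ℂ (act g) Z := by
  obtain ⟨u, hu⟩ := hg.isUnit hZ
  have : CompleteSpace V := FiniteDimensional.complete ℂ V
  have h1 : DifferentiableAt ℂ Ring.inverse (mobA g Z) := by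
    rw [← hu]; exact differentiableAt_inverse u.isUnit
  exact (mobC_diff g Z).clm_comp (h1.comp Z (mobA_diff g Z))

theorem IsMob.diffOn {g : (V × W) ≃L[ℂ] (V × W)} (hg : IsMob g) :
    DifferentiableOn ℂ (act g) (ball (0 : V →L[ℂ] W) 1) :=
  fun _ hZ => (hg.diffAt (by simpa using hZ)).differentiableWithinAt

theorem IsMob.bound {g : (V × W) ≃L[ℂ] (V × W)} (hg : IsMob g) (r : ℝ) (hr : r < 1) :
    ∃ r' < (1:ℝ), ∀ Z, ‖Z‖ ≤ r → ‖act g Z‖ ≤ r' := by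
  have : ProperSpace (V →L[ℂ] W) := FiniteDimensional.proper ℂ _
  by_cases hr0 : 0 ≤ r
  · have hc : IsCompact (closedBall (0 : V →L[ℂ] W) r) := isCompact_closedBall _ _
    have hcont : ContinuousOn (fun Z : V →L[ℂ] W => ‖act g Z‖) (closedBall 0 r) := by
      refine (hg.diffOn.continuousOn.mono ?_).norm
      exact closedBall_subset_ball hr
    obtain ⟨Z0, hZ0, hmax⟩ := hc.exists_isMaxOn ⟨0, by simpa using hr0⟩ hcont
    refine ⟨‖act g Z0‖, hg.maps (lt_of_le_of_lt (by simpa using hZ0) hr), fun Z hZ => ?_⟩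
    exact hmax (show Z ∈ closedBall (0 : V →L[ℂ] W) r by simpa using hZ)
  · exact ⟨0, one_pos, fun Z hZ => absurd ((norm_nonneg Z).trans hZ) hr0⟩

theorem PH.mob {f : (V →L[ℂ] W) → (V' →L[ℂ] W')} (hf : PH f) {g : (V × W) ≃L[ℂ] (V × W)}
    (hg : IsMob g) {g' : (V' × W') ≃L[ℂ] (V' × W')} (hg' : IsMob g') :
    PH (fun Z => act g' (f (act g Z))) := by
  refine ⟨?_, ?_, ?_⟩
  · refine hg'.diffOn.comp (hf.diff.comp hg.diffOn ?_) ?_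
    · intro Z hZ; simpa using hg.maps (by simpa using hZ)
    · intro Z hZ; simpa using hf.maps _ (hg.maps (by simpa using hZ))
  · intro Z hZ; exact hg'.maps (hf.maps _ (hg.maps hZ))
  · intro r hr
    obtain ⟨r', hr', h1⟩ := hg'.symm.bound r hr
    obtain ⟨ρ, hρ, h2⟩ := hf.prop r' hr'
    obtain ⟨ρ', hρ', h3⟩ := hg.symm.bound ρ hρ
    refine ⟨ρ', hρ', fun Z hZ hZ' => ?_⟩
    by_contra hcon
    push Not at hcon
    have e1 := h1 _ hcon
    rw [hg'.symm_act (hf.maps _ (hg.maps hZ))] at e1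
    have e2 : ‖act g Z‖ ≤ ρ := by
      by_contra hc2
      push Not at hc2
      exact absurd (h2 _ (hg.maps hZ) hc2) (not_lt.2 e1)
    have e3 := h3 _ e2
    rw [hg.symm_act hZ] at e3
    linarith

/-- inverse square roots -/
theorem exists_inv_sqrt (S : V →L[ℂ] V) (hS : (S : V →ₗ[ℂ] V).IsSymmetric)
    (hpos : ∀ v, v ≠ 0 → 0 < (inner ℂ (S v) v : ℂ).re) :
    ∃ A : V →L[ℂ] V, ∀ a b, inner ℂ (S (A a)) (A b) = inner ℂ a b := by
  classical
  let b := hS.eigenvectorBasis rfl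
  let l := hS.eigenvalues rfl
  have hSb : ∀ i, S (b i) = ((l i : ℝ) : ℂ) • b i := fun i => hS.apply_eigenvectorBasis rfl i
  have hl : ∀ i, 0 < l i := by
    intro i
    have := hpos (b i) (b.orthonormal.ne_zero i)
    rw [hSb, inner_smul_left, inner_self_eq_norm_sq_to_K, b.orthonormal.1 i] at this
    simpa using this
  let A0 : V →ₗ[ℂ] V := b.toBasis.constr ℂ (fun i => (((Real.sqrt (l i))⁻¹ : ℝ) : ℂ) • b i)
  have hA : ∀ i, A0 (b i) = (((Real.sqrt (l i))⁻¹ : ℝ) : ℂ) • b i := by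
    intro i
    have := b.toBasis.constr_basis ℂ (fun i => (((Real.sqrt (l i))⁻¹ : ℝ) : ℂ) • b i) i
    rw [OrthonormalBasis.coe_toBasis] at this
    exact this
  refine ⟨LinearMap.toContinuousLinearMap A0, ?_⟩
  have key : ∀ i j, inner ℂ (S (A0 (b i))) (A0 (b j)) = inner ℂ (b i) (b j) := by
    intro i j
    rw [hA, hA, map_smul, hSb, inner_smul_left, inner_smul_right, inner_smul_left]
    have := orthonormal_iff_ite.1 b.orthonormal i j
    rw [this]
    by_cases hij : i = j
    · subst hij
      simp only [if_true, Complex.conj_ofReal, mul_one]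
      norm_cast
      have := Real.mul_self_sqrt (hl i).le
      have h2 := Real.sqrt_pos.2 (hl i)
      field_simp
      nlinarith
    · simp [hij]
  intro x y
  have ex : x = ∑ i, b.repr x i • b i := (b.sum_repr x).symm
  have ey : y = ∑ i, b.repr y i • b i := (b.sum_repr y).symm
  simp only [LinearMap.coe_toContinuousLinearMap']
  rw [ex, ey]
  simp only [map_sum, map_smul, sum_inner, inner_sum, inner_smul_left, inner_smul_right, key]

theorem exists_mob (Z0 : V →L[ℂ] W) (hZ0 : ‖Z0‖ < 1) :
    ∃ g : (V × W) ≃L[ℂ] (V × W), IsMob g ∧ act g 0 = Z0 := by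
  have : CompleteSpace V := FiniteDimensional.complete ℂ V
  have : CompleteSpace W := FiniteDimensional.complete ℂ W
  let Zs := ContinuousLinearMap.adjoint Z0
  have hZs : ‖Zs‖ < 1 := by simpa [Zs] using hZ0
  have e1 : ∀ v w, inner ℂ (Zs w) v = inner ℂ w (Z0 v) := fun v w =>
    ContinuousLinearMap.adjoint_inner_left Z0 v w
  have e2 : ∀ v w, inner ℂ v (Zs w) = inner ℂ (Z0 v) w := fun v w =>
    ContinuousLinearMap.adjoint_inner_right Z0 v w
  obtain ⟨A, hA⟩ := exists_inv_sqrt (ContinuousLinearMap.id ℂ V - Zs.comp Z0) (by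
    intro v w; simp [inner_sub_left, inner_sub_right, e1, e2]) (by
    intro v hv
    have := pt_of_norm_lt_one hZ0 hv
    simp only [ContinuousLinearMap.sub_apply, ContinuousLinearMap.id_apply,
      ContinuousLinearMap.comp_apply, inner_sub_left, e1, inner_self_eq_norm_sq_to_K]
    have h3 : ‖Z0 v‖ ^ 2 < ‖v‖ ^ 2 := by gcongr
    have h4 : ((‖v‖ : ℂ) ^ 2 - (‖Z0 v‖ : ℂ) ^ 2) = ((‖v‖ ^ 2 - ‖Z0 v‖ ^ 2 : ℝ) : ℂ) := by push_cast; rfl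
    show 0 < ((‖v‖ : ℂ) ^ 2 - (‖Z0 v‖ : ℂ) ^ 2).re
    rw [h4, Complex.ofReal_re]
    linarith)
  obtain ⟨D, hD⟩ := exists_inv_sqrt (ContinuousLinearMap.id ℂ W - Z0.comp Zs) (by
    intro v w; simp [inner_sub_left, inner_sub_right, ← e1, ← e2]) (by
    intro v hv
    have := pt_of_norm_lt_one hZs hv
    simp only [ContinuousLinearMap.sub_apply, ContinuousLinearMap.id_apply,
      ContinuousLinearMap.comp_apply, inner_sub_left, ← e2, inner_self_eq_norm_sq_to_K]
    have h3 : ‖Zs v‖ ^ 2 < ‖v‖ ^ 2 := by gcongr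
    have h4 : ((‖v‖ : ℂ) ^ 2 - (‖Zs v‖ : ℂ) ^ 2) = ((‖v‖ ^ 2 - ‖Zs v‖ ^ 2 : ℝ) : ℂ) := by push_cast; rfl
    show 0 < ((‖v‖ : ℂ) ^ 2 - (‖Zs v‖ : ℂ) ^ 2).re
    rw [h4, Complex.ofReal_re]
    linarith)
  simp only [ContinuousLinearMap.sub_apply, ContinuousLinearMap.id_apply,
      ContinuousLinearMap.comp_apply, inner_sub_left, e1] at hA
  simp only [ContinuousLinearMap.sub_apply, ContinuousLinearMap.id_apply,
      ContinuousLinearMap.comp_apply, inner_sub_left, ← e2] at hD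
  let G : (V × W) →L[ℂ] (V × W) :=
    (A.comp (ContinuousLinearMap.fst ℂ V W) + (Zs.comp D).comp (ContinuousLinearMap.snd ℂ V W)).prod
    ((Z0.comp A).comp (ContinuousLinearMap.fst ℂ V W) + D.comp (ContinuousLinearMap.snd ℂ V W))
  have hG : ∀ a, G a = (A a.1 + Zs (D a.2), Z0 (A a.1) + D a.2) := fun a => rfl
  have hpres : ∀ a b, hform (G a) (G b) = hform a b := by
    intro a b
    rw [hG, hG]
    unfold hform
    rw [← hA a.1 b.1, ← hD a.2 b.2]
    simp only [inner_add_left, inner_add_right, e1, e2, map_add]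
    have e3 : inner ℂ (Z0 (Zs (D a.2))) (D b.2) = inner ℂ (D a.2) (Z0 (Zs (D b.2))) := by
      rw [← e2, e1]
    rw [e3]
    ring
  have hinj : Function.Injective (G : (V × W) →ₗ[ℂ] (V × W)) := by
    rw [← LinearMap.ker_eq_bot, LinearMap.ker_eq_bot']
    intro a ha
    have ha' : G a = 0 := ha
    have h1 := hpres a (a.1, -a.2)
    rw [ha'] at h1
    simp only [hform, Prod.fst_zero, Prod.snd_zero, inner_zero_left, inner_neg_right, sub_neg_eq_add,
      sub_zero, inner_self_eq_norm_sq_to_K] at h1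
    have h2 : ‖a.1‖ ^ 2 + ‖a.2‖ ^ 2 = 0 := by
      refine Complex.ofReal_injective ?_
      push_cast
      exact h1.symm
    have h3 : ‖a.1‖ = 0 := by nlinarith [norm_nonneg a.1, norm_nonneg a.2]
    have h4 : ‖a.2‖ = 0 := by nlinarith [norm_nonneg a.1, norm_nonneg a.2]
    exact Prod.ext (by simpa using h3) (by simpa using h4)
  let g := (LinearEquiv.ofInjectiveEndo (G : (V × W) →ₗ[ℂ] (V × W)) hinj).toContinuousLinearEquiv
  have hg : ∀ a, g a = G a := fun a => rfl
  have hm : IsMob g := fun a b => by rw [hg, hg, hpres]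
  refine ⟨g, hm, hm.act_eq (by simp) ?_⟩
  intro v
  rw [hg, hG]
  simp

theorem act_fderiv {g : (V × W) ≃L[ℂ] (V × W)} (hg : IsMob g) {Z : V →L[ℂ] W} (hZ : ‖Z‖ < 1)
    (Y : V →L[ℂ] W) (v : V) : fderiv ℂ (act g) Z Y (mobA g Z v) =
      (g (0, Y v)).2 - act g Z (g (0, Y v)).1 := by
  have hev : (fun Z' : V →L[ℂ] W => act g Z' (mobA g Z' v)) =ᶠ[nhds Z] fun Z' => mobC g Z' v := by
    have : ball (0 : V →L[ℂ] W) 1 ∈ nhds Z := isOpen_ball.mem_nhds (by simpa using hZ)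
    filter_upwards [this] with Z' hZ'
    exact hg.act_apply (by simpa using hZ') v
  have key : ∀ Z' : V →L[ℂ] W, mobA g Z' v = (g (v, 0)).1 + (g (0, Z' v)).1 := by
    intro Z'; rw [mobA_apply, ← Prod.fst_add, ← map_add]; simp
  have key2 : ∀ Z' : V →L[ℂ] W, mobC g Z' v = (g (v, 0)).2 + (g (0, Z' v)).2 := by
    intro Z'; rw [mobC_apply, ← Prod.snd_add, ← map_add]; simp
  let B : (V →L[ℂ] W) →L[ℂ] V := ((ContinuousLinearMap.fst ℂ V W).comp
    ((g : (V × W) →L[ℂ] (V × W)).comp (ContinuousLinearMap.inr ℂ V W))).comp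
    (ContinuousLinearMap.apply ℂ W v)
  let D : (V →L[ℂ] W) →L[ℂ] W := ((ContinuousLinearMap.snd ℂ V W).comp
    ((g : (V × W) →L[ℂ] (V × W)).comp (ContinuousLinearMap.inr ℂ V W))).comp
    (ContinuousLinearMap.apply ℂ W v)
  have dA : HasFDerivAt (fun Z' : V →L[ℂ] W => mobA g Z' v) B Z := by
    have : (fun Z' : V →L[ℂ] W => mobA g Z' v) = fun Z' => (g (v, 0)).1 + B Z' := by
      funext Z'; rw [key]; rfl
    rw [this]
    exact B.hasFDerivAt.const_add _
  have dC : HasFDerivAt (fun Z' : V →L[ℂ] W => mobC g Z' v) D Z := by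
    have : (fun Z' : V →L[ℂ] W => mobC g Z' v) = fun Z' => (g (v, 0)).2 + D Z' := by
      funext Z'; rw [key2]; rfl
    rw [this]
    exact D.hasFDerivAt.const_add _
  have d1 := ((hg.diffAt hZ).hasFDerivAt.clm_apply dA).congr_of_eventuallyEq hev.symm
  have := DFunLike.congr_fun (d1.unique dC) Y
  simp only [ContinuousLinearMap.add_apply, ContinuousLinearMap.comp_apply,
    ContinuousLinearMap.flip_apply] at this
  have hB : B Y = (g (0, Y v)).1 := rfl
  have hD : D Y = (g (0, Y v)).2 := rfl
  rw [hB, hD] at this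
  rw [← this]
  abel

theorem mob_delta_inj {g : (V × W) ≃L[ℂ] (V × W)} (hg : IsMob g) {Z : V →L[ℂ] W} (hZ : ‖Z‖ < 1)
    (w : W) (h : (g (0, w)).2 - act g Z (g (0, w)).1 = 0) : w = 0 := by
  have := (hg.graph_iff hZ (0, w)).1 (sub_eq_zero.1 h).symm
  simpa using this.symm

/-- normalisation at a base point -/
theorem PH.normalise {f : (V →L[ℂ] W) → (V' →L[ℂ] W')} (hf : PH f) (Z0 : V →L[ℂ] W) (hZ0 : ‖Z0‖ < 1) :
    ∃ (g : (V × W) ≃L[ℂ] (V × W)) (g' : (V' × W') ≃L[ℂ] (V' × W')), IsMob g ∧ IsMob g' ∧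
      act g 0 = Z0 ∧ act g' (f Z0) = 0 ∧ PH (fun Z => act g' (f (act g Z))) := by
  obtain ⟨g, hg, e⟩ := exists_mob Z0 hZ0
  obtain ⟨h, hh, e'⟩ := exists_mob (f Z0) (hf.maps _ hZ0)
  refine ⟨g, h.symm, hg, hh.symm, e, ?_, hf.mob hg hh.symm⟩
  rw [← e', hh.symm_act (by simp)]

end

open Metric InnerProductSpace

section
variable {V W V' W' : Type} [NormedAddCommGroup V] [InnerProductSpace ℂ V] [FiniteDimensional ℂ V]
  [NormedAddCommGroup W] [InnerProductSpace ℂ W] [FiniteDimensional ℂ W]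
  [NormedAddCommGroup V'] [InnerProductSpace ℂ V'] [FiniteDimensional ℂ V']
  [NormedAddCommGroup W'] [InnerProductSpace ℂ W'] [FiniteDimensional ℂ W']

theorem PH.diffAt {f : (V →L[ℂ] W) → (V' →L[ℂ] W')} (hf : PH f) {Z : V →L[ℂ] W} (hZ : ‖Z‖ < 1) :
    DifferentiableAt ℂ f Z :=
  hf.diff.differentiableAt (isOpen_ball.mem_nhds (by simpa using hZ))

/-- the first derivative along a line -/
theorem hasDerivAt_line {f : (V →L[ℂ] W) → (V' →L[ℂ] W')} {Z : V →L[ℂ] W}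
    (h : DifferentiableAt ℂ f Z) (Y : V →L[ℂ] W) (m : V') :
    HasDerivAt (fun t : ℂ => f (Z + t • Y) m) (fderiv ℂ f Z Y m) 0 := by
  have h1 : HasDerivAt (fun t : ℂ => Z + t • Y) Y 0 := by
    simpa using ((hasDerivAt_id (0:ℂ)).smul_const Y).const_add Z
  have h0 : HasFDerivAt f (fderiv ℂ f Z) (Z + (0:ℂ) • Y) := by simpa using h.hasFDerivAt
  have h2 : HasDerivAt (fun t : ℂ => f (Z + t • Y)) (fderiv ℂ f Z Y) 0 :=
    h0.comp_hasDerivAt (0:ℂ) h1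
  have h3 := h2.clm_apply (hasDerivAt_const (0:ℂ) m)
  simpa using h3

theorem small_line {Z : V →L[ℂ] W} (hZ : ‖Z‖ < 1) (Y : V →L[ℂ] W) :
    ∀ᶠ t in nhds (0:ℂ), ‖Z + t • Y‖ < 1 := by
  have : ContinuousAt (fun t : ℂ => ‖Z + t • Y‖) 0 := by fun_prop
  exact this.eventually_lt continuousAt_const (by simpa using hZ)

theorem fderiv_MS {f : (V →L[ℂ] W) → (V' →L[ℂ] W')} (hf : PH f)
    {K : Submodule ℂ V} {T : Submodule ℂ W} {m : V'}
    (hm : m ∈ MS f K T) {Y : V →L[ℂ] W} (hY : NS K T Y) : fderiv ℂ f 0 Y m = 0 := by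
  have h1 := hasDerivAt_line (hf.diffAt (Z := 0) (by simp)) Y m
  have h2 : (fun t : ℂ => f (0 + t • Y) m) =ᶠ[nhds 0] fun _ => 0 := by
    filter_upwards [small_line (Z := 0) (by simp) Y] with t ht
    apply hm _ ht
    rw [zero_add]
    exact ⟨fun k hk => by simp [hY.1 k hk], fun v => T.smul_mem _ (hY.2 v)⟩
  exact (h1.congr_of_eventuallyEq h2.symm).unique (hasDerivAt_const (0:ℂ) (0:W'))

theorem sum_rankOne {ι : Type*} [Fintype ι] (b : OrthonormalBasis ι ℂ V) (Y : V →L[ℂ] W) :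
    Y = ∑ i, rankOne ℂ (Y (b i)) (b i) := by
  ext v
  conv_lhs => rw [← b.sum_repr' v]
  simp [map_sum]

theorem exists_rankOne_ne {E : Type*} [NormedAddCommGroup E] [NormedSpace ℂ E]
    (F : (V →L[ℂ] W) →L[ℂ] E) (hF : F ≠ 0) : ∃ u x, F (rankOne ℂ u x) ≠ 0 := by
  by_contra hcon
  push Not at hcon
  apply hF
  ext Y
  rw [sum_rankOne (stdOrthonormalBasis ℂ V) Y, map_sum]
  simp [hcon]

theorem exists_riesz (S : V →ₗ⋆[ℂ] V' →ₗ[ℂ] ℂ) : ∃ B : V' →ₗ[ℂ] V, ∀ v m, inner ℂ v (B m) = S v m := by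
  let b := stdOrthonormalBasis ℂ V
  refine ⟨∑ i, (S (b i)).smulRight (b i), fun v m => ?_⟩
  conv_rhs => rw [← b.sum_repr' v]
  simp only [LinearMap.sum_apply, LinearMap.smulRight_apply, inner_sum, inner_smul_right, map_sum,
    LinearMap.map_smulₛₗ, LinearMap.smul_apply, smul_eq_mul, inner_conj_symm]
  exact Finset.sum_congr rfl fun i _ => mul_comm _ _

/-- the sesquilinear pairing of the derivative -/
theorem exists_Bs (F : (V →L[ℂ] W) →L[ℂ] (V' →L[ℂ] W')) (u : W) (n : W') :
    ∃ B : V' →ₗ[ℂ] V, ∀ v m, inner ℂ v (B m) = inner ℂ n (F (rankOne ℂ u v) m) := by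
  obtain ⟨B, hB⟩ := exists_riesz (V := V) (V' := V')
    (LinearMap.mk₂'ₛₗ (starRingEnd ℂ) (RingHom.id ℂ) (fun v m => inner ℂ n (F (rankOne ℂ u v) m))
      (by intros; simp [inner_add_right]) (by intros; simp [inner_smul_right])
      (by intros; simp [inner_add_right]) (by intros; simp [inner_smul_right]))
  exact ⟨B, fun v m => by rw [hB]; rfl⟩

theorem exists_onb_with {x : V} (hx : ‖x‖ = 1) :
    ∃ (b : OrthonormalBasis (Fin (Module.finrank ℂ V)) ℂ V) (i : Fin (Module.finrank ℂ V)), b i = x := by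
  have hV : 0 < Module.finrank ℂ V := by
    have : Nontrivial V := ⟨x, 0, by rintro rfl; simp at hx⟩
    exact Module.finrank_pos
  let i0 : Fin (Module.finrank ℂ V) := ⟨0, hV⟩
  obtain ⟨b, hb⟩ := Orthonormal.exists_orthonormalBasis_extension_of_card_eq (𝕜 := ℂ) (E := V)
    (ι := Fin (Module.finrank ℂ V)) (by simp) (v := fun _ => x) (s := {i0}) (by
      constructor
      · intro i; simpa using hx
      · intro i j hij; exact absurd (Subsingleton.elim i j) hij)
  exact ⟨b, i0, hb i0 rfl⟩

theorem mem_span_of_orth {x y : V} (h : ∀ v, inner ℂ v x = 0 → inner ℂ v y = 0) : y ∈ (ℂ ∙ x) := by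
  rw [← Submodule.orthogonal_orthogonal (ℂ ∙ x)]
  intro v hv
  rw [Submodule.mem_orthogonal_singleton_iff_inner_left] at hv
  exact h v hv

theorem PH.nontriv {f : (V →L[ℂ] W) → (V' →L[ℂ] W')} (hf : PH f) (hV : 1 ≤ Module.finrank ℂ V)
    (hW : 1 ≤ Module.finrank ℂ W) : ∃ Z0, ‖Z0‖ < 1 ∧ fderiv ℂ f Z0 ≠ 0 := by
  by_contra hcon
  push Not at hcon
  have hconst : ∀ Z, ‖Z‖ < 1 → f Z = f 0 := by
    intro Z hZ
    refine (convex_ball (0 : V →L[ℂ] W) 1).is_const_of_fderivWithin_eq_zero (𝕜 := ℂ) hf.diff ?_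
      (by simpa using hZ) (by simp)
    intro Y hY
    rw [fderivWithin_of_isOpen isOpen_ball hY]
    exact hcon Y (by simpa using hY)
  obtain ⟨ρ, hρ, h⟩ := hf.prop _ (hf.maps 0 (by simp))
  have : Nontrivial V := Module.nontrivial_of_finrank_pos (R := ℂ) hV
  have : Nontrivial W := Module.nontrivial_of_finrank_pos (R := ℂ) hW
  obtain ⟨x, hx⟩ := exists_ne (0:V)
  obtain ⟨w, hw⟩ := exists_ne (0:W)
  obtain ⟨x, hx, -⟩ := smul_unit x hx
  obtain ⟨w, hw, -⟩ := smul_unit w hw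
  obtain ⟨t, ht1, ht2⟩ := exists_between (max_lt hρ one_pos)
  have ht0 : 0 < t := lt_of_le_of_lt (le_max_right _ _) ht1
  have hn : ‖(t : ℂ) • rankOne ℂ w x‖ = t := by
    rw [rk_norm hw hx, Complex.norm_real, Real.norm_of_nonneg ht0.le]
  have := h ((t : ℂ) • rankOne ℂ w x) (by rw [hn]; exact ht2)
    (by rw [hn]; exact lt_of_le_of_lt (le_max_left _ _) ht1)
  rw [hconst ((t : ℂ) • rankOne ℂ w x) (by rw [hn]; exact ht2)] at this
  exact lt_irrefl _ this

theorem PH.normalise_deriv {f : (V →L[ℂ] W) → (V' →L[ℂ] W')} (hf : PH f)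
    {g : (V × W) ≃L[ℂ] (V × W)} (hg : IsMob g) {g' : (V' × W') ≃L[ℂ] (V' × W')} (hg' : IsMob g')
    (h : fderiv ℂ f (act g 0) ≠ 0) : fderiv ℂ (fun Z => act g' (f (act g Z))) 0 ≠ 0 := by
  intro h0
  apply h
  have hF := hf.mob hg hg'
  set F := fun Z => act g' (f (act g Z)) with hFdef
  have hn : ‖act g (0 : V →L[ℂ] W)‖ < 1 := hg.maps (by simp)
  have hev : f =ᶠ[nhds (act g 0)] fun Z => act g'.symm (F (act g.symm Z)) := by
    have : ball (0 : V →L[ℂ] W) 1 ∈ nhds (act g 0) := isOpen_ball.mem_nhds (by simpa using hn)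
    filter_upwards [this] with Z hZ
    have hZ' : ‖Z‖ < 1 := by simpa using hZ
    rw [hFdef]
    simp only
    rw [hg.act_symm hZ', hg'.symm_act (hf.maps _ hZ')]
  have d1 : HasFDerivAt (act g.symm) (fderiv ℂ (act g.symm) (act g 0)) (act g 0) :=
    (hg.symm.diffAt hn).hasFDerivAt
  have e0 : act g.symm (act g 0) = (0 : V →L[ℂ] W) := hg.symm_act (by simp)
  have d2 : HasFDerivAt F (0 : (V →L[ℂ] W) →L[ℂ] (V' →L[ℂ] W')) (act g.symm (act g 0)) := by
    rw [e0, ← h0]; exact (hF.diffAt (by simp)).hasFDerivAt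
  have d3 : HasFDerivAt (act g'.symm) (fderiv ℂ (act g'.symm) (F (act g.symm (act g 0))))
    (F (act g.symm (act g 0))) := (hg'.symm.diffAt (by rw [e0]; exact hF.maps 0 (by simp))).hasFDerivAt
  have d4 := d3.comp (act g 0) (d2.comp (act g 0) d1)
  have := (d4.congr_of_eventuallyEq hev).fderiv
  rw [this]
  simp

theorem finrank_orth_singleton {u : W} (hu : u ≠ 0) :
    Module.finrank ℂ ((ℂ ∙ u)ᗮ : Submodule ℂ W) + 1 = Module.finrank ℂ W := by
  have h2 := Submodule.finrank_add_finrank_orthogonal (ℂ ∙ u)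
  have h3 := finrank_span_singleton (K := ℂ) hu
  omega

theorem CA0 {f : (V →L[ℂ] W) → (V' →L[ℂ] W')} (hf : PH f) (f0 : f 0 = 0)
    (hV : 2 ≤ Module.finrank ℂ V) (hVV : Module.finrank ℂ V' = Module.finrank ℂ V)
    (hW : Module.finrank ℂ V < Module.finrank ℂ W) (hd : fderiv ℂ f 0 ≠ 0) :
    ∃ (T : W →ₗᵢ[ℂ] W') (U : V' ≃ₗᵢ[ℂ] V), ∀ Z, ‖Z‖ < 1 → ∀ m, f Z m = T (Z (U m)) := by
  have : Nontrivial W := Module.nontrivial_of_finrank_pos (R := ℂ) (by omega)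
  obtain ⟨u0, hu0⟩ := exists_ne (0 : W)
  have hdim : ∀ (x : V), x ≠ 0 → ∀ T : Submodule ℂ W, Module.finrank ℂ V - 1 ≤ Module.finrank ℂ T →
      Module.finrank ℂ (MS f (ℂ ∙ x) T) ≤ 1 := by
    intro x hx T hT
    have := RI_aux hf f0 (Module.finrank ℂ V - 1) (ℂ ∙ x) T
      (by rw [finrank_span_singleton hx]; omega) hT
    omega
  have hex : ∀ x : V, ∃ m : V', x ≠ 0 → m ≠ 0 ∧ ∀ u : W, u ≠ 0 → MS f (ℂ ∙ x) (ℂ ∙ u)ᗮ = ℂ ∙ m := by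
    intro x
    by_cases hx : x = 0
    · exact ⟨0, fun h => absurd hx h⟩
    obtain ⟨m, hm0, hm1, -⟩ := KL hf f0 hu0 hx
    refine ⟨m, fun _ => ⟨hm0, fun u hu => ?_⟩⟩
    have hle : ∀ v : W, v ≠ 0 → ∀ a ∈ MS f (ℂ ∙ x) (ℂ ∙ v)ᗮ, a ≠ 0 →
        MS f (ℂ ∙ x) ((ℂ ∙ u0)ᗮ ⊓ (ℂ ∙ u)ᗮ) ≤ (ℂ ∙ a) ∨ ¬ (v = u0 ∨ v = u) := by
      intro v hv a ha ha0
      by_cases hvv : v = u0 ∨ v = u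
      · left
        have h1 : (ℂ ∙ a) ≤ MS f (ℂ ∙ x) ((ℂ ∙ u0)ᗮ ⊓ (ℂ ∙ u)ᗮ) := by
          rw [Submodule.span_singleton_le_iff_mem]
          refine MS_mono f le_rfl ?_ ha
          rcases hvv with rfl | rfl
          · exact inf_le_left
          · exact inf_le_right
        have h2 := hdim x hx ((ℂ ∙ u0)ᗮ ⊓ (ℂ ∙ u)ᗮ) (by
          have := finrank_inf_orth (ℂ ∙ u0)ᗮ hu
          have := finrank_orth_singleton hu0
          omega)
        exact (Submodule.eq_of_le_of_finrank_le h1 (by rw [finrank_span_singleton ha0]; exact h2)).ge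
      · exact Or.inr hvv
    obtain ⟨a, ha0, ha1, -⟩ := KL hf f0 hu hx
    have k1 := (hle u0 hu0 m hm1 hm0).resolve_right (by simp)
    have k2 := (hle u hu a ha1 ha0).resolve_right (by simp)
    have hmm : m ∈ MS f (ℂ ∙ x) ((ℂ ∙ u0)ᗮ ⊓ (ℂ ∙ u)ᗮ) := MS_mono f le_rfl inf_le_left hm1
    obtain ⟨c, hc⟩ := Submodule.mem_span_singleton.1 (k2 hmm)
    apply le_antisymm
    · exact (MS_mono f le_rfl inf_le_right).trans k1
    · rw [Submodule.span_singleton_le_iff_mem, ← hc]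
      exact Submodule.smul_mem _ _ ha1
  choose X hX using hex
  have horth : ∀ x w, x ≠ 0 → w ≠ 0 → inner ℂ x w = 0 → inner ℂ (X x) (X w) = 0 := by
    intro x w hx hw hxw
    obtain ⟨v, hv, huv⟩ := exists_ne_orth (by omega) u0
    obtain ⟨m, hm0, hm1, hm2⟩ := KL hf f0 hu0 hx
    rw [(hX x hx).2 u0 hu0] at hm1
    obtain ⟨c, rfl⟩ := Submodule.mem_span_singleton.1 hm1
    have hc : c ≠ 0 := by rintro rfl; simp at hm0
    have h1 : X w ∈ MS f (ℂ ∙ x)ᗮ (ℂ ∙ u0) := by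
      refine MS_mono f (K := ℂ ∙ w) (T := (ℂ ∙ v)ᗮ) ?_ ?_ ?_
      · rw [Submodule.span_singleton_le_iff_mem, Submodule.mem_orthogonal_singleton_iff_inner_right]
        exact hxw
      · rw [Submodule.span_singleton_le_iff_mem, Submodule.mem_orthogonal_singleton_iff_inner_left]
        exact huv
      · rw [(hX w hw).2 v hv]; exact Submodule.mem_span_singleton_self _
    have h2 := hm2 _ h1
    rw [inner_smul_right, mul_eq_zero] at h2
    exact inner_eq_zero_symm.1 (h2.resolve_left hc)
  have hkill : ∀ x v u, x ≠ 0 → inner ℂ v x = 0 → fderiv ℂ f 0 (rankOne ℂ u v) (X x) = 0 := by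
    intro x v u hx hvx
    obtain ⟨w, hw, huw⟩ := exists_ne_orth (V := W) (by omega) u
    refine fderiv_MS hf (K := ℂ ∙ x) (T := (ℂ ∙ w)ᗮ) ?_ ?_
    · rw [(hX x hx).2 w hw]; exact Submodule.mem_span_singleton_self _
    · constructor
      · intro k hk
        obtain ⟨c, rfl⟩ := Submodule.mem_span_singleton.1 hk
        simp [hvx]
      · intro z
        rw [rankOne_apply, Submodule.mem_orthogonal_singleton_iff_inner_left, inner_smul_left, huw,
          mul_zero]
  obtain ⟨u, x0, hux⟩ := exists_rankOne_ne _ hd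
  obtain ⟨m0, hm0⟩ : ∃ m, fderiv ℂ f 0 (rankOne ℂ u x0) m ≠ 0 := by
    by_contra hcon
    push Not at hcon
    exact hux (ContinuousLinearMap.ext hcon)
  obtain ⟨B, hB⟩ := exists_Bs (fderiv ℂ f 0) u (fderiv ℂ f 0 (rankOne ℂ u x0) m0)
  have hB0 : B m0 ≠ 0 := by
    intro h
    have := hB x0 m0
    rw [h, inner_zero_right] at this
    exact hm0 (inner_self_eq_zero.1 this.symm)
  have hBX : ∀ x, x ≠ 0 → B (X x) ∈ (ℂ ∙ x) := by
    intro x hx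
    apply mem_span_of_orth
    intro v hv
    rw [hB, hkill x v u hx hv, inner_zero_right]
  -- nonvanishing
  have hne1 : ∀ x1, ‖x1‖ = 1 → B (X x1) ≠ 0 := by
    intro x1 hx1 hzero
    obtain ⟨b, i, hbi⟩ := exists_onb_with hx1
    have hbne : ∀ j, b j ≠ 0 := fun j => b.orthonormal.ne_zero j
    obtain ⟨j, hj⟩ : ∃ j, B (X (b j)) ≠ 0 := by
      by_contra hcon
      push Not at hcon
      have hli : LinearIndependent ℂ (fun j => X (b j)) := by
        apply linearIndependent_of_ne_zero_of_inner_eq_zero (𝕜 := ℂ)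
        · intro j; exact (hX _ (hbne j)).1
        · intro j k hjk
          exact horth _ _ (hbne j) (hbne k) (b.orthonormal.2 hjk)
      have hsp := hli.span_eq_top_of_card_eq_finrank' (by simp [hVV])
      apply hB0
      have : m0 ∈ Submodule.span ℂ (Set.range fun j => X (b j)) := by rw [hsp]; trivial
      have hle : Submodule.span ℂ (Set.range fun j => X (b j)) ≤ LinearMap.ker B := by
        rw [Submodule.span_le]
        rintro _ ⟨j, rfl⟩
        exact hcon j
      exact hle this
    have hji : i ≠ j := by rintro rfl; exact hj (by rw [hbi]; exact hzero)
    set x2 := b j with hx2def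
    have hx2 : ‖x2‖ = 1 := b.orthonormal.1 j
    have h12 : inner ℂ x1 x2 = 0 := by rw [← hbi]; exact b.orthonormal.2 hji
    have h21 : inner ℂ x2 x1 = 0 := inner_eq_zero_symm.1 h12
    have hx1n : x1 ≠ 0 := by rw [← hbi]; exact hbne i
    have hx2n : x2 ≠ 0 := hbne j
    clear_value x2
    have hli0 : LinearIndependent ℂ ![x1, x2] := by
      apply linearIndependent_of_ne_zero_of_inner_eq_zero (𝕜 := ℂ)
      · intro k; fin_cases k <;> simp [hx1n, hx2n]
      · intro k l hkl; fin_cases k <;> fin_cases l <;> simp_all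
    have hliX : LinearIndependent ℂ ![X x1, X x2] := by
      apply linearIndependent_of_ne_zero_of_inner_eq_zero (𝕜 := ℂ)
      · intro k; fin_cases k <;> simp [(hX _ hx1n).1, (hX _ hx2n).1]
      · intro k l hkl
        fin_cases k <;> fin_cases l <;> simp_all [horth x1 x2 hx1n hx2n h12, horth x2 x1 hx2n hx1n h21]
    have fr0 : Module.finrank ℂ (Submodule.span ℂ (Set.range ![x1, x2])) = 2 := by
      simpa using finrank_span_eq_card hli0
    have frX : Module.finrank ℂ (Submodule.span ℂ (Set.range ![X x1, X x2])) = 2 := by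
      simpa using finrank_span_eq_card hliX
    rw [Matrix.range_cons_cons_empty] at fr0 frX
    obtain ⟨u1, hu1⟩ := exists_ne (0 : W)
    have hM2 : Module.finrank ℂ (MS f (Submodule.span ℂ {x1, x2}) (ℂ ∙ u1)ᗮ) ≤ 2 := by
      have := RI_aux hf f0 (Module.finrank ℂ V - 2) (Submodule.span ℂ {x1, x2}) (ℂ ∙ u1)ᗮ
        (by omega) (by have := finrank_orth_singleton hu1; omega)
      omega
    have hin : ∀ y ∈ Submodule.span ℂ {x1, x2}, y ≠ 0 →
        X y ∈ MS f (Submodule.span ℂ {x1, x2}) (ℂ ∙ u1)ᗮ := by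
      intro y hy hy0
      refine MS_mono f (K := ℂ ∙ y) ?_ le_rfl ?_
      · rw [Submodule.span_singleton_le_iff_mem]; exact hy
      · rw [(hX y hy0).2 u1 hu1]; exact Submodule.mem_span_singleton_self _
    have hx1s : x1 ∈ Submodule.span ℂ {x1, x2} := Submodule.subset_span (by simp)
    have hx2s : x2 ∈ Submodule.span ℂ {x1, x2} := Submodule.subset_span (by simp)
    have hspan : Submodule.span ℂ {X x1, X x2} = MS f (Submodule.span ℂ {x1, x2}) (ℂ ∙ u1)ᗮ := by
      apply Submodule.eq_of_le_of_finrank_le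
      · rw [Submodule.span_le]
        rintro z (rfl | rfl)
        · exact hin _ hx1s hx1n
        · exact hin _ hx2s hx2n
      · omega
    obtain ⟨l, hl⟩ := Submodule.mem_span_singleton.1 (hBX x2 hx2n)
    have hl0 : l ≠ 0 := by rintro rfl; rw [zero_smul] at hl; exact hj hl.symm
    have hpm : ∀ s : ℂ, s ≠ 0 → X (x1 + s • x2) ∈ (ℂ ∙ X x1) ∧ x1 + s • x2 ≠ 0 := by
      intro s hs
      have hne : x1 + s • x2 ≠ 0 := by
        intro h
        have := congrArg (inner ℂ x1) h
        rw [inner_add_right, inner_smul_right, h12, inner_self_eq_norm_sq_to_K, hx1] at this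
        simp at this
      refine ⟨?_, hne⟩
      have h1 := hin (x1 + s • x2) (Submodule.add_mem _ hx1s (Submodule.smul_mem _ _ hx2s)) hne
      rw [← hspan, Submodule.mem_span_pair] at h1
      obtain ⟨a, b', hab⟩ := h1
      have h2 := hBX _ hne
      obtain ⟨c, hc⟩ := Submodule.mem_span_singleton.1 h2
      rw [← hab, map_add, map_smul, map_smul, hzero, smul_zero, zero_add, ← hl] at hc
      have e1 := congrArg (inner ℂ x1) hc
      simp only [inner_add_right, inner_smul_right, h12, inner_self_eq_norm_sq_to_K, hx1] at e1
      have hc0 : c = 0 := by simpa using e1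
      have e2 := congrArg (inner ℂ x2) hc
      simp only [inner_add_right, inner_smul_right, h21, inner_self_eq_norm_sq_to_K, hx2, hc0] at e2
      have hb0 : b' = 0 := by
        have : 0 = b' * l := by simpa using e2
        exact (mul_eq_zero.1 this.symm).resolve_right hl0
      rw [← hab, hb0, zero_smul, add_zero]
      exact Submodule.smul_mem _ _ (Submodule.mem_span_singleton_self _)
    obtain ⟨hp1, hp2⟩ := hpm 1 one_ne_zero
    obtain ⟨hq1, hq2⟩ := hpm (-1) (by norm_num)
    obtain ⟨a, ha⟩ := Submodule.mem_span_singleton.1 hp1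
    obtain ⟨c, hc⟩ := Submodule.mem_span_singleton.1 hq1
    have horth2 := horth _ _ hp2 hq2 (by
      simp only [inner_add_right, inner_add_left, inner_smul_left, inner_smul_right, h12, h21,
        inner_self_eq_norm_sq_to_K, hx1, hx2]
      simp)
    rw [← ha, ← hc, inner_smul_left, inner_smul_right] at horth2
    have ha0 : a ≠ 0 := by rintro rfl; exact (hX _ hp2).1 (by rw [← ha, zero_smul])
    have hc0 : c ≠ 0 := by rintro rfl; exact (hX _ hq2).1 (by rw [← hc, zero_smul])
    have : inner ℂ (X x1) (X x1) = 0 := by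
      rcases mul_eq_zero.1 horth2 with h | h
      · exact absurd h (by simpa using ha0)
      · exact (mul_eq_zero.1 h).resolve_left hc0
    exact (hX x1 hx1n).1 (inner_self_eq_zero.1 this)
  have hlam : ∀ x, ‖x‖ = 1 → ∃ m, B m = x := by
    intro x hx
    have hxn : x ≠ 0 := by rintro rfl; simp at hx
    obtain ⟨l, hl⟩ := Submodule.mem_span_singleton.1 (hBX x hxn)
    have hl0 : l ≠ 0 := by rintro rfl; rw [zero_smul] at hl; exact hne1 x hx hl.symm
    exact ⟨l⁻¹ • X x, by rw [map_smul, ← hl, smul_smul, inv_mul_cancel₀ hl0, one_smul]⟩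
  have hsurj : Function.Surjective B := by
    intro x
    by_cases hx : x = 0
    · exact ⟨0, by simp [hx]⟩
    obtain ⟨w, hw, e⟩ := smul_unit x hx
    obtain ⟨m, hm⟩ := hlam w hw
    exact ⟨((‖x‖ : ℝ) : ℂ) • m, by rw [map_smul, hm, ← e]⟩
  have hinj : Function.Injective B := (LinearMap.injective_iff_surjective_of_finrank_eq_finrank hVV).2 hsurj
  let E : V' ≃ₗ[ℂ] V := LinearEquiv.ofBijective B ⟨hinj, hsurj⟩
  refine FL0 hf f0 hV (by omega) E.symm ?_
  intro x v hv hx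
  rw [(hX x hx).2 v hv]
  obtain ⟨l, hl⟩ := Submodule.mem_span_singleton.1 (hBX x hx)
  have hl0 : l ≠ 0 := by
    rintro rfl; rw [zero_smul] at hl
    exact (hX x hx).1 (hinj (by rw [← hl, map_zero]))
  have e1 : X x = l • E.symm x := by
    apply E.injective
    rw [map_smul, LinearEquiv.apply_symm_apply]
    exact hl.symm
  rw [e1]
  exact Submodule.span_singleton_smul_eq (Ne.isUnit hl0) _

theorem CA {f : (V →L[ℂ] W) → (V' →L[ℂ] W')} (hf : PH f)
    (hV : 2 ≤ Module.finrank ℂ V) (hVV : Module.finrank ℂ V' = Module.finrank ℂ V)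
    (hW : Module.finrank ℂ V < Module.finrank ℂ W) :
    ∃ (g : (V × W) ≃L[ℂ] (V × W)) (g' : (V' × W') ≃L[ℂ] (V' × W')), IsMob g ∧ IsMob g' ∧
    ∃ (T : W →ₗᵢ[ℂ] W') (U : V' ≃ₗᵢ[ℂ] V), ∀ Z, ‖Z‖ < 1 → ∀ m, act g' (f (act g Z)) m = T (Z (U m)) := by
  obtain ⟨Z0, hZ0, hd⟩ := hf.nontriv (by omega) (by omega)
  obtain ⟨g, g', hg, hg', e1, e2, hF⟩ := hf.normalise Z0 hZ0
  refine ⟨g, g', hg, hg', ?_⟩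
  exact CA0 hF (by simp only [e1, e2]) hV hVV hW (hf.normalise_deriv hg hg' (by rw [e1]; exact hd))

end

open Metric InnerProductSpace

theorem inj_open {X E F : Type*} [TopologicalSpace X] [NormedAddCommGroup E] [NormedSpace ℂ E]
    [FiniteDimensional ℂ E] [NormedAddCommGroup F] [NormedSpace ℂ F] [FiniteDimensional ℂ F]
    (L : X → E →L[ℂ] F) (c : X)
    (hL : ContinuousAt L c) (hi : Function.Injective (L c)) :
    ∀ᶠ x in nhds c, Function.Injective (L x) := by
  have : CompleteSpace E := FiniteDimensional.complete ℂ E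
  obtain ⟨B, hB⟩ := LinearMap.exists_leftInverse_of_injective (L c : E →ₗ[ℂ] F)
    (LinearMap.ker_eq_bot.2 hi)
  let Bc : F →L[ℂ] E := LinearMap.toContinuousLinearMap B
  have h1 : ContinuousAt (fun x => Bc.comp (L x)) c := by
    exact (ContinuousLinearMap.compL ℂ E F E Bc).continuous.continuousAt.comp hL
  have h2 : Bc.comp (L c) = 1 := by
    ext v; exact DFunLike.congr_fun hB v
  have h3 : {A : E →L[ℂ] E | IsUnit A} ∈ nhds (Bc.comp (L c)) := by
    rw [h2]; exact Units.isOpen.mem_nhds isUnit_one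
  filter_upwards [h1 h3] with x hx
  obtain ⟨u, hu⟩ := hx
  intro v w hvw
  have e : ∀ z, (u : E →L[ℂ] E) z = Bc (L x z) := fun z => by rw [hu]; rfl
  have e2 : ∀ z, ((u⁻¹ : (E →L[ℂ] E)ˣ) : E →L[ℂ] E) ((u : E →L[ℂ] E) z) = z := fun z => by
    have := u.inv_mul; exact DFunLike.congr_fun this z
  rw [← e2 v, ← e2 w, e, e, hvw]

section
variable {V W V' W' : Type} [NormedAddCommGroup V] [InnerProductSpace ℂ V] [FiniteDimensional ℂ V]
  [NormedAddCommGroup W] [InnerProductSpace ℂ W] [FiniteDimensional ℂ W]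
  [NormedAddCommGroup V'] [InnerProductSpace ℂ V'] [FiniteDimensional ℂ V']
  [NormedAddCommGroup W'] [InnerProductSpace ℂ W'] [FiniteDimensional ℂ W']

theorem exists_isometry_of_le (h : Module.finrank ℂ V ≤ Module.finrank ℂ W) :
    Nonempty (V →ₗᵢ[ℂ] W) := by
  let b := stdOrthonormalBasis ℂ V
  let b' := stdOrthonormalBasis ℂ W
  let A : V →ₗ[ℂ] W := b.toBasis.constr ℂ (fun i => b' (Fin.castLE h i))
  have hA : ∀ i, A (b i) = b' (Fin.castLE h i) := by
    intro i
    have := b.toBasis.constr_basis ℂ (fun i => b' (Fin.castLE h i)) i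
    rw [OrthonormalBasis.coe_toBasis] at this
    exact this
  refine ⟨LinearMap.isometryOfOrthonormal A (v := b.toBasis) (by simpa using b.orthonormal) ?_⟩
  have : A ∘ b.toBasis = b' ∘ Fin.castLE h := by
    funext i; simp [hA]
  rw [this]
  exact b'.orthonormal.comp _ (Fin.castLE_injective h)

theorem exists_unitary_into (R T : Submodule ℂ W) (h : Module.finrank ℂ R ≤ Module.finrank ℂ T) :
    ∃ A : W ≃ₗᵢ[ℂ] W, ∀ w ∈ R, A w ∈ T := by
  obtain ⟨L⟩ := exists_isometry_of_le h
  let L' : R →ₗᵢ[ℂ] W := T.subtypeₗᵢ.comp L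
  refine ⟨LinearIsometry.toLinearIsometryEquiv L'.extend rfl, fun w hw => ?_⟩
  have := LinearIsometry.extend_apply L' ⟨w, hw⟩
  simp only at this
  rw [LinearIsometry.coe_toLinearIsometryEquiv, this]
  exact (L ⟨w, hw⟩).2

theorem exists_submodule_finrank (t : ℕ) (ht : t ≤ Module.finrank ℂ W) :
    ∃ T : Submodule ℂ W, Module.finrank ℂ T = t := by
  obtain ⟨s, hs1, hs2⟩ := exists_finset_linearIndependent_of_le_finrank (R := ℂ) (M := W) ht
  exact ⟨Submodule.span ℂ (s : Set W), by rw [finrank_span_finset_eq_card hs2, hs1]⟩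

/-- dimension at least one for proper `T` -/
theorem CL_pos {f : (V →L[ℂ] W) → (V' →L[ℂ] W')} (hf : PH f) (f0 : f 0 = 0) {x : V} (hx : x ≠ 0)
    (T : Submodule ℂ W) (hT : Module.finrank ℂ T < Module.finrank ℂ W) :
    1 ≤ Module.finrank ℂ (MS f (ℂ ∙ x) T ⊓ (MS f (ℂ ∙ x)ᗮ ⊤)ᗮ : Submodule ℂ V') := by
  obtain ⟨u, hu, hu0⟩ : ∃ u ∈ Tᗮ, u ≠ 0 := by
    apply Submodule.exists_mem_ne_zero_of_ne_bot
    intro h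
    have := Submodule.finrank_add_finrank_orthogonal T
    rw [h, finrank_bot] at this
    omega
  obtain ⟨m, hm0, hm1, hm2⟩ := KL hf f0 hu0 hx
  have hTu : T ≤ (ℂ ∙ u)ᗮ := by
    intro w hw
    rw [Submodule.mem_orthogonal_singleton_iff_inner_left]
    exact hu w hw
  have hm : m ∈ (MS f (ℂ ∙ x) T ⊓ (MS f (ℂ ∙ x)ᗮ ⊤)ᗮ : Submodule ℂ V') :=
    ⟨MS_mono f le_rfl hTu hm1, Submodule.orthogonal_le (MS_mono f le_rfl le_top) hm2⟩
  have : Nontrivial (MS f (ℂ ∙ x) T ⊓ (MS f (ℂ ∙ x)ᗮ ⊤)ᗮ : Submodule ℂ V') :=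
    ⟨⟨m, hm⟩, 0, by intro h; exact hm0 (congrArg Subtype.val h)⟩
  exact Module.finrank_pos

/-- a stable choice of `T0` -/
theorem CL_stable (c : Submodule ℂ W → ℕ) (q1 p D : ℕ) (hp : p = Module.finrank ℂ W)
    (h1 : ∀ T : Submodule ℂ W, Module.finrank ℂ T < p → 1 ≤ c T)
    (h2 : ∀ T : Submodule ℂ W, q1 ≤ Module.finrank ℂ T → c T ≤ D)
    (hD : q1 + D < p) :
    ∃ T0 : Submodule ℂ W, q1 ≤ Module.finrank ℂ T0 ∧ Module.finrank ℂ T0 < p ∧ ∀ T : Submodule ℂ W,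
      Module.finrank ℂ T0 ≤ Module.finrank ℂ T → Module.finrank ℂ T ≤ Module.finrank ℂ T0 + 1 →
      c T0 ≤ c T := by
  let S : ℕ → Set ℕ := fun t => {n | ∃ T : Submodule ℂ W, Module.finrank ℂ T = t ∧ c T = n}
  have hS : ∀ t ≤ p, (S t).Nonempty := by
    intro t ht
    obtain ⟨T, hT⟩ := exists_submodule_finrank (W := W) t (hp ▸ ht)
    exact ⟨c T, T, hT, rfl⟩
  have hle : ∀ T : Submodule ℂ W, sInf (S (Module.finrank ℂ T)) ≤ c T := fun T => Nat.sInf_le ⟨T, rfl, rfl⟩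
  by_contra hcon
  push Not at hcon
  have hdec : ∀ k, q1 + k < p → sInf (S (q1 + k)) + k ≤ D := by
    intro k
    induction k with
    | zero =>
      intro hk
      obtain ⟨T, hT, e⟩ := Nat.sInf_mem (hS q1 (by omega))
      rw [add_zero, add_zero, ← e]
      exact h2 T hT.ge
    | succ k ih =>
      intro hk
      have hi := ih (by omega)
      obtain ⟨T0, hT0, e⟩ := Nat.sInf_mem (hS (q1 + k) (by omega))
      obtain ⟨T, ha, hb, hlt⟩ := hcon T0 (by omega) (by omega)
      have h3 := hle T
      have : Module.finrank ℂ T = q1 + k ∨ Module.finrank ℂ T = q1 + (k + 1) := by omega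
      rcases this with h | h
      · rw [h] at h3; omega
      · rw [h] at h3; omega
  have h3 := hdec (p - 1 - q1) (by omega)
  obtain ⟨T, hT, e⟩ := Nat.sInf_mem (hS (q1 + (p - 1 - q1)) (by omega))
  have := h1 T (by omega)
  omega

theorem finrank_le_of_inf_orth (N M : Submodule ℂ V') (h : N ⊓ Mᗮ = ⊥) :
    Module.finrank ℂ N ≤ Module.finrank ℂ M := by
  have h1 := Submodule.finrank_sup_add_finrank_inf_eq N Mᗮ
  have h2 := Submodule.finrank_add_finrank_orthogonal M
  have h3 := Submodule.finrank_le (N ⊔ Mᗮ)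
  rw [h, finrank_bot] at h1
  omega

theorem CL_open {f : (V →L[ℂ] W) → (V' →L[ℂ] W')} (hf : PH f) (x : V) (E : Submodule ℂ V')
    (T0 : Submodule ℂ W) :
    ∀ᶠ g : W →L[ℂ] W in nhds 1,
      Module.finrank ℂ (MS f (ℂ ∙ x) (T0.map (g : W →ₗ[ℂ] W)) ⊓ E : Submodule ℂ V') ≤
        Module.finrank ℂ (MS f (ℂ ∙ x) T0 ⊓ E : Submodule ℂ V') ∧
      Module.finrank ℂ (T0.map (g : W →ₗ[ℂ] W)) = Module.finrank ℂ T0 := by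
  classical
  set N0 := MS f (ℂ ∙ x) T0 ⊓ E with hN0
  let Es : Submodule ℂ V' := E ⊓ N0ᗮ
  obtain ⟨s, hs⟩ := exists_fin_rows (ι := {Z : V →L[ℂ] W // ‖Z‖ < 1 ∧ NS (ℂ ∙ x) T0 Z}) (E := Es) (F := W')
    (fun Z => ((f Z.1).comp Es.subtypeL : Es →L[ℂ] W')) (by
      intro v hv
      have h1 : (v : V') ∈ N0 := ⟨fun Z hZ hN => hv ⟨Z, hZ, hN⟩, v.2.1⟩
      have h2 := v.2.2 _ h1
      exact Subtype.ext (inner_self_eq_zero.1 h2))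
  let L : (W →L[ℂ] W) → Es →L[ℂ] (s → W') := fun g =>
    ContinuousLinearMap.pi fun i : s => (f (g.comp i.1.1)).comp Es.subtypeL
  have hcont : ContinuousAt L 1 := by
    rw [ContinuousAt]
    have hfi : ∀ i : s, ContinuousAt (fun g : W →L[ℂ] W => (f (g.comp i.1.1)).comp Es.subtypeL) 1 := by
      intro i
      have h1 : ContinuousAt f ((1 : W →L[ℂ] W).comp i.1.1) := by
        have : (1 : W →L[ℂ] W).comp i.1.1 = i.1.1 := by ext; rfl
        rw [this]
        exact (hf.diffAt i.1.2.1).continuousAt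
      have h2 : ContinuousAt (fun g : W →L[ℂ] W => g.comp i.1.1) 1 := by fun_prop
      have h3 : ContinuousAt (fun g : W →L[ℂ] W => f (g.comp i.1.1)) 1 :=
        ContinuousAt.comp (f := fun g : W →L[ℂ] W => g.comp i.1.1) h1 h2
      exact h3.clm_comp continuousAt_const
    have : L = fun g => ∑ i : s, (ContinuousLinearMap.compL ℂ Es W' (s → W')
        (ContinuousLinearMap.single ℂ (fun _ : s => W') i)) ((f (g.comp i.1.1)).comp Es.subtypeL) := by
      funext g; ext v i
      simp only [L, ContinuousLinearMap.pi_apply, ContinuousLinearMap.sum_apply,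
        ContinuousLinearMap.compL_apply, ContinuousLinearMap.comp_apply, Finset.sum_apply,
        ContinuousLinearMap.single_apply]
      rw [Finset.sum_eq_single i]
      · simp
      · intro j _ hj; simp [Pi.single_apply, hj.symm]
      · simp
    rw [this]
    refine tendsto_finsetSum _ fun i _ => ?_
    exact (ContinuousLinearMap.continuous _).continuousAt.comp (hfi i)
  have hinj : Function.Injective (L 1) := by
    rw [injective_iff_map_eq_zero]
    intro v hv
    apply hs v
    intro i hi
    have := congrFun hv ⟨i, hi⟩
    have e : (1 : W →L[ℂ] W).comp i.1 = i.1 := by ext; rfl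
    simp only [L, ContinuousLinearMap.pi_apply, e] at this
    exact this
  have hev1 := inj_open L 1 hcont hinj
  have hev2 : ∀ᶠ g in nhds (1 : W →L[ℂ] W), ∀ i : s, ‖g.comp i.1.1‖ < 1 := by
    rw [Filter.eventually_all]
    intro i
    have : ContinuousAt (fun g : W →L[ℂ] W => ‖g.comp i.1.1‖) 1 := by fun_prop
    refine this.eventually_lt continuousAt_const ?_
    have e : (1 : W →L[ℂ] W).comp i.1.1 = i.1.1 := by ext; rfl
    simp only [e]
    exact i.1.2.1
  have hev3 : ∀ᶠ g in nhds (1 : W →L[ℂ] W), IsUnit g := by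
    have : CompleteSpace W := FiniteDimensional.complete ℂ W
    exact Units.isOpen.mem_nhds isUnit_one
  filter_upwards [hev1, hev2, hev3] with g h1 h2 h3
  constructor
  · apply finrank_le_of_inf_orth
    rw [Submodule.eq_bot_iff]
    rintro v ⟨⟨hv1, hv2⟩, hv3⟩
    have : (⟨v, hv2, hv3⟩ : Es) = 0 := by
      apply h1
      rw [map_zero]
      funext i
      refine hv1 _ (h2 i) ⟨fun k hk => ?_, fun w => ?_⟩
      · simp [i.1.2.2.1 k hk]
      · exact Submodule.mem_map_of_mem (i.1.2.2.2 w)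
    exact congrArg Subtype.val this
  · have hgi : Function.Injective g := by
      obtain ⟨u, rfl⟩ := h3
      intro v w hvw
      have e2 : ∀ z, ((u⁻¹ : (W →L[ℂ] W)ˣ) : W →L[ℂ] W) ((u : W →L[ℂ] W) z) = z := fun z => by
        have := u.inv_mul; exact DFunLike.congr_fun this z
      rw [← e2 v, ← e2 w, hvw]
    exact (Submodule.equivMapOfInjective (g : W →ₗ[ℂ] W) hgi T0).symm.finrank_eq

theorem CL_near {f : (V →L[ℂ] W) → (V' →L[ℂ] W')} (hf : PH f) (x : V) (E : Submodule ℂ V')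
    (T0 : Submodule ℂ W)
    (hmin : ∀ T : Submodule ℂ W, Module.finrank ℂ T0 ≤ Module.finrank ℂ T →
      Module.finrank ℂ T ≤ Module.finrank ℂ T0 + 1 →
      Module.finrank ℂ (MS f (ℂ ∙ x) T0 ⊓ E : Submodule ℂ V') ≤
        Module.finrank ℂ (MS f (ℂ ∙ x) T ⊓ E : Submodule ℂ V')) :
    ∀ᶠ g : W →L[ℂ] W in nhds 1, MS f (ℂ ∙ x) T0 ⊓ E ≤
      MS f (ℂ ∙ x) (T0.map (g : W →ₗ[ℂ] W)) := by
  classical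
  obtain ⟨ε, hε, hball⟩ := Metric.eventually_nhds_iff.1 (CL_open hf x E T0)
  let b := stdOrthonormalBasis ℂ W
  set n := Module.finrank ℂ W with hn
  rw [Metric.eventually_nhds_iff]
  refine ⟨ε / (n + 1), by positivity, fun g hg => ?_⟩
  rw [dist_eq_norm] at hg
  let G : Finset (Fin n) → W →L[ℂ] W := fun s => 1 + ∑ i ∈ s, rankOne ℂ ((g - 1) (b i)) (b i)
  have hGn : ∀ s, dist (G s) 1 < ε := by
    intro s
    rw [dist_eq_norm]
    have e : G s - 1 = ∑ i ∈ s, rankOne ℂ ((g - 1) (b i)) (b i) := by simp [G]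
    rw [e]
    have h1 : ‖∑ i ∈ s, rankOne ℂ ((g - 1) (b i)) (b i)‖ ≤ ∑ i ∈ s, ‖g - 1‖ := by
      refine (norm_sum_le _ _).trans (Finset.sum_le_sum fun i _ => ?_)
      rw [norm_rankOne, b.orthonormal.1 i, mul_one]
      have := (g - 1).le_opNorm (b i)
      rwa [b.orthonormal.1 i, mul_one] at this
    rw [Finset.sum_const, nsmul_eq_mul] at h1
    have h2 : (s.card : ℝ) ≤ n := by
      have := Finset.card_le_univ s
      rw [Fintype.card_fin] at this
      exact_mod_cast this
    have h3 : (s.card : ℝ) * ‖g - 1‖ ≤ n * ‖g - 1‖ := by gcongr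
    rw [lt_div_iff₀ (by positivity)] at hg
    nlinarith [norm_nonneg (g - 1)]
  have key : ∀ s, MS f (ℂ ∙ x) T0 ⊓ E ≤ MS f (ℂ ∙ x) (T0.map (G s : W →ₗ[ℂ] W)) ⊓ E := by
    intro s
    induction s using Finset.induction_on with
    | empty =>
      have : T0.map (G ∅ : W →ₗ[ℂ] W) = T0 := by
        have e : (G ∅ : W →ₗ[ℂ] W) = LinearMap.id := by ext; simp [G]
        rw [e, Submodule.map_id]
      rw [this]
    | insert i s hi ih =>
      set T1 := T0.map (G s : W →ₗ[ℂ] W) with hT1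
      obtain ⟨hc, hd⟩ := hball (hGn s)
      rw [← hT1] at hc hd
      set u := (g - 1) (b i) with hu
      have hle : T0.map (G (insert i s) : W →ₗ[ℂ] W) ≤ T1 ⊔ (ℂ ∙ u) := by
        rintro _ ⟨w, hw, rfl⟩
        have e : (G (insert i s) : W →ₗ[ℂ] W) w = G s w + inner ℂ (b i) w • u := by
          simp only [G, Finset.sum_insert hi, ContinuousLinearMap.coe_coe, ContinuousLinearMap.add_apply,
            rankOne_apply]
          abel
        rw [e]
        exact Submodule.add_mem_sup (Submodule.mem_map_of_mem hw)
          (Submodule.smul_mem _ _ (Submodule.mem_span_singleton_self u))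
      have hr1 : Module.finrank ℂ T0 ≤ Module.finrank ℂ (T1 ⊔ (ℂ ∙ u) : Submodule ℂ W) := by
        rw [← hd]; exact Submodule.finrank_mono le_sup_left
      have hr2 : Module.finrank ℂ (T1 ⊔ (ℂ ∙ u) : Submodule ℂ W) ≤ Module.finrank ℂ T0 + 1 := by
        rw [← hd]
        refine (Submodule.finrank_add_le_finrank_add_finrank _ _).trans ?_
        gcongr
        have h5 := finrank_span_le_card (R := ℂ) ({u} : Set W)
        simpa using h5
      have hm := hmin _ hr1 hr2
      have hle2 : MS f (ℂ ∙ x) (T1 ⊔ (ℂ ∙ u)) ⊓ E ≤ MS f (ℂ ∙ x) T1 ⊓ E :=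
        inf_le_inf_right _ (MS_mono f le_rfl le_sup_left)
      have heq := Submodule.eq_of_le_of_finrank_le hle2 (hc.trans hm)
      refine ih.trans ?_
      rw [← heq]
      exact inf_le_inf_right _ (MS_mono f le_rfl hle)
  have hfin : G Finset.univ = g := by
    have := sum_rankOne b (g - 1)
    simp only [G]
    rw [← this]; abel
  have := (key Finset.univ).trans inf_le_left
  rwa [hfin] at this

theorem CL {f : (V →L[ℂ] W) → (V' →L[ℂ] W')} (hf : PH f) (f0 : f 0 = 0)
    (hqp : Module.finrank ℂ V' < Module.finrank ℂ W) {x : V} (hx : x ≠ 0) :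
    ∃ m ≠ 0, m ∈ MS f (ℂ ∙ x) ⊤ ∧ m ∈ (MS f (ℂ ∙ x)ᗮ ⊤)ᗮ := by
  set E := (MS f (ℂ ∙ x)ᗮ ⊤)ᗮ with hE
  have hV1 : 1 ≤ Module.finrank ℂ V := by
    have : Nontrivial V := ⟨x, 0, hx⟩
    exact Module.finrank_pos
  have hqq : Module.finrank ℂ V ≤ Module.finrank ℂ V' := by
    have := RI_aux hf f0 (min (Module.finrank ℂ V) (Module.finrank ℂ W)) ⊥ ⊤ (by simp)
      (by rw [finrank_top]; exact min_le_right _ _)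
    have h3 := le_total (Module.finrank ℂ V) (Module.finrank ℂ W)
    rcases h3 with h | h
    · rw [min_eq_left h] at this; omega
    · rw [min_eq_right h] at this; omega
  obtain ⟨T0, hT0, hT0p, hmin⟩ := CL_stable (W := W)
    (fun T : Submodule ℂ W => Module.finrank ℂ (MS f (ℂ ∙ x) T ⊓ E : Submodule ℂ V'))
    (Module.finrank ℂ V - 1) (Module.finrank ℂ W)
    (Module.finrank ℂ V' - (Module.finrank ℂ V - 1)) rfl
    (fun T hT => CL_pos hf f0 hx T hT)
    (fun T hT => by
      have h1 := RI_aux hf f0 (Module.finrank ℂ V - 1) (ℂ ∙ x) T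
        (by rw [finrank_span_singleton hx]; omega) hT
      have h2 := Submodule.finrank_mono (inf_le_left : MS f (ℂ ∙ x) T ⊓ E ≤ MS f (ℂ ∙ x) T)
      omega)
    (by omega)
  have hnear := CL_near hf x E T0 hmin
  have hpos := CL_pos hf f0 hx T0 hT0p
  have hne : MS f (ℂ ∙ x) T0 ⊓ E ≠ ⊥ := by
    intro h
    rw [← hE, h, finrank_bot] at hpos
    omega
  obtain ⟨m, hm, hm0⟩ := Submodule.exists_mem_ne_zero_of_ne_bot hne
  refine ⟨m, hm0, ?_, hm.2⟩
  intro Z' hZ' hN'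
  have hrk : Module.finrank ℂ (LinearMap.range (Z' : V →ₗ[ℂ] W)) ≤ Module.finrank ℂ T0 := by
    refine le_trans ?_ hT0
    have h1 := LinearMap.finrank_range_add_finrank_ker (Z' : V →ₗ[ℂ] W)
    have h2 : (ℂ ∙ x) ≤ LinearMap.ker (Z' : V →ₗ[ℂ] W) := by
      intro k hk; exact hN'.1 k hk
    have h3 := Submodule.finrank_mono h2
    rw [finrank_span_singleton hx] at h3
    omega
  obtain ⟨A, hA⟩ := exists_unitary_into _ T0 hrk
  let Ac : W →L[ℂ] W := A.toContinuousLinearEquiv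
  let Ai : W →L[ℂ] W := A.symm.toContinuousLinearEquiv
  let Z := Ac.comp Z'
  have hAi : Ai.comp Z = Z' := by ext v; simp [Ai, Z, Ac]
  have hZ : ‖Z‖ < 1 := by
    have : ‖Z‖ = ‖Z'‖ := by
      apply ContinuousLinearMap.opNorm_ext
      intro v; simp [Z, Ac]
    rw [this]; exact hZ'
  have hZN : ∀ g : W →L[ℂ] W, NS (ℂ ∙ x) (T0.map (g : W →ₗ[ℂ] W)) (g.comp Z) := by
    intro g
    refine ⟨fun k hk => ?_, fun v => ?_⟩
    · simp [Z, hN'.1 k hk]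
    · exact Submodule.mem_map_of_mem (hA _ (LinearMap.mem_range_self _ v))
  have hcomp : ∀ g : W →L[ℂ] W, g.comp Z = ContinuousLinearMap.precomp W Z g := fun g => rfl
  have hc := convex_ident (fun g : W →L[ℂ] W => f (g.comp Z) m) {g | ‖g.comp Z‖ < 1}
    (by
      have : Continuous fun g : W →L[ℂ] W => ‖g.comp Z‖ := by fun_prop
      exact isOpen_lt this continuous_const)
    (by
      have h := (convex_ball (0 : V →L[ℂ] W) 1).is_linear_preimage
        (f := fun g : W →L[ℂ] W => g.comp Z) ⟨fun a b => by ext; simp, fun c a => by ext; simp⟩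
      have e : {g : W →L[ℂ] W | ‖g.comp Z‖ < 1} = (fun g : W →L[ℂ] W => g.comp Z) ⁻¹' ball 0 1 := by
        ext g
        show ‖g.comp Z‖ < 1 ↔ g.comp Z ∈ ball 0 1
        rw [mem_ball_zero_iff]
      rw [e]; exact h)
    (by
      intro g hg
      have h1 : DifferentiableAt ℂ f (g.comp Z) := hf.diffAt hg
      have h2 : DifferentiableAt ℂ (fun g : W →L[ℂ] W => g.comp Z) g := by fun_prop
      have h3 : DifferentiableAt ℂ (fun g : W →L[ℂ] W => f (g.comp Z)) g :=
        DifferentiableAt.comp (f := fun g : W →L[ℂ] W => g.comp Z) g h1 h2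
      exact (h3.clm_apply (differentiableAt_const m)).differentiableWithinAt)
    1 (by
      have e : (1 : W →L[ℂ] W).comp Z = Z := by ext; rfl
      show ‖(1 : W →L[ℂ] W).comp Z‖ < 1
      rw [e]; exact hZ)
    (by
      have hev : ∀ᶠ g : W →L[ℂ] W in nhds 1, ‖g.comp Z‖ < 1 := by
        have : ContinuousAt (fun g : W →L[ℂ] W => ‖g.comp Z‖) 1 := by fun_prop
        refine this.eventually_lt continuousAt_const ?_
        have e : (1 : W →L[ℂ] W).comp Z = Z := by ext; rfl
        simp only [e]
        exact hZ
      filter_upwards [hnear, hev] with g h1 h2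
      exact h1 hm _ h2 (hZN g))
  have := hc Ai (by show ‖Ai.comp Z‖ < 1; rw [hAi]; exact hZ')
  simp only [hAi] at this
  exact this

end

open Metric InnerProductSpace

section
variable {V W V' W' : Type} [NormedAddCommGroup V] [InnerProductSpace ℂ V] [FiniteDimensional ℂ V]
  [NormedAddCommGroup W] [InnerProductSpace ℂ W] [FiniteDimensional ℂ W]
  [NormedAddCommGroup V'] [InnerProductSpace ℂ V'] [FiniteDimensional ℂ V']
  [NormedAddCommGroup W'] [InnerProductSpace ℂ W'] [FiniteDimensional ℂ W']

theorem mob_fderiv {f : (V →L[ℂ] W) → (V' →L[ℂ] W')} (hf : PH f)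
    {g : (V × W) ≃L[ℂ] (V × W)} (hg : IsMob g) {g' : (V' × W') ≃L[ℂ] (V' × W')} (hg' : IsMob g')
    {Z : V →L[ℂ] W} (hZ : ‖Z‖ < 1) (Y : V →L[ℂ] W) (m : V') :
    fderiv ℂ (fun Z => act g' (f (act g Z))) Z Y (mobA g' (f (act g Z)) m) =
      (g' (0, fderiv ℂ f (act g Z) (fderiv ℂ (act g) Z Y) m)).2 -
        act g' (f (act g Z)) (g' (0, fderiv ℂ f (act g Z) (fderiv ℂ (act g) Z Y) m)).1 := by
  have h1 := (hg.diffAt hZ).hasFDerivAt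
  have h2 := (hf.diffAt (hg.maps hZ)).hasFDerivAt
  have h3 := (hg'.diffAt (hf.maps _ (hg.maps hZ))).hasFDerivAt
  have h4 := h3.comp Z (h2.comp Z h1)
  have h5 : fderiv ℂ (fun Z => act g' (f (act g Z))) Z = _ := h4.fderiv
  rw [h5]
  simp only [ContinuousLinearMap.comp_apply]
  rw [act_fderiv hg' (hf.maps _ (hg.maps hZ))]

/-- the good-base property -/
def GB (f : (V →L[ℂ] W) → (V' →L[ℂ] W')) (Z0 : V →L[ℂ] W) : Prop :=
  ∃ R : Submodule ℂ V, Module.finrank ℂ R + 2 ≤ Module.finrank ℂ V ∧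
    ∃ (P : V →ₗ[ℂ] V') (T : W →ₗ[ℂ] W'), Function.Injective T ∧
      ∀ Y : V →L[ℂ] W, (∀ r ∈ R, Y r = 0) → ∀ v, fderiv ℂ f Z0 Y (P v) = T (Y v)

theorem GB_mob {f : (V →L[ℂ] W) → (V' →L[ℂ] W')} (hf : PH f)
    {g : (V × W) ≃L[ℂ] (V × W)} (hg : IsMob g) {g' : (V' × W') ≃L[ℂ] (V' × W')} (hg' : IsMob g')
    {Z : V →L[ℂ] W} (hZ : ‖Z‖ < 1) (h : GB f (act g Z)) :
    GB (fun Z => act g' (f (act g Z))) Z := by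
  obtain ⟨R, hR, P, T, hT, hY⟩ := h
  refine ⟨R.comap (mobA g Z : V →ₗ[ℂ] V), ?_,
    (mobA g' (f (act g Z)) : V' →ₗ[ℂ] V').comp (P.comp (mobA g Z : V →ₗ[ℂ] V)), ?_⟩
  · have e : Module.finrank ℂ (R.comap (mobA g Z : V →ₗ[ℂ] V)) = Module.finrank ℂ R := by
      have hs : (R.comap (mobA g Z : V →ₗ[ℂ] V)).map (mobA g Z : V →ₗ[ℂ] V) = R :=
        Submodule.map_comap_eq_of_surjective (hg.surj hZ) R
      have := (Submodule.equivMapOfInjective (mobA g Z : V →ₗ[ℂ] V) (hg.inj hZ)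
        (R.comap (mobA g Z : V →ₗ[ℂ] V))).finrank_eq
      rw [this, hs]
    rw [e]; exact hR
  let δ : W →ₗ[ℂ] W :=
    { toFun := fun w => (g (0, w)).2 - act g Z (g (0, w)).1
      map_add' := by
        intro a b
        have : ((0 : V), a + b) = (0, a) + (0, b) := by simp
        simp only [this, map_add, Prod.fst_add, Prod.snd_add]; abel
      map_smul' := by
        intro c a
        have : ((0 : V), c • a) = c • (0, a) := by simp
        simp only [this, map_smul, Prod.smul_fst, Prod.smul_snd, RingHom.id_apply, smul_sub] }
  let δ' : W' →ₗ[ℂ] W' :=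
    { toFun := fun w => (g' (0, w)).2 - act g' (f (act g Z)) (g' (0, w)).1
      map_add' := by
        intro a b
        have : ((0 : V'), a + b) = (0, a) + (0, b) := by simp
        simp only [this, map_add, Prod.fst_add, Prod.snd_add]; abel
      map_smul' := by
        intro c a
        have : ((0 : V'), c • a) = c • (0, a) := by simp
        simp only [this, map_smul, Prod.smul_fst, Prod.smul_snd, RingHom.id_apply, smul_sub] }
  have hδ : Function.Injective δ := by
    rw [injective_iff_map_eq_zero]
    intro w hw; exact mob_delta_inj hg hZ w hw
  have hδ' : Function.Injective δ' := by
    rw [injective_iff_map_eq_zero]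
    intro w hw; exact mob_delta_inj hg' (hf.maps _ (hg.maps hZ)) w hw
  refine ⟨δ'.comp (T.comp δ), ?_, ?_⟩
  · exact hδ'.comp (hT.comp hδ)
  · intro Y hYR v
    have h1 := mob_fderiv hf hg hg' hZ Y (P (mobA g Z v))
    have h2 : ∀ r ∈ R, fderiv ℂ (act g) Z Y r = 0 := by
      intro r hr
      obtain ⟨v, rfl⟩ := hg.surj hZ r
      rw [act_fderiv hg hZ, hYR v hr]
      have : ((0 : V), (0 : W)) = 0 := rfl
      simp [this]
    have h3 := hY _ h2 (mobA g Z v)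
    rw [act_fderiv hg hZ] at h3
    rw [h3] at h1
    exact h1

theorem GB_congr {f f' : (V →L[ℂ] W) → (V' →L[ℂ] W')} {Z : V →L[ℂ] W} (hZ : ‖Z‖ < 1)
    (h : ∀ Z, ‖Z‖ < 1 → f Z = f' Z) (hG : GB f Z) : GB f' Z := by
  have hev : f =ᶠ[nhds Z] f' := by
    have : ball (0 : V →L[ℂ] W) 1 ∈ nhds Z := isOpen_ball.mem_nhds (by simpa using hZ)
    filter_upwards [this] with Z' hZ'
    exact h _ (by simpa using hZ')
  unfold GB at *
  rwa [← hev.fderiv_eq]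

theorem GB_back {f : (V →L[ℂ] W) → (V' →L[ℂ] W')} (hf : PH f)
    {g : (V × W) ≃L[ℂ] (V × W)} (hg : IsMob g) {g' : (V' × W') ≃L[ℂ] (V' × W')} (hg' : IsMob g')
    {Z : V →L[ℂ] W} (hZ : ‖Z‖ < 1) (h : GB (fun Z => act g' (f (act g Z))) Z) :
    GB f (act g Z) := by
  have h1 := GB_mob (hf.mob hg hg') hg.symm hg'.symm (Z := act g Z) (hg.maps hZ)
    (by rw [hg.symm_act hZ]; exact h)
  refine GB_congr (hg.maps hZ) ?_ h1
  intro Z hZ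
  show act g'.symm (act g' (f (act g (act g.symm Z)))) = f Z
  rw [hg.act_symm hZ, hg'.symm_act (hf.maps _ hZ)]

/-- ambient space of vectors common to all graphs through `A` -/
def Amb (f : (V →L[ℂ] W) → (V' →L[ℂ] W')) (A : V × W) : Submodule ℂ (V' × W') where
  carrier := {a | ∀ Z, ‖Z‖ < 1 → Z A.1 = A.2 → f Z a.1 = a.2}
  add_mem' := by
    intro a b ha hb Z hZ hA
    simp [ha Z hZ hA, hb Z hZ hA]
  zero_mem' := by intro Z _ _; simp
  smul_mem' := by
    intro c a ha Z hZ hA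
    simp [ha Z hZ hA]

theorem mem_Amb {f : (V →L[ℂ] W) → (V' →L[ℂ] W')} {A : V × W} {a : V' × W'} :
    a ∈ Amb f A ↔ ∀ Z, ‖Z‖ < 1 → Z A.1 = A.2 → f Z a.1 = a.2 := Iff.rfl

theorem Amb_mob {f : (V →L[ℂ] W) → (V' →L[ℂ] W')} (hf : PH f)
    {g : (V × W) ≃L[ℂ] (V × W)} (hg : IsMob g) {g' : (V' × W') ≃L[ℂ] (V' × W')} (hg' : IsMob g')
    (A : V × W) (a : V' × W') :
    g' a ∈ Amb (fun Z => act g' (f (act g Z))) A ↔ a ∈ Amb f (g A) := by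
  constructor
  · intro h Z hZ hA
    have hs := hg.symm.maps hZ
    have e := hg.act_symm hZ
    have h1 := h (act g.symm Z) hs (by
      rw [← hg.graph_iff hs, e]; exact hA)
    simp only [e] at h1
    exact (hg'.graph_iff (hf.maps _ hZ) a).1 h1
  · intro h Z hZ hA
    refine (hg'.graph_iff (hf.maps _ (hg.maps hZ)) a).2 ?_
    exact h _ (hg.maps hZ) ((hg.graph_iff hZ A).2 hA)

theorem Amb_finrank_mob {f : (V →L[ℂ] W) → (V' →L[ℂ] W')} (hf : PH f)
    {g : (V × W) ≃L[ℂ] (V × W)} (hg : IsMob g) {g' : (V' × W') ≃L[ℂ] (V' × W')} (hg' : IsMob g')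
    (A : V × W) :
    Module.finrank ℂ (Amb (fun Z => act g' (f (act g Z))) A) = Module.finrank ℂ (Amb f (g A)) := by
  have e : (Amb f (g A)).map (g'.toLinearEquiv : (V' × W') →ₗ[ℂ] (V' × W')) =
      Amb (fun Z => act g' (f (act g Z))) A := by
    ext b
    constructor
    · rintro ⟨a, ha, rfl⟩
      exact (Amb_mob hf hg hg' A a).2 ha
    · intro hb
      refine ⟨g'.symm b, (Amb_mob hf hg hg' A _).1 (by simpa using hb), by simp⟩
  rw [← e]
  exact LinearEquiv.finrank_map_eq g'.toLinearEquiv _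

theorem Amb_base {f : (V →L[ℂ] W) → (V' →L[ℂ] W')} (f0 : f 0 = 0) (x : V) (a : V' × W') :
    a ∈ Amb f (x, 0) ↔ a.1 ∈ MS f (ℂ ∙ x) ⊤ ∧ a.2 = 0 := by
  constructor
  · intro h
    have h2 : a.2 = 0 := by
      have := h 0 (by simp) (by simp)
      rw [f0] at this
      simpa using this.symm
    refine ⟨fun Z hZ hN => ?_, h2⟩
    have := h Z hZ (hN.1 x (Submodule.mem_span_singleton_self x))
    rw [this, h2]
  · rintro ⟨h1, h2⟩ Z hZ hA
    rw [h2]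
    refine h1 Z hZ ⟨fun k hk => ?_, fun _ => trivial⟩
    obtain ⟨c, rfl⟩ := Submodule.mem_span_singleton.1 hk
    simp only at hA
    rw [map_smul, hA, smul_zero]

theorem Amb_base_finrank {f : (V →L[ℂ] W) → (V' →L[ℂ] W')} (f0 : f 0 = 0) (x : V) :
    Module.finrank ℂ (Amb f (x, 0)) = Module.finrank ℂ (MS f (ℂ ∙ x) ⊤) := by
  have e : (MS f (ℂ ∙ x) ⊤).map (LinearMap.inl ℂ V' W') = Amb f (x, 0) := by
    ext a
    rw [Amb_base f0]
    constructor
    · rintro ⟨m, hm, rfl⟩; exact ⟨hm, rfl⟩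
    · rintro ⟨h1, h2⟩; exact ⟨a.1, h1, Prod.ext rfl h2.symm⟩
  rw [← e]
  exact (Submodule.equivMapOfInjective (LinearMap.inl ℂ V' W') LinearMap.inl_injective _).symm.finrank_eq

theorem exists_through {A : V × W} (hA : ‖A.2‖ < ‖A.1‖) : ∃ Z : V →L[ℂ] W, ‖Z‖ < 1 ∧ Z A.1 = A.2 ∧
    ∀ v, inner ℂ A.1 v = 0 → Z v = 0 := by
  have hx : 0 < ‖A.1‖ := lt_of_le_of_lt (norm_nonneg _) hA
  refine ⟨((‖A.1‖ ^ 2 : ℝ) : ℂ)⁻¹ • rankOne ℂ A.2 A.1, ?_, ?_, ?_⟩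
  · rw [norm_smul, norm_rankOne, norm_inv, Complex.norm_real, Real.norm_of_nonneg (by positivity)]
    rw [inv_mul_lt_iff₀ (by positivity)]
    nlinarith
  · rw [ContinuousLinearMap.smul_apply, rankOne_apply, inner_self_eq_norm_sq_to_K, smul_smul]
    have : (((‖A.1‖ ^ 2 : ℝ) : ℂ))⁻¹ * ((‖A.1‖ : ℂ)) ^ 2 = 1 := by
      push_cast
      apply inv_mul_cancel₀
      have : (‖A.1‖ : ℂ) ≠ 0 := by exact_mod_cast hx.ne'
      positivity
    erw [this]; rw [one_smul]
  · intro v hv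
    simp [rankOne_apply, hv]

/-- Normalisation at a positive vector. -/
theorem normalise_at {f : (V →L[ℂ] W) → (V' →L[ℂ] W')} (hf : PH f) {Z0 : V →L[ℂ] W} (hZ0 : ‖Z0‖ < 1) :
    ∃ (g : (V × W) ≃L[ℂ] (V × W)) (g' : (V' × W') ≃L[ℂ] (V' × W')), IsMob g ∧ IsMob g' ∧
      act g 0 = Z0 ∧ PH (fun Z => act g' (f (act g Z))) ∧
      (fun Z => act g' (f (act g Z))) 0 = 0 ∧ ∀ A : V × W, Z0 A.1 = A.2 → (g.symm A).2 = 0 := by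
  obtain ⟨g, g', hg, hg', e0, e1, hP⟩ := hf.normalise Z0 hZ0
  refine ⟨g, g', hg, hg', e0, hP, by simp only [e0, e1], fun A hA => ?_⟩
  have := (hg.graph_iff (Z := 0) (by simp) (g.symm A)).1 (by simpa [e0] using hA)
  simpa using this.symm

theorem pos_symm {g : (V × W) ≃L[ℂ] (V × W)} (hg : IsMob g) {A : V × W} (hA : ‖A.2‖ < ‖A.1‖) :
    ‖(g A).2‖ < ‖(g A).1‖ := by
  have := hg.norms A
  have h2 : 0 < ‖A.1‖ ^ 2 - ‖A.2‖ ^ 2 := by nlinarith [norm_nonneg A.2]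
  have h3 := norm_nonneg (g A).1
  nlinarith [norm_nonneg (g A).2]

theorem Amb_finrank_pos {f : (V →L[ℂ] W) → (V' →L[ℂ] W')} (hf : PH f)
    (hqp : Module.finrank ℂ V' < Module.finrank ℂ W) {A : V × W} (hA : ‖A.2‖ < ‖A.1‖) :
    ∃ (g : (V × W) ≃L[ℂ] (V × W)) (g' : (V' × W') ≃L[ℂ] (V' × W')) (x : V), IsMob g ∧ IsMob g' ∧
      PH (fun Z => act g' (f (act g Z))) ∧ (fun Z => act g' (f (act g Z))) 0 = 0 ∧ x ≠ 0 ∧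
      1 ≤ Module.finrank ℂ (Amb f A) ∧
      Module.finrank ℂ (Amb f A) = Module.finrank ℂ (MS (fun Z => act g' (f (act g Z))) (ℂ ∙ x) ⊤) := by
  obtain ⟨Z0, hZ0, hZA, -⟩ := exists_through hA
  obtain ⟨g, g', hg, hg', e0, hP, h0, hA2⟩ := normalise_at hf hZ0
  have h1 := pos_symm hg.symm hA
  have h2 := hA2 A hZA
  have hx : (g.symm A).1 ≠ 0 := by
    intro h; rw [h, h2] at h1; simp at h1
  have h3 : g.symm A = ((g.symm A).1, 0) := Prod.ext rfl h2
  have h4 : Module.finrank ℂ (Amb f A) =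
      Module.finrank ℂ (MS (fun Z => act g' (f (act g Z))) (ℂ ∙ (g.symm A).1) ⊤) := by
    have h5 := Amb_base_finrank (f := fun Z => act g' (f (act g Z))) h0 (g.symm A).1
    have h6 := Amb_finrank_mob hf hg hg' (g.symm A)
    rw [← h3] at h5
    rw [g.apply_symm_apply] at h6
    rw [← h5, h6]
  refine ⟨g, g', (g.symm A).1, hg, hg', hP, h0, hx, ?_, h4⟩
  rw [h4]
  obtain ⟨m, hm0, hm1, -⟩ := CL hP h0 hqp hx
  have : Nontrivial (MS (fun Z => act g' (f (act g Z))) (ℂ ∙ (g.symm A).1) ⊤) :=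
    ⟨⟨m, hm1⟩, 0, by intro h; exact hm0 (congrArg Subtype.val h)⟩
  exact Module.finrank_pos

def AmbOne (f : (V →L[ℂ] W) → (V' →L[ℂ] W')) : Prop :=
  ∀ A : V × W, ‖A.2‖ < ‖A.1‖ → Module.finrank ℂ (Amb f A) = 1

theorem AmbOne.mob {f : (V →L[ℂ] W) → (V' →L[ℂ] W')} (hf : PH f) (h : AmbOne f)
    {g : (V × W) ≃L[ℂ] (V × W)} (hg : IsMob g) {g' : (V' × W') ≃L[ℂ] (V' × W')} (hg' : IsMob g') :
    AmbOne (fun Z => act g' (f (act g Z))) := by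
  intro A hA
  rw [Amb_finrank_mob hf hg hg']
  exact h _ (pos_symm hg hA)

theorem AmbOne.mem {f : (V →L[ℂ] W) → (V' →L[ℂ] W')} (h : AmbOne f) {A : V × W} (hA : ‖A.2‖ < ‖A.1‖)
    {a b : V' × W'} (ha : a ∈ Amb f A) (ha0 : a ≠ 0) (hb : b ∈ Amb f A) : ∃ c : ℂ, b = c • a := by
  have := (finrank_eq_one_iff_of_nonzero' (⟨a, ha⟩ : Amb f A)
    (by intro h; exact ha0 (congrArg Subtype.val h))).1 (h A hA) ⟨b, hb⟩
  obtain ⟨c, hc⟩ := this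
  exact ⟨c, (congrArg Subtype.val hc).symm⟩

theorem AmbOne.exists {f : (V →L[ℂ] W) → (V' →L[ℂ] W')} (h : AmbOne f) {A : V × W}
    (hA : ‖A.2‖ < ‖A.1‖) : ∃ a ∈ Amb f A, a.1 ≠ 0 := by
  have h1 : Nontrivial (Amb f A) := Module.nontrivial_of_finrank_pos (R := ℂ) (by rw [h A hA]; norm_num)
  obtain ⟨⟨a, ha⟩, ha0⟩ := exists_ne (0 : Amb f A)
  refine ⟨a, ha, fun h0 => ha0 ?_⟩
  obtain ⟨Z, hZ, hZA, -⟩ := exists_through hA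
  have := ha Z hZ hZA
  rw [h0, map_zero] at this
  exact Subtype.ext (Prod.ext h0 this.symm)

/-- fst nonzero -/
theorem Amb_fst_ne {f : (V →L[ℂ] W) → (V' →L[ℂ] W')} {A : V × W}
    (hA : ‖A.2‖ < ‖A.1‖) {a : V' × W'} (ha : a ∈ Amb f A) (h0 : a ≠ 0) : a.1 ≠ 0 := by
  intro h
  obtain ⟨Z, hZ, hZA, -⟩ := exists_through hA
  have := ha Z hZ hZA
  rw [h, map_zero] at this
  exact h0 (Prod.ext h this.symm)

end

open Metric InnerProductSpace

section
variable {V W V' W' : Type} [NormedAddCommGroup V] [InnerProductSpace ℂ V] [FiniteDimensional ℂ V]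
  [NormedAddCommGroup W] [InnerProductSpace ℂ W] [FiniteDimensional ℂ W]
  [NormedAddCommGroup V'] [InnerProductSpace ℂ V'] [FiniteDimensional ℂ V']
  [NormedAddCommGroup W'] [InnerProductSpace ℂ W'] [FiniteDimensional ℂ W']

/-- rank one operators, linear in the range vector -/
noncomputable def rkL (x : V) : W →L[ℂ] (V →L[ℂ] W) := LinearMap.toContinuousLinearMap
  { toFun := fun w => rankOne ℂ w x
    map_add' := by intro a b; ext v; simp [rankOne_apply]
    map_smul' := by intro c a; ext v; simp [rankOne_apply, smul_smul, mul_comm] }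

theorem rkL_apply (x : V) (w : W) (v : V) : rkL x w v = inner ℂ x v • w := by
  show rankOne ℂ w x v = _
  simp [rankOne_apply]

/-- a local holomorphic section of the ambient lines -/
structure LF (f : (V →L[ℂ] W) → (V' →L[ℂ] W')) (A0 : V × W) (Φ : V × W → V' × W') : Prop where
  diff : ∀ᶠ A in nhds A0, DifferentiableAt ℂ Φ A
  mem : ∀ᶠ A in nhds A0, ‖A.2‖ < ‖A.1‖ ∧ Φ A ∈ Amb f A
  nrm : ∀ᶠ A in nhds A0, inner ℂ (Φ A0).1 (Φ A).1 = inner ℂ (Φ A0).1 (Φ A0).1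
  ne : (Φ A0).1 ≠ 0

/-- perturbation of `Z` through `A` -/
noncomputable def sg (x0 : V) (Z : V →L[ℂ] W) (A : V × W) : V →L[ℂ] W :=
  Z + (inner ℂ x0 A.1)⁻¹ • rkL x0 (A.2 - Z A.1)

theorem sg_apply (x0 : V) (Z : V →L[ℂ] W) (A : V × W) (h : inner ℂ x0 A.1 ≠ 0) :
    sg x0 Z A A.1 = A.2 := by
  unfold sg
  rw [ContinuousLinearMap.add_apply, ContinuousLinearMap.smul_apply, rkL_apply, smul_smul,
    inv_mul_cancel₀ h, one_smul]
  abel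

theorem sg_center (x0 : V) (Z : V →L[ℂ] W) (A : V × W) (h : Z A.1 = A.2) : sg x0 Z A = Z := by
  unfold sg
  rw [h, sub_self, map_zero, smul_zero, add_zero]

theorem inner_diff (x0 : V) : Differentiable ℂ (fun A : V × W => inner ℂ x0 A.1) := by
  have : (fun A : V × W => inner ℂ x0 A.1) = fun A => innerSL ℂ x0 A.1 := by funext A; simp
  rw [this]; fun_prop

theorem sg_diff (x0 : V) (Z : V →L[ℂ] W) (A : V × W) (h : inner ℂ x0 A.1 ≠ 0) :
    DifferentiableAt ℂ (sg x0 Z) A := by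
  unfold sg
  have h1 : DifferentiableAt ℂ (fun A : V × W => (inner ℂ x0 A.1)⁻¹) A := (inner_diff x0 A).inv h
  have h2 : DifferentiableAt ℂ (fun A : V × W => rkL x0 (A.2 - Z A.1)) A := by fun_prop
  exact (differentiableAt_const Z).add (h1.smul h2)

theorem exists_LF {f : (V →L[ℂ] W) → (V' →L[ℂ] W')} (hf : PH f) (h1 : AmbOne f) {A0 : V × W}
    (hA0 : ‖A0.2‖ < ‖A0.1‖) {a0 : V' × W'} (ha0 : a0 ∈ Amb f A0) (hne : a0 ≠ 0) :
    ∃ Φ, LF f A0 Φ ∧ Φ A0 = a0 := by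
  classical
  have hm0 : a0.1 ≠ 0 := Amb_fst_ne hA0 ha0 hne
  set m0 := a0.1 with hm0d
  set x0 := A0.1 with hx0d
  have hx0 : x0 ≠ 0 := by
    intro h; rw [h, norm_zero] at hA0; exact absurd hA0 (not_lt.2 (norm_nonneg _))
  obtain ⟨Z00, hZ00, hZ00A, -⟩ := exists_through hA0
  set S : ℂ := inner ℂ m0 m0 with hS
  have hS0 : S ≠ 0 := by rw [hS, inner_self_ne_zero]; exact hm0
  let E : Submodule ℂ V' := (ℂ ∙ m0)ᗮ
  obtain ⟨s, hs⟩ := exists_fin_rows (ι := {Z : V →L[ℂ] W // ‖Z‖ < 1 ∧ Z x0 = A0.2}) (E := E) (F := W')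
    (fun Z => ((f Z.1 - f Z00).comp E.subtypeL : E →L[ℂ] W')) (by
      intro v hv
      have hmem : ((v : V'), f Z00 v) ∈ Amb f A0 := by
        intro Z hZ hZA
        have := hv ⟨Z, hZ, hZA⟩
        exact sub_eq_zero.1 this
      obtain ⟨c, hc⟩ := h1.mem hA0 ha0 hne hmem
      have hc1 : (v : V') = c • m0 := congrArg Prod.fst hc
      have h2 : inner ℂ m0 (v : V') = 0 := v.2 m0 (Submodule.mem_span_singleton_self m0)
      rw [hc1, inner_smul_right, mul_eq_zero] at h2
      rcases h2 with h2 | h2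
      · apply Subtype.ext; rw [hc1, h2, zero_smul]; rfl
      · exact absurd h2 hS0)
  let R0 : E →ₗ[ℂ] (s → W') := LinearMap.pi fun k : s =>
    ((f (k.1 : {Z : V →L[ℂ] W // ‖Z‖ < 1 ∧ Z x0 = A0.2}).1 - f Z00).comp E.subtypeL : E →L[ℂ] W')
  have hR0 : Function.Injective R0 := by
    rw [injective_iff_map_eq_zero]
    intro v hv
    exact hs v fun i hi => congrFun hv ⟨i, hi⟩
  obtain ⟨B, hB⟩ := LinearMap.exists_leftInverse_of_injective R0 (LinearMap.ker_eq_bot.2 hR0)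
  let Bk : s → W' →L[ℂ] V' := fun k => LinearMap.toContinuousLinearMap
    (E.subtype.comp (B.comp (LinearMap.single ℂ (fun _ : s => W') k)))
  have hBk : ∀ w : s → W', ∑ k, Bk k (w k) = (B w : V') := by
    intro w
    have e : w = ∑ k, Pi.single k (w k) := (Finset.univ_sum_single w).symm
    conv_rhs => rw [e, map_sum]
    rw [AddSubmonoidClass.coe_finsetSum]
    rfl
  let Zk : s → V →L[ℂ] W := fun k => (k.1 : {Z : V →L[ℂ] W // ‖Z‖ < 1 ∧ Z x0 = A0.2}).1
  have hZk1 : ∀ k, ‖Zk k‖ < 1 := fun k => k.1.2.1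
  have hZk2 : ∀ k, Zk k A0.1 = A0.2 := fun k => k.1.2.2
  let L : V × W → V' →L[ℂ] V' := fun A => rankOne ℂ m0 m0 +
    ∑ k, (Bk k).comp (f (sg x0 (Zk k) A) - f (sg x0 Z00 A))
  have hLA : ∀ A m, L A m = inner ℂ m0 m • m0 + ∑ k, Bk k (f (sg x0 (Zk k) A) m - f (sg x0 Z00 A) m) := by
    intro A m
    simp [L, ContinuousLinearMap.sum_apply, rankOne_apply]
  have hLinj : Function.Injective (L A0) := by
    rw [injective_iff_map_eq_zero]
    intro m hm
    rw [hLA] at hm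
    simp only [sg_center x0 Z00 A0 hZ00A, sg_center x0 _ A0 (hZk2 _)] at hm
    have heE : m - (inner ℂ m0 m / S) • m0 ∈ E := by
      rw [Submodule.mem_orthogonal_singleton_iff_inner_right, inner_sub_right, inner_smul_right, ← hS,
        div_mul_cancel₀ _ hS0, sub_self]
    have hRk : ∀ k, f (Zk k) m - f Z00 m = R0 ⟨m - (inner ℂ m0 m / S) • m0, heE⟩ k := by
      intro k
      show _ = (f (Zk k) - f Z00) (m - (inner ℂ m0 m / S) • m0)
      have : f (Zk k) m0 = f Z00 m0 := by
        rw [ha0 (Zk k) (hZk1 k) (hZk2 k), ha0 Z00 hZ00 hZ00A]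
      simp [this]
    simp only [hRk] at hm
    rw [hBk] at hm
    have e : B (R0 ⟨m - (inner ℂ m0 m / S) • m0, heE⟩) = ⟨m - (inner ℂ m0 m / S) • m0, heE⟩ :=
      DFunLike.congr_fun hB _
    rw [e] at hm
    simp only at hm
    have h3 : inner ℂ m0 m * S = 0 := by
      have := congrArg (fun z => inner ℂ m0 z) hm
      simp only [inner_add_right, inner_smul_right, inner_sub_right, inner_zero_right] at this
      rw [← hS, div_mul_cancel₀ _ hS0] at this
      simpa using this
    have h4 : inner ℂ m0 m = 0 := by
      rcases mul_eq_zero.1 h3 with h | h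
      · exact h
      · exact absurd h hS0
    rw [h4] at hm
    simpa using hm
  -- good conditions
  have hopen1 : ∀ᶠ A : V × W in nhds A0, inner ℂ x0 A.1 ≠ 0 := by
    have : ContinuousAt (fun A : V × W => inner ℂ x0 A.1) A0 := (inner_diff x0 A0).continuousAt
    exact this.eventually_ne (by rw [← hx0d, inner_self_ne_zero]; exact hx0)
  have hx00 : inner ℂ x0 A0.1 ≠ 0 := by rw [← hx0d, inner_self_ne_zero]; exact hx0
  have hsm : ∀ Z : V →L[ℂ] W, ‖Z‖ < 1 → Z A0.1 = A0.2 → ∀ᶠ A in nhds A0, ‖sg x0 Z A‖ < 1 := by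
    intro Z hZ hZA
    have : ContinuousAt (fun A => ‖sg x0 Z A‖) A0 := (sg_diff x0 Z A0 hx00).continuousAt.norm
    refine this.eventually_lt continuousAt_const ?_
    simp only [sg_center x0 Z A0 hZA]; exact hZ
  have hfd : ∀ Z A, inner ℂ x0 A.1 ≠ 0 → ‖sg x0 Z A‖ < 1 →
      DifferentiableAt ℂ (fun A : V × W => f (sg x0 Z A)) A := by
    intro Z A hA hn
    exact DifferentiableAt.comp (f := sg x0 Z) A (hf.diffAt hn) (sg_diff x0 Z A hA)
  have hLd : ∀ A : V × W, inner ℂ x0 A.1 ≠ 0 → ‖sg x0 Z00 A‖ < 1 → (∀ k, ‖sg x0 (Zk k) A‖ < 1) →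
      DifferentiableAt ℂ L A := by
    intro A hA h0 hk
    refine (differentiableAt_const _).add (DifferentiableAt.fun_sum fun k _ => ?_)
    exact (differentiableAt_const _).clm_comp ((hfd _ A hA (hk k)).sub (hfd _ A hA h0))
  have hc0 := hsm Z00 hZ00 hZ00A
  have hck : ∀ᶠ A in nhds A0, ∀ k, ‖sg x0 (Zk k) A‖ < 1 :=
    Filter.eventually_all.2 fun k => hsm _ (hZk1 k) (hZk2 k)
  have hpos : ∀ᶠ A : V × W in nhds A0, ‖A.2‖ < ‖A.1‖ := by
    have c1 : ContinuousAt (fun A : V × W => ‖A.2‖) A0 := by fun_prop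
    have c2 : ContinuousAt (fun A : V × W => ‖A.1‖) A0 := by fun_prop
    exact c1.eventually_lt c2 hA0
  have hunit : ∀ᶠ A in nhds A0, Function.Injective (L A) :=
    inj_open L A0 (hLd A0 hx00 hc0.self_of_nhds hck.self_of_nhds).continuousAt hLinj
  have : CompleteSpace V' := FiniteDimensional.complete ℂ V'
  let χ : V × W → V' := fun A => S • Ring.inverse (L A) m0
  have hinv : ∀ A, Function.Injective (L A) → ∀ m, Ring.inverse (L A) (L A m) = m := by
    intro A hi m
    have := Ring.inverse_mul_cancel _ (isUnit_of_inj hi)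
    exact DFunLike.congr_fun this m
  -- identify χ with the ambient vector
  have hχ : ∀ A : V × W, inner ℂ x0 A.1 ≠ 0 → ‖sg x0 Z00 A‖ < 1 → (∀ k, ‖sg x0 (Zk k) A‖ < 1) →
      ‖A.2‖ < ‖A.1‖ → Function.Injective (L A) → ∀ a ∈ Amb f A, a ≠ 0 →
      inner ℂ m0 a.1 ≠ 0 ∧ χ A = (S / inner ℂ m0 a.1) • a.1 := by
    intro A hA h0 hk hp hi a ha hane
    have e1 : L A a.1 = inner ℂ m0 a.1 • m0 := by
      rw [hLA]
      have : ∀ k, f (sg x0 (Zk k) A) a.1 - f (sg x0 Z00 A) a.1 = 0 := by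
        intro k
        rw [ha _ (hk k) (sg_apply x0 _ A hA), ha _ h0 (sg_apply x0 _ A hA), sub_self]
      simp [this]
    have e2 := hinv A hi a.1
    rw [e1, map_smul] at e2
    have hn : inner ℂ m0 a.1 ≠ 0 := by
      intro h
      rw [h, zero_smul] at e2
      exact Amb_fst_ne hp ha hane e2.symm
    refine ⟨hn, ?_⟩
    rw [← e2, smul_smul, inner_smul_right]
    have e3 : inner ℂ m0 (Ring.inverse (L A) m0) = 1 := by
      have := congrArg (fun z => inner ℂ m0 z) e2
      simp only [inner_smul_right] at this
      exact mul_left_cancel₀ hn (by rw [this, mul_one])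
    rw [e3, mul_one, div_mul_cancel₀ _ hn]
  let Φ : V × W → V' × W' := fun A => (χ A, f (sg x0 Z00 A) (χ A))
  have hΦ0 : Φ A0 = a0 := by
    have := (hχ A0 hx00 hc0.self_of_nhds hck.self_of_nhds hA0 hLinj a0 ha0 hne).2
    rw [← hm0d, ← hS, div_self hS0, one_smul] at this
    refine Prod.ext this ?_
    show f (sg x0 Z00 A0) (χ A0) = a0.2
    rw [this, sg_center x0 Z00 A0 hZ00A]
    exact ha0 Z00 hZ00 hZ00A
  refine ⟨Φ, ⟨?_, ?_, ?_, ?_⟩, hΦ0⟩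
  · filter_upwards [hopen1, hc0, hck, hunit] with A a1 a2 a3 a4
    have d1 : DifferentiableAt ℂ (fun A => Ring.inverse (L A)) A := by
      have : DifferentiableAt ℂ Ring.inverse (L A) := differentiableAt_inverse (isUnit_of_inj a4)
      exact this.comp A (hLd A a1 a2 a3)
    have d2 : DifferentiableAt ℂ χ A := (d1.clm_apply (differentiableAt_const m0)).const_smul S
    exact d2.prodMk ((hfd Z00 A a1 a2).clm_apply d2)
  · filter_upwards [hopen1, hc0, hck, hunit, hpos] with A a1 a2 a3 a4 a5
    refine ⟨a5, ?_⟩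
    obtain ⟨a, ha, ha1⟩ := h1.exists a5
    have hane : a ≠ 0 := by rintro rfl; exact ha1 rfl
    have e := (hχ A a1 a2 a3 a5 a4 a ha hane).2
    have : Φ A = (S / inner ℂ m0 a.1) • a := by
      refine Prod.ext e ?_
      show f (sg x0 Z00 A) (χ A) = _
      rw [e, map_smul, ha _ a2 (sg_apply x0 _ A a1)]
      rfl
    rw [this]
    exact Submodule.smul_mem _ _ ha
  · rw [hΦ0]
    filter_upwards [hopen1, hc0, hck, hunit, hpos] with A a1 a2 a3 a4 a5
    obtain ⟨a, ha, ha1⟩ := h1.exists a5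
    have hane : a ≠ 0 := by rintro rfl; exact ha1 rfl
    obtain ⟨hn, e⟩ := hχ A a1 a2 a3 a5 a4 a ha hane
    show inner ℂ m0 (χ A) = inner ℂ m0 m0
    rw [e, inner_smul_right, div_mul_cancel₀ _ hn]
  · rw [hΦ0]; exact hm0

end

open Metric InnerProductSpace

section
variable {V W V' W' : Type} [NormedAddCommGroup V] [InnerProductSpace ℂ V] [FiniteDimensional ℂ V]
  [NormedAddCommGroup W] [InnerProductSpace ℂ W] [FiniteDimensional ℂ W]
  [NormedAddCommGroup V'] [InnerProductSpace ℂ V'] [FiniteDimensional ℂ V']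
  [NormedAddCommGroup W'] [InnerProductSpace ℂ W'] [FiniteDimensional ℂ W']

theorem line_deriv {f : (V →L[ℂ] W) → (V' →L[ℂ] W')} (hf : PH f) {Z : V →L[ℂ] W} (hZ : ‖Z‖ < 1)
    (k : V →L[ℂ] W) {φ : ℂ → V' × W'} {φ' : V' × W'} (hφ : HasDerivAt φ φ' 0)
    (h : ∀ᶠ t in nhds (0 : ℂ), f (Z + t • k) (φ t).1 = (φ t).2) :
    fderiv ℂ f Z k (φ 0).1 + f Z φ'.1 = φ'.2 := by
  have h1 : HasDerivAt (fun t : ℂ => f (Z + t • k)) (fderiv ℂ f Z k) 0 := by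
    have e : HasDerivAt (fun t : ℂ => Z + t • k) k 0 := by
      simpa using ((hasDerivAt_id (0 : ℂ)).smul_const k).const_add Z
    have h2 : HasFDerivAt f (fderiv ℂ f Z) (Z + (0 : ℂ) • k) := by
      simpa using (hf.diffAt hZ).hasFDerivAt
    exact h2.comp_hasDerivAt (0 : ℂ) e
  have hA : HasDerivAt (fun t => (φ t).1) φ'.1 0 := hφ.fst
  have hB : HasDerivAt (fun t => (φ t).2) φ'.2 0 := hφ.snd
  have h3 := h1.clm_apply hA
  have h4 := h3.congr_of_eventuallyEq (h.mono fun t ht => ht.symm)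
  have h5 := hB.unique h4
  rw [h5]
  simp

theorem deriv_transfer {f : (V →L[ℂ] W) → (V' →L[ℂ] W')} (hf : PH f)
    {Z0 : V →L[ℂ] W} (hZ0 : ‖Z0‖ < 1) {g : (V × W) ≃L[ℂ] (V × W)} (hg : IsMob g)
    {g' : (V' × W') ≃L[ℂ] (V' × W')} (hg' : IsMob g') (e0 : act g 0 = Z0)
    (f0 : (fun Z => act g' (f (act g Z))) 0 = 0)
    (hA2 : ∀ A : V × W, Z0 A.1 = A.2 → (g.symm A).2 = 0)
    (H : ∀ x : V, x ≠ 0 → ∀ m ∈ MS (fun Z => act g' (f (act g Z))) (ℂ ∙ x) ⊤, ∀ Y,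
      fderiv ℂ (fun Z => act g' (f (act g Z))) 0 Y m = 0)
    {A : V × W} (hA : ‖A.2‖ < ‖A.1‖) (hZA : Z0 A.1 = A.2) {a : V' × W'} (ha : a ∈ Amb f A) (Y : V →L[ℂ] W) :
    fderiv ℂ f Z0 Y a.1 = 0 := by
  have hP := hf.mob hg hg'
  set f1 := (fun Z => act g' (f (act g Z))) with hf1
  have h2 := hA2 A hZA
  have hpos := pos_symm hg.symm hA
  have ha1 : g' a ∈ Amb f1 (g.symm A) := by
    rw [hf1, Amb_mob hf hg hg']; simpa using ha
  have hgA : g.symm A = ((g.symm A).1, 0) := Prod.ext rfl h2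
  rw [hgA, Amb_base f0] at ha1
  have hx : (g.symm A).1 ≠ 0 := by
    intro h; rw [h, norm_zero] at hpos; exact absurd hpos (not_lt.2 (norm_nonneg _))
  have h3 := H _ hx _ ha1.1
  have hs0 : act g.symm Z0 = 0 := by rw [← e0]; exact hg.symm_act (by simp)
  have h4 := mob_fderiv hP hg.symm hg'.symm hZ0 Y (g' a).1
  rw [hs0, h3] at h4
  have h5 : mobA g'.symm (f1 0) (g' a).1 = a.1 := by
    show (g'.symm ((g' a).1, f1 0 (g' a).1)).1 = a.1
    rw [f0]
    have : ((g' a).1, (0 : V' →L[ℂ] W') (g' a).1) = g' a := Prod.ext rfl (by simp [ha1.2])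
    rw [this]; simp
  rw [h5] at h4
  have h6 : fderiv ℂ (fun Z => act g'.symm (f1 (act g.symm Z))) Z0 = fderiv ℂ f Z0 := by
    apply Filter.EventuallyEq.fderiv_eq
    have : ∀ᶠ Z in nhds Z0, ‖Z‖ < 1 := continuous_norm.continuousAt.eventually_lt continuousAt_const hZ0
    filter_upwards [this] with Z hZ
    show act g'.symm (act g' (f (act g (act g.symm Z)))) = f Z
    rw [hg.act_symm hZ, hg'.symm_act (hf.maps _ hZ)]
  rw [h6] at h4
  rw [h4]
  have : ((0 : V'), (0 : W')) = 0 := rfl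
  rw [this]; simp

theorem stepb {f : (V →L[ℂ] W) → (V' →L[ℂ] W')} (hf : PH f) (f0 : f 0 = 0) (h1 : AmbOne f)
    (hqp : Module.finrank ℂ V' < Module.finrank ℂ W) {x : V} (hx : x ≠ 0)
    (H : ∀ Z : V →L[ℂ] W, ‖Z‖ < 1 → ∀ A : V × W, ‖A.2‖ < ‖A.1‖ → Z A.1 = A.2 → ∀ a ∈ Amb f A, ∀ Y,
      fderiv ℂ f Z Y a.1 = 0) : False := by
  have hA0 : ‖((x, 0) : V × W).2‖ < ‖((x, 0) : V × W).1‖ := by simpa using hx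
  obtain ⟨a0, ha0, hm0⟩ := h1.exists hA0
  obtain ⟨Φ, hΦ, hΦ0⟩ := exists_LF hf h1 hA0 ha0 (fun h => hm0 (by rw [h]; rfl))
  have hd : ∀ᶠ A in nhds ((x, 0) : V × W), ∀ h : W, DifferentiableAt ℂ Φ A ∧ fderiv ℂ Φ A (0, h) = 0 := by
    filter_upwards [hΦ.diff, hΦ.mem.eventually_nhds, hΦ.nrm.eventually_nhds] with A hA1 hA2 hA3 h
    refine ⟨hA1, ?_⟩
    have hAp := hA2.self_of_nhds
    have hx1 : A.1 ≠ 0 := by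
      intro h; have := hAp.1; rw [h, norm_zero] at this; exact absurd this (not_lt.2 (norm_nonneg _))
    have hxx : inner ℂ A.1 A.1 ≠ 0 := by rw [inner_self_ne_zero]; exact hx1
    have hc : Filter.Tendsto (fun t : ℂ => A + t • ((0 : V), h)) (nhds 0) (nhds A) := by
      have : Continuous (fun t : ℂ => A + t • ((0 : V), h)) := by fun_prop
      simpa using this.tendsto 0
    have hder : HasDerivAt (fun t : ℂ => Φ (A + t • ((0 : V), h))) (fderiv ℂ Φ A (0, h)) 0 := by
      have e : HasDerivAt (fun t : ℂ => A + t • ((0 : V), h)) ((0 : V), h) 0 := by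
        simpa using ((hasDerivAt_id (0 : ℂ)).smul_const ((0 : V), h)).const_add A
      have h2 : HasFDerivAt Φ (fderiv ℂ Φ A) (A + (0 : ℂ) • ((0 : V), h)) := by
        simpa using hA1.hasFDerivAt
      exact h2.comp_hasDerivAt (0 : ℂ) e
    have hmem : fderiv ℂ Φ A (0, h) ∈ Amb f A := by
      intro Z hZ hZA
      have h3 := line_deriv hf hZ ((inner ℂ A.1 A.1)⁻¹ • rkL A.1 h) hder (by
        filter_upwards [hc.eventually hA2, small_line hZ ((inner ℂ A.1 A.1)⁻¹ • rkL A.1 h)] with t ht ht1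
        refine ht.2 _ ht1 ?_
        have e1 : (A + t • ((0 : V), h)).1 = A.1 := by simp
        rw [e1, ContinuousLinearMap.add_apply, ContinuousLinearMap.smul_apply,
          ContinuousLinearMap.smul_apply, rkL_apply, hZA, smul_smul (inner ℂ A.1 A.1)⁻¹,
          inv_mul_cancel₀ hxx, one_smul]
        simp)
      rw [H Z hZ A hAp.1 hZA _ (by simpa using hAp.2), zero_add] at h3
      exact h3
    have hne : Φ A ≠ 0 := by
      intro h0
      have := hA3.self_of_nhds
      rw [h0] at this
      simp only [Prod.fst_zero, inner_zero_right] at this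
      exact hΦ.ne (inner_self_eq_zero.1 this.symm)
    obtain ⟨c, hc1⟩ := h1.mem hAp.1 hAp.2 hne hmem
    have h5 : inner ℂ (Φ (x, 0)).1 (fderiv ℂ Φ A (0, h)).1 = 0 := by
      have h6 : HasDerivAt (fun t : ℂ => innerSL ℂ (Φ (x, 0)).1 (Φ (A + t • ((0 : V), h))).1)
          (innerSL ℂ (Φ (x, 0)).1 (fderiv ℂ Φ A (0, h)).1) 0 :=
        (innerSL ℂ (Φ (x, 0)).1).hasFDerivAt.comp_hasDerivAt (0 : ℂ) hder.fst
      have h7 : HasDerivAt (fun t : ℂ => innerSL ℂ (Φ (x, 0)).1 (Φ (A + t • ((0 : V), h))).1) 0 0 := by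
        refine (hasDerivAt_const (0 : ℂ) (inner ℂ (Φ (x, 0)).1 (Φ (x, 0)).1)).congr_of_eventuallyEq ?_
        filter_upwards [hc.eventually hA3] with t ht
        simpa using ht
      simpa using h6.unique h7
    rw [hc1] at h5
    simp only [Prod.smul_fst, inner_smul_right] at h5
    rw [hA3.self_of_nhds] at h5
    rcases mul_eq_zero.1 h5 with h6 | h6
    · rw [hc1, h6, zero_smul]
    · exact absurd (inner_self_eq_zero.1 h6) hΦ.ne
  have hcx : Continuous (fun y : W => ((x, y) : V × W)) := by fun_prop
  have hy : ∀ᶠ y : W in nhds 0, ∀ h : W, DifferentiableAt ℂ Φ (x, y) ∧ fderiv ℂ Φ (x, y) (0, h) = 0 :=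
    (hcx.tendsto 0).eventually hd
  have hm : ∀ᶠ y : W in nhds 0, Φ (x, y) ∈ Amb f (x, y) :=
    (hcx.tendsto 0).eventually (hΦ.mem.mono fun A h => h.2)
  obtain ⟨r, hr, hball⟩ := Metric.eventually_nhds_iff_ball.1 (hy.and hm)
  have hconst : ∀ y ∈ ball (0 : W) r, Φ (x, y) = a0 := by
    intro y hy
    rw [← hΦ0]
    have hD : ∀ z ∈ ball (0 : W) r, HasFDerivAt (fun y => Φ (x, y)) (0 : W →L[ℂ] V' × W') z := by
      intro z hz
      have h2 := ((hball z hz).1 0).1.hasFDerivAt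
      have h3 : HasFDerivAt (fun y : W => ((x, y) : V × W)) (ContinuousLinearMap.inr ℂ V W) z :=
        hasFDerivAt_prodMk_right x z
      have h4 := h2.comp z h3
      have e5 : (fderiv ℂ Φ (x, z)).comp (ContinuousLinearMap.inr ℂ V W) = 0 := by
        ext1 h
        exact ((hball z hz).1 h).2
      rw [e5] at h4
      exact h4
    exact isOpen_ball.is_const_of_fderiv_eq_zero (𝕜 := ℂ) (convex_ball (0 : W) r).isPreconnected
      (fun z hz => (hD z hz).differentiableAt.differentiableWithinAt)
      (fun z hz => (hD z hz).fderiv) hy (mem_ball_self hr)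
  have hz : a0.2 = 0 := ((Amb_base f0 x a0).1 ha0).2
  have hzero : ∀ Z ∈ ball (0 : V →L[ℂ] W) 1, f Z a0.1 = 0 := by
    refine convex_ident (fun Z => f Z a0.1) (ball 0 1) isOpen_ball (convex_ball _ _) ?_ 0
      (mem_ball_self one_pos) ?_
    · exact hf.diff.clm_apply (differentiableOn_const _)
    · have hcont : ContinuousAt (fun Z : V →L[ℂ] W => ‖Z x‖) 0 := by fun_prop
      have h6 : ∀ᶠ Z : V →L[ℂ] W in nhds 0, ‖Z x‖ < r :=
        hcont.eventually_lt continuousAt_const (by simpa using hr)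
      filter_upwards [h6, ball_mem_nhds (0 : V →L[ℂ] W) one_pos] with Z hZ1 hZ2
      have h7 : Z x ∈ ball (0 : W) r := by simpa using hZ1
      have h8 := (hball _ h7).2
      rw [hconst _ h7] at h8
      rw [h8 Z (by simpa using hZ2) rfl, hz]
  obtain ⟨m, hmne, hm1, hm2⟩ := CL hf f0 hqp hx
  obtain ⟨c, hc⟩ := h1.mem hA0 ha0 (fun h => hm0 (by rw [h]; rfl)) ((Amb_base f0 x (m, 0)).2 ⟨hm1, rfl⟩)
  have hc1 : m = c • a0.1 := congrArg Prod.fst hc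
  have h9 : m ∈ MS f (ℂ ∙ x)ᗮ ⊤ := by
    intro Z hZ _
    rw [hc1, map_smul, hzero Z (by simpa using hZ), smul_zero]
  exact hmne (inner_self_eq_zero.1 (hm2 m h9))

/-- there is a normalisation at which some ambient vector is not killed by the differential -/
theorem exists_good {f : (V →L[ℂ] W) → (V' →L[ℂ] W')} (hf : PH f) (f0 : f 0 = 0) (h1 : AmbOne f)
    (hqp : Module.finrank ℂ V' < Module.finrank ℂ W) {x : V} (hx : x ≠ 0) :
    ∃ (g : (V × W) ≃L[ℂ] (V × W)) (g' : (V' × W') ≃L[ℂ] (V' × W')), IsMob g ∧ IsMob g' ∧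
      PH (fun Z => act g' (f (act g Z))) ∧ (fun Z => act g' (f (act g Z))) 0 = 0 ∧
      AmbOne (fun Z => act g' (f (act g Z))) ∧
      ∃ x : V, x ≠ 0 ∧ ∃ m ∈ MS (fun Z => act g' (f (act g Z))) (ℂ ∙ x) ⊤, ∃ Y,
        fderiv ℂ (fun Z => act g' (f (act g Z))) 0 Y m ≠ 0 := by
  by_contra hcon
  refine stepb hf f0 h1 hqp hx ?_
  intro Z0 hZ0 A hA hZA a ha Y
  obtain ⟨g, g', hg, hg', e0, hP, h0, hA2⟩ := normalise_at hf hZ0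
  refine deriv_transfer hf hZ0 hg hg' e0 h0 hA2 ?_ hA hZA ha Y
  intro x hx m hm Y
  by_contra hne
  exact hcon ⟨g, g', hg, hg', hP, h0, h1.mob hf hg hg', x, hx, m, hm, Y, hne⟩

/-- orthogonality of ambient vectors -/
theorem Amb_orth0 {f : (V →L[ℂ] W) → (V' →L[ℂ] W')} (hf : PH f) (f0 : f 0 = 0) (h1 : AmbOne f)
    (hqp : Module.finrank ℂ V' < Module.finrank ℂ W) {x w : V} (hx : x ≠ 0) (hxw : inner ℂ x w = 0)
    {m n : V'} (hm : m ∈ MS f (ℂ ∙ x) ⊤) (hn : n ∈ MS f (ℂ ∙ w) ⊤) : inner ℂ m n = 0 := by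
  obtain ⟨k, hk, hk1, hk2⟩ := CL hf f0 hqp hx
  have hA0 : ‖((x, 0) : V × W).2‖ < ‖((x, 0) : V × W).1‖ := by simpa using hx
  obtain ⟨c, hc⟩ := h1.mem hA0 (a := (k, 0)) ((Amb_base f0 x (k, 0)).2 ⟨hk1, rfl⟩)
    (fun h => hk (congrArg Prod.fst h)) ((Amb_base f0 x (m, 0)).2 ⟨hm, rfl⟩)
  have hc1 : m = c • k := congrArg Prod.fst hc
  have hle : (ℂ ∙ w) ≤ (ℂ ∙ x)ᗮ := by
    rw [Submodule.span_singleton_le_iff_mem, Submodule.mem_orthogonal_singleton_iff_inner_right]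
    exact hxw
  have hn2 : n ∈ MS f (ℂ ∙ x)ᗮ ⊤ := MS_mono f hle le_rfl hn
  have := hk2 n hn2
  rw [hc1, inner_smul_left, inner_eq_zero_symm.1 this, mul_zero]

theorem hform_conj (a b : V × W) : hform a b = 0 → hform b a = 0 := by
  intro h
  unfold hform at *
  have := congrArg (starRingEnd ℂ) h
  simpa using this

theorem Amb_orth1 {f : (V →L[ℂ] W) → (V' →L[ℂ] W')} (hf : PH f) (h1 : AmbOne f)
    (hqp : Module.finrank ℂ V' < Module.finrank ℂ W) {A B : V × W} (hA : ‖A.2‖ < ‖A.1‖)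
    (hAB : hform A B = 0) {Z : V →L[ℂ] W} (hZ : ‖Z‖ < 1) (hZA : Z A.1 = A.2) (hZB : Z B.1 = B.2)
    {a b : V' × W'} (ha : a ∈ Amb f A) (hb : b ∈ Amb f B) : hform a b = 0 := by
  obtain ⟨g, g', hg, hg', e0, hP, h0, hA2⟩ := normalise_at hf hZ
  have h2 := hA2 A hZA
  have h3 := hA2 B hZB
  have hpos := pos_symm hg.symm hA
  have ha1 : g' a ∈ Amb (fun Z => act g' (f (act g Z))) (g.symm A) := by
    rw [Amb_mob hf hg hg']; simpa using ha
  have hb1 : g' b ∈ Amb (fun Z => act g' (f (act g Z))) (g.symm B) := by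
    rw [Amb_mob hf hg hg']; simpa using hb
  rw [show g.symm A = ((g.symm A).1, 0) from Prod.ext rfl h2, Amb_base h0] at ha1
  rw [show g.symm B = ((g.symm B).1, 0) from Prod.ext rfl h3, Amb_base h0] at hb1
  have hx : (g.symm A).1 ≠ 0 := by
    intro h; rw [h, norm_zero] at hpos; exact absurd hpos (not_lt.2 (norm_nonneg _))
  have hxw : inner ℂ (g.symm A).1 (g.symm B).1 = 0 := by
    have := hg.symm A B
    rw [hAB] at this
    unfold hform at this
    rw [h2] at this
    simpa using this
  have h5 := Amb_orth0 hP h0 (h1.mob hf hg hg') hqp hx hxw ha1.1 hb1.1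
  rw [← hg' a b]
  unfold hform
  rw [h5, ha1.2]; simp

theorem exists_common {A B : V × W} (hA : ‖A.2‖ < ‖A.1‖) (hB : ‖B.2‖ < ‖B.1‖) (hAB : hform A B = 0) :
    ∃ Z : V →L[ℂ] W, ‖Z‖ < 1 ∧ Z A.1 = A.2 ∧ Z B.1 = B.2 := by
  obtain ⟨Z0, hZ0, hZ0A, -⟩ := exists_through hA
  obtain ⟨g, hg, e0⟩ : ∃ g : (V × W) ≃L[ℂ] (V × W), IsMob g ∧ act g 0 = Z0 :=
    exists_mob Z0 hZ0
  have h2 : (g.symm A).2 = 0 := by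
    have := (hg.graph_iff (Z := 0) (by simp) (g.symm A)).1 (by simpa [e0] using hZ0A)
    simpa using this.symm
  have hpos := pos_symm hg.symm hB
  obtain ⟨Z1, hZ1, hZ1B, hZ1o⟩ := exists_through hpos
  have hxw : inner ℂ (g.symm A).1 (g.symm B).1 = 0 := by
    have := hg.symm A B
    rw [hAB] at this
    unfold hform at this
    rw [h2] at this
    simpa using this
  refine ⟨act g Z1, hg.maps hZ1, ?_, ?_⟩
  · have := (hg.graph_iff hZ1 (g.symm A)).2 (by rw [h2]; exact hZ1o _ (inner_eq_zero_symm.1 hxw))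
    simpa using this
  · have := (hg.graph_iff hZ1 (g.symm B)).2 hZ1B
    simpa using this

theorem Amb_orth {f : (V →L[ℂ] W) → (V' →L[ℂ] W')} (hf : PH f) (h1 : AmbOne f)
    (hqp : Module.finrank ℂ V' < Module.finrank ℂ W) {A B : V × W} (hA : ‖A.2‖ < ‖A.1‖)
    (hB : ‖B.2‖ < ‖B.1‖) (hAB : hform A B = 0)
    {a b : V' × W'} (ha : a ∈ Amb f A) (hb : b ∈ Amb f B) : hform a b = 0 := by
  obtain ⟨Z, hZ, hZA, hZB⟩ := exists_common hA hB hAB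
  exact Amb_orth1 hf h1 hqp hA hAB hZ hZA hZB ha hb

/-- derivative of the form along a curve -/
theorem hform_deriv {Φ : V × W → V' × W'} {A : V × W} (hΦ : DifferentiableAt ℂ Φ A) (η : V × W)
    (b : V' × W') (h : ∀ᶠ t : ℂ in nhds 0, hform b (Φ (A + t • η)) = 0) :
    hform b (fderiv ℂ Φ A η) = 0 := by
  have hder : HasDerivAt (fun t : ℂ => Φ (A + t • η)) (fderiv ℂ Φ A η) 0 := by
    have e : HasDerivAt (fun t : ℂ => A + t • η) η 0 := by
      simpa using ((hasDerivAt_id (0 : ℂ)).smul_const η).const_add A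
    have h2 : HasFDerivAt Φ (fderiv ℂ Φ A) (A + (0 : ℂ) • η) := by
      simpa using hΦ.hasFDerivAt
    exact h2.comp_hasDerivAt (0 : ℂ) e
  have h6 : HasDerivAt (fun t : ℂ => innerSL ℂ b.1 (Φ (A + t • η)).1 - innerSL ℂ b.2 (Φ (A + t • η)).2)
      (innerSL ℂ b.1 (fderiv ℂ Φ A η).1 - innerSL ℂ b.2 (fderiv ℂ Φ A η).2) 0 :=
    ((innerSL ℂ b.1).hasFDerivAt.comp_hasDerivAt (0 : ℂ) hder.fst).sub
      ((innerSL ℂ b.2).hasFDerivAt.comp_hasDerivAt (0 : ℂ) hder.snd)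
  have h7 : HasDerivAt (fun t : ℂ => innerSL ℂ b.1 (Φ (A + t • η)).1 - innerSL ℂ b.2 (Φ (A + t • η)).2) 0 0 := by
    refine (hasDerivAt_const (0 : ℂ) (0 : ℂ)).congr_of_eventuallyEq ?_
    filter_upwards [h] with t ht
    simpa [hform] using ht
  simpa [hform] using h6.unique h7
end

open Metric InnerProductSpace

section
variable {V W V' W' : Type} [NormedAddCommGroup V] [InnerProductSpace ℂ V] [FiniteDimensional ℂ V]
  [NormedAddCommGroup W] [InnerProductSpace ℂ W] [FiniteDimensional ℂ W]
  [NormedAddCommGroup V'] [InnerProductSpace ℂ V'] [FiniteDimensional ℂ V']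
  [NormedAddCommGroup W'] [InnerProductSpace ℂ W'] [FiniteDimensional ℂ W']

theorem eq_zero_of_ball (φ : V →ₗ[ℂ] ℂ) (x0 : V) {ρ : ℝ} (hρ : 0 < ρ) (h : ∀ x ∈ ball x0 ρ, φ x = 0) : φ = 0 := by
  have : LinearMap.ker φ = ⊤ := by
    apply Submodule.eq_top_of_nonempty_interior'
    refine ⟨x0, mem_interior.2 ⟨ball x0 ρ, fun x hx => h x hx, isOpen_ball, mem_ball_self hρ⟩⟩
  exact LinearMap.ker_eq_top.1 this

theorem quad_zero {a b c : ℂ} {ε : ℝ} (hε : 0 < ε) (h : ∀ t : ℂ, ‖t‖ < ε → a + t * b + t ^ 2 * c = 0) : c = 0 := by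
  have h0 := h 0 (by simpa using hε)
  have hn : ‖((ε / 2 : ℝ) : ℂ)‖ < ε := by
    rw [Complex.norm_real, Real.norm_of_nonneg (by positivity)]; linarith
  have h1 := h ((ε / 2 : ℝ) : ℂ) hn
  have h2 := h (-((ε / 2 : ℝ) : ℂ)) (by rw [norm_neg]; exact hn)
  have h3 : ((ε / 2 : ℝ) : ℂ) ^ 2 * c = 0 := by linear_combination (h1 + h2) / 2 - h0
  rcases mul_eq_zero.1 h3 with h4 | h4
  · exfalso
    have : (ε / 2 : ℝ) = 0 := by exact_mod_cast pow_eq_zero_iff (two_ne_zero) |>.1 h4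
    linarith
  · exact h4

theorem TL_aux (α β : Fin 2 → V →ₗ[ℂ] ℂ) (x0 : V) {ρ : ℝ} (hρ : 0 < ρ)
    (hq : ∀ x ∈ ball x0 ρ, α 0 x * β 1 x = α 1 x * β 0 x)
    (hind : ∀ c d : ℂ, c • α 0 + d • α 1 = 0 → c = 0 ∧ d = 0) :
    ∃ r : ℂ, ∃ e : V, α 0 e = 1 ∧ ∀ x, β 0 x = r * α 0 x := by
  have hq2 : ∀ v, α 0 v * β 1 v = α 1 v * β 0 v := by
    intro v
    rcases eq_or_ne v 0 with rfl | hv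
    · simp
    have hv' : 0 < ‖v‖ := norm_pos_iff.2 hv
    have := quad_zero (a := α 0 x0 * β 1 x0 - α 1 x0 * β 0 x0)
      (b := α 0 x0 * β 1 v + α 0 v * β 1 x0 - α 1 x0 * β 0 v - α 1 v * β 0 x0)
      (c := α 0 v * β 1 v - α 1 v * β 0 v) (ε := ρ / ‖v‖) (by positivity) (by
        intro t ht
        have h1 := hq (x0 + t • v) (by
          rw [mem_ball, dist_eq_norm, add_sub_cancel_left, norm_smul]
          rwa [lt_div_iff₀ hv'] at ht)
        simp only [map_add, map_smul, smul_eq_mul] at h1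
        linear_combination h1)
    exact sub_eq_zero.1 this
  have hpol : ∀ v w, α 0 v * β 1 w + α 0 w * β 1 v = α 1 v * β 0 w + α 1 w * β 0 v := by
    intro v w
    have h1 := hq2 (v + w)
    simp only [map_add] at h1
    linear_combination h1 - hq2 v - hq2 w
  have ha : α 0 ≠ 0 := by
    intro h
    have := (hind 1 0 (by simp [h])).1
    exact one_ne_zero this
  obtain ⟨e1, he1⟩ : ∃ e, α 0 e = 1 := by
    obtain ⟨e, he⟩ : ∃ e, α 0 e ≠ 0 := by
      by_contra hcon; push Not at hcon; exact ha (LinearMap.ext hcon)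
    exact ⟨(α 0 e)⁻¹ • e, by simp [inv_mul_cancel₀ he]⟩
  have ha2 : α 1 - (α 1 e1) • α 0 ≠ 0 := by
    intro h
    have := (hind (-(α 1 e1)) 1 (by rw [← h]; module)).2
    exact one_ne_zero this
  obtain ⟨e2, he2⟩ : ∃ e, (α 1 - (α 1 e1) • α 0) e ≠ 0 := by
    by_contra hcon; push Not at hcon; exact ha2 (LinearMap.ext hcon)
  have he2' : α 1 e2 - α 1 e1 * α 0 e2 ≠ 0 := by simpa using he2
  refine ⟨β 0 e1, e1, he1, fun x => ?_⟩
  obtain ⟨y, hy0, hy1⟩ : ∃ y, α 0 y = 0 ∧ α 1 y ≠ 0 := by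
    refine ⟨e2 - (α 0 e2) • e1, by simp [he1], ?_⟩
    intro h
    apply he2'
    simp only [map_sub, map_smul, smul_eq_mul] at h
    linear_combination h
  have pyy := hpol y y
  have p1y := hpol e1 y
  have pyx := hpol y x
  rw [hy0] at pyy p1y pyx
  rw [he1] at p1y
  have h1 : β 0 y = 0 := by
    have : α 1 y * β 0 y = 0 := by linear_combination -pyy / 2
    exact (mul_eq_zero.1 this).resolve_left hy1
  rw [h1] at p1y pyx
  have key : α 1 y * (β 0 x - β 0 e1 * α 0 x) = 0 := by
    linear_combination -pyx + α 0 x * p1y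
  rcases mul_eq_zero.1 key with h | h
  · exact absurd h hy1
  · exact sub_eq_zero.1 h

theorem TL (x0 : V) {ρ : ℝ} (hρ : 0 < ρ) (h0 : (0 : V) ∉ ball x0 ρ) (χ : V → V') (hχ : ContinuousOn χ (ball x0 ρ))
    (B B0 : V' →ₗ[ℂ] V) (l l0 : V → ℂ) (hB : ∀ x ∈ ball x0 ρ, B (χ x) = l x • x)
    (hB0 : ∀ x ∈ ball x0 ρ, B0 (χ x) = l0 x • x) (hl0 : ∀ x ∈ ball x0 ρ, l0 x ≠ 0)
    (hdim : Module.finrank ℂ V' + 2 ≤ 2 * Module.finrank ℂ V) :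
    ∃ r : ℂ, ∀ x ∈ ball x0 ρ, l x = r * l0 x := by
  let L : V' →ₗ[ℂ] V × V := B.prod B0
  have h2 : 1 < Module.finrank ℂ (LinearMap.range L).dualAnnihilator := by
    have e1 := Subspace.finrank_add_finrank_dualAnnihilator_eq (LinearMap.range L)
    have e2 := LinearMap.finrank_range_le L
    rw [Module.finrank_prod] at e1
    omega
  obtain ⟨φ, hφ⟩ : ∃ φ : Fin 2 → (LinearMap.range L).dualAnnihilator, LinearIndependent ℂ φ :=
    exists_linearIndependent_of_le_finrank (by omega)
  let α : Fin 2 → V →ₗ[ℂ] ℂ := fun i => (φ i : Module.Dual ℂ (V × V)).comp (LinearMap.inl ℂ V V)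
  let β : Fin 2 → V →ₗ[ℂ] ℂ := fun i => (φ i : Module.Dual ℂ (V × V)).comp (LinearMap.inr ℂ V V)
  have hab : ∀ i v w, (φ i : Module.Dual ℂ (V × V)) (v, w) = α i v + β i w := by
    intro i v w
    show _ = (φ i : Module.Dual ℂ (V × V)) (v, 0) + (φ i : Module.Dual ℂ (V × V)) (0, w)
    rw [← map_add]; simp
  have hrel : ∀ i, ∀ x ∈ ball x0 ρ, l x * α i x + l0 x * β i x = 0 := by
    intro i x hx
    have h3 := (Submodule.mem_dualAnnihilator _).1 (φ i).2 (L (χ x)) ⟨χ x, rfl⟩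
    have h4 : L (χ x) = (l x • x, l0 x • x) := Prod.ext (hB x hx) (hB0 x hx)
    rw [h4, hab] at h3
    simpa using h3
  have hind : ∀ c d : ℂ, c • α 0 + d • α 1 = 0 → c = 0 ∧ d = 0 := by
    intro c d h
    have hb : c • β 0 + d • β 1 = 0 := by
      refine eq_zero_of_ball _ x0 hρ fun x hx => ?_
      have h3 := hrel 0 x hx
      have h4 := hrel 1 x hx
      have h5 : c * α 0 x + d * α 1 x = 0 := by simpa using DFunLike.congr_fun h x
      have h6 : l0 x * (c * β 0 x + d * β 1 x) = 0 := by linear_combination c * h3 + d * h4 - l x * h5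
      simpa using (mul_eq_zero.1 h6).resolve_left (hl0 x hx)
    have h7 : c • φ 0 + d • φ 1 = 0 := by
      apply Subtype.ext
      apply LinearMap.ext
      rintro ⟨v, w⟩
      show c * (φ 0 : Module.Dual ℂ (V × V)) (v, w) + d * (φ 1 : Module.Dual ℂ (V × V)) (v, w) = 0
      rw [hab, hab]
      have h5 : c * α 0 v + d * α 1 v = 0 := by simpa using DFunLike.congr_fun h v
      have h6 : c * β 0 w + d * β 1 w = 0 := by simpa using DFunLike.congr_fun hb w
      linear_combination h5 + h6
    have h8 := Fintype.linearIndependent_iff.1 hφ ![c, d] (by simpa using h7)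
    exact ⟨h8 0, h8 1⟩
  obtain ⟨r, e, he, hr⟩ := TL_aux α β x0 hρ (by
    intro x hx
    have h3 := hrel 0 x hx
    have h4 := hrel 1 x hx
    have h5 : l0 x * (α 0 x * β 1 x - α 1 x * β 0 x) = 0 := by
      linear_combination α 0 x * h4 - α 1 x * h3
    exact sub_eq_zero.1 ((mul_eq_zero.1 h5).resolve_left (hl0 x hx))) hind
  refine ⟨-r, fun x hx => ?_⟩
  have hx0 : x ≠ 0 := by rintro rfl; exact h0 hx
  have hcont : ∀ (B : V' →ₗ[ℂ] V) (l : V → ℂ), (∀ x ∈ ball x0 ρ, B (χ x) = l x • x) → ContinuousAt l x := by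
    intro B l hB
    have hi : ContinuousAt (fun y : V => inner ℂ x y) x := by fun_prop
    have hBc : Continuous B := B.continuous_of_finiteDimensional
    have hc : ContinuousAt (fun y => inner ℂ x (B (χ y)) / inner ℂ x y) x := by
      have h3 : ContinuousAt (fun y => B (χ y)) x :=
        hBc.continuousAt.comp (hχ.continuousAt (isOpen_ball.mem_nhds hx))
      have h4 : ContinuousAt (fun y => inner ℂ x (B (χ y))) x := continuousAt_const.inner h3
      exact h4.div hi (by rw [inner_self_ne_zero]; exact hx0)
    refine hc.congr ?_
    filter_upwards [isOpen_ball.mem_nhds hx, hi.eventually_ne (by rw [inner_self_ne_zero]; exact hx0)] with y hy hy2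
    rw [hB y hy, inner_smul_right, mul_div_cancel_right₀ _ hy2]
  have hg : ContinuousAt (fun y => l y + r * l0 y) x :=
    (hcont B l hB).add (continuousAt_const.mul (hcont B0 l0 hB0))
  have hrel2 : ∀ y ∈ ball x0 ρ, (l y + r * l0 y) * α 0 y = 0 := by
    intro y hy
    have h3 := hrel 0 y hy
    rw [hr] at h3
    linear_combination h3
  suffices h : l x + r * l0 x = 0 by linear_combination h
  by_cases hax : α 0 x = 0
  · have hline : Filter.Tendsto (fun s : ℂ => x + s • e) (nhds 0) (nhds x) := by
      have : Continuous (fun s : ℂ => x + s • e) := by fun_prop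
      simpa using this.tendsto 0
    have hl1 : Filter.Tendsto (fun s : ℂ => l (x + s • e) + r * l0 (x + s • e)) (nhdsWithin 0 {0}ᶜ)
        (nhds (l x + r * l0 x)) := (hg.tendsto.comp hline).mono_left nhdsWithin_le_nhds
    have hl2 : Filter.Tendsto (fun s : ℂ => l (x + s • e) + r * l0 (x + s • e)) (nhdsWithin 0 {0}ᶜ)
        (nhds 0) := by
      refine tendsto_const_nhds.congr' ?_
      filter_upwards [nhdsWithin_le_nhds (hline.eventually (isOpen_ball.mem_nhds hx)), self_mem_nhdsWithin] with s hs hs0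
      have h3 := hrel2 _ hs
      simp only [map_add, map_smul, hax, he, smul_eq_mul, mul_one, zero_add] at h3
      exact ((mul_eq_zero.1 h3).resolve_right hs0).symm
    exact tendsto_nhds_unique hl1 hl2
  · exact (mul_eq_zero.1 (hrel2 x hx)).resolve_right hax
end

open Metric InnerProductSpace

section
variable {V W V' W' : Type} [NormedAddCommGroup V] [InnerProductSpace ℂ V] [FiniteDimensional ℂ V]
  [NormedAddCommGroup W] [InnerProductSpace ℂ W] [FiniteDimensional ℂ W]
  [NormedAddCommGroup V'] [InnerProductSpace ℂ V'] [FiniteDimensional ℂ V']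
  [NormedAddCommGroup W'] [InnerProductSpace ℂ W'] [FiniteDimensional ℂ W']

/-- good directions -/
def Good (f : (V →L[ℂ] W) → (V' →L[ℂ] W')) (x : V) : Prop :=
  x ≠ 0 ∧ ∃ m ∈ MS f (ℂ ∙ x) ⊤, ∃ Y, fderiv ℂ f 0 Y m ≠ 0

theorem lift0 {f : (V →L[ℂ] W) → (V' →L[ℂ] W')} (hf : PH f) (f0 : f 0 = 0) (h1 : AmbOne f)
    {x : V} (hx : x ≠ 0) {m : V'} (hm : m ∈ MS f (ℂ ∙ x) ⊤) (hm0 : m ≠ 0) :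
    ∃ ρ > 0, ∃ χ : V → V', χ x = m ∧ DifferentiableOn ℂ χ (ball x ρ) ∧
      ∀ y ∈ ball x ρ, y ≠ 0 ∧ χ y ≠ 0 ∧ χ y ∈ MS f (ℂ ∙ y) ⊤ := by
  have hA0 : ‖((x, 0) : V × W).2‖ < ‖((x, 0) : V × W).1‖ := by simpa using hx
  obtain ⟨Φ, hΦ, hΦ0⟩ := exists_LF hf h1 hA0 (a0 := (m, 0)) ((Amb_base f0 x (m, 0)).2 ⟨hm, rfl⟩)
    (fun h => hm0 (congrArg Prod.fst h))
  have hcx : Continuous (fun y : V => ((y, 0) : V × W)) := by fun_prop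
  have hall := (hcx.tendsto x).eventually ((hΦ.diff.and hΦ.mem).and hΦ.nrm)
  obtain ⟨ρ, hρ, hball⟩ := Metric.eventually_nhds_iff_ball.1 hall
  refine ⟨ρ, hρ, fun y => (Φ (y, 0)).1, by simp only [hΦ0], ?_, ?_⟩
  · intro y hy
    have h2 := (hball y hy).1.1
    have h3 : DifferentiableAt ℂ (fun y : V => ((y, 0) : V × W)) y := by fun_prop
    have h4 : DifferentiableAt ℂ (fun y => Φ (y, 0)) y := DifferentiableAt.comp y h2 h3
    exact h4.fst.differentiableWithinAt
  · intro y hy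
    obtain ⟨⟨_, h3, h4⟩, h5⟩ := hball y hy
    refine ⟨?_, ?_, ((Amb_base f0 y _).1 h4).1⟩
    · rintro rfl; simp at h3
    · intro h6
      replace h6 : (Φ (y, 0)).1 = 0 := h6
      rw [h6, inner_zero_right] at h5
      exact hΦ.ne (inner_self_eq_zero.1 h5.symm)

theorem Tx_exists {f : (V →L[ℂ] W) → (V' →L[ℂ] W')} (hf : PH f) {x : V} (hx : x ≠ 0) {m : V'}
    (hm : m ∈ MS f (ℂ ∙ x) ⊤) : ∃ T : W →ₗ[ℂ] W', ∀ Y, fderiv ℂ f 0 Y m = T (Y x) := by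
  have hxx : inner ℂ x x ≠ 0 := by rw [inner_self_ne_zero]; exact hx
  let T : W →ₗ[ℂ] W' :=
    { toFun := fun h => fderiv ℂ f 0 ((inner ℂ x x)⁻¹ • rkL x h) m
      map_add' := by intro a b; simp
      map_smul' := by intro c a; simp [smul_smul, mul_comm] }
  refine ⟨T, fun Y => ?_⟩
  show _ = fderiv ℂ f 0 ((inner ℂ x x)⁻¹ • rkL x (Y x)) m
  rw [← sub_eq_zero, ← ContinuousLinearMap.sub_apply, ← map_sub]
  refine fderiv_MS hf hm ⟨?_, fun v => Submodule.mem_top⟩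
  intro k hk
  obtain ⟨c, rfl⟩ := Submodule.mem_span_singleton.1 hk
  rw [map_smul, ContinuousLinearMap.sub_apply, ContinuousLinearMap.smul_apply, rkL_apply, smul_smul,
    inv_mul_cancel₀ hxx, one_smul, sub_self, smul_zero]

theorem exists_map_apply {x : V} (hx : x ≠ 0) (h : W) : ∃ Y : V →L[ℂ] W, Y x = h := by
  have hxx : inner ℂ x x ≠ 0 := by rw [inner_self_ne_zero]; exact hx
  refine ⟨(inner ℂ x x)⁻¹ • rkL x h, ?_⟩
  rw [ContinuousLinearMap.smul_apply, rkL_apply, smul_smul, inv_mul_cancel₀ hxx, one_smul]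

theorem good_linear {f : (V →L[ℂ] W) → (V' →L[ℂ] W')} (hf : PH f) (f0 : f 0 = 0) (h1 : AmbOne f)
    (hdim : Module.finrank ℂ V' + 2 ≤ 2 * Module.finrank ℂ V)
    {x0 : V} (hx0 : x0 ≠ 0) {m0 : V'} (hm0 : m0 ∈ MS f (ℂ ∙ x0) ⊤) {T0 : W →ₗ[ℂ] W'}
    (hT0 : ∀ Y, fderiv ℂ f 0 Y m0 = T0 (Y x0)) (hTn : T0 ≠ 0) :
    ∃ P : V →ₗ[ℂ] V', ∀ Y v, fderiv ℂ f 0 Y (P v) = T0 (Y v) := by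
  classical
  set F := fderiv ℂ f 0 with hF
  obtain ⟨h0, hh0⟩ : ∃ h0, T0 h0 ≠ 0 := by
    by_contra hcon; push Not at hcon; exact hTn (LinearMap.ext hcon)
  have hmne : m0 ≠ 0 := by
    rintro rfl
    obtain ⟨Y, hY⟩ := exists_map_apply hx0 h0
    have := hT0 Y
    rw [hY, map_zero] at this
    exact hh0 this.symm
  set n0 := T0 h0 with hn0
  obtain ⟨ρ, hρ, χ, hχ0, hχd, hχ⟩ := lift0 hf f0 h1 hx0 hm0 hmne
  have hTex : ∀ x : V, ∃ T : W →ₗ[ℂ] W', x ∈ ball x0 ρ → ∀ Y, F Y (χ x) = T (Y x) := by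
    intro x
    by_cases hx : x ∈ ball x0 ρ
    · obtain ⟨T, hT⟩ := Tx_exists hf (hχ x hx).1 (hχ x hx).2.2
      exact ⟨T, fun _ => hT⟩
    · exact ⟨0, fun h => absurd h hx⟩
  choose Tx hTx using hTex
  have hTx0 : Tx x0 = T0 := by
    ext h
    obtain ⟨Y, hY⟩ := exists_map_apply hx0 h
    have h3 := hTx x0 (mem_ball_self hρ) Y
    rw [hχ0, hT0, hY] at h3
    exact h3.symm
  have hBs : ∀ h n, ∃ B : V' →ₗ[ℂ] V, ∀ x ∈ ball x0 ρ, B (χ x) = (inner ℂ n (Tx x h)) • x := by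
    intro h n
    obtain ⟨B, hB⟩ := exists_Bs F h n
    refine ⟨B, fun x hx => ext_inner_left ℂ fun v => ?_⟩
    rw [hB, hTx x hx, rankOne_apply, map_smul, inner_smul_right, inner_smul_right, mul_comm]
  obtain ⟨B0, hB0⟩ := hBs h0 n0
  -- shrink
  obtain ⟨ρ', hρ', hle, hne⟩ : ∃ ρ' > 0, ρ' ≤ ρ ∧ ∀ x ∈ ball x0 ρ', inner ℂ n0 (Tx x h0) ≠ 0 := by
    have hc : ContinuousAt (fun y => inner ℂ x0 (B0 (χ y))) x0 := by
      have hBc : Continuous B0 := B0.continuous_of_finiteDimensional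
      have h3 : ContinuousAt (fun y => B0 (χ y)) x0 :=
        hBc.continuousAt.comp (hχd.continuousOn.continuousAt (isOpen_ball.mem_nhds (mem_ball_self hρ)))
      exact continuousAt_const.inner h3
    have h4 : ∀ᶠ y in nhds x0, inner ℂ x0 (B0 (χ y)) ≠ 0 := by
      refine hc.eventually_ne ?_
      rw [hB0 x0 (mem_ball_self hρ), hTx0, inner_smul_right]
      exact mul_ne_zero (by rw [inner_self_ne_zero]; exact hh0) (by rw [inner_self_ne_zero]; exact hx0)
    obtain ⟨ε, hε, hb⟩ := Metric.eventually_nhds_iff_ball.1 h4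
    refine ⟨min ε ρ, lt_min hε hρ, min_le_right _ _, fun x hx hz => ?_⟩
    have := hb x (ball_subset_ball (min_le_left _ _) hx)
    rw [hB0 x (ball_subset_ball (min_le_right _ _) hx), hz, zero_smul, inner_zero_right] at this
    exact this rfl
  have hsub : ball x0 ρ' ⊆ ball x0 ρ := ball_subset_ball hle
  have hl0 : inner ℂ n0 (T0 h0) ≠ 0 := by
    have := hne x0 (mem_ball_self hρ'); rwa [hTx0] at this
  have hprop : ∀ x ∈ ball x0 ρ', ∀ h, Tx x h = (inner ℂ n0 (Tx x h0) / inner ℂ n0 (T0 h0)) • T0 h := by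
    intro x hx h
    refine ext_inner_left ℂ fun n => ?_
    obtain ⟨B, hB⟩ := hBs h n
    obtain ⟨r, hr⟩ := TL x0 hρ' (fun h => (hχ 0 (hsub h)).1 rfl) χ (hχd.continuousOn.mono hsub) B B0
      (fun x => inner ℂ n (Tx x h)) (fun x => inner ℂ n0 (Tx x h0)) (fun x hx => hB x (hsub hx))
      (fun x hx => hB0 x (hsub hx)) hne hdim
    have h3 := hr x0 (mem_ball_self hρ')
    simp only [hTx0] at h3
    rw [hr x hx, inner_smul_right, h3]
    field_simp
  let S : Submodule ℂ V :=
    { carrier := {x | ∃ m, ∀ Y, F Y m = T0 (Y x)}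
      add_mem' := by
        rintro a b ⟨m, hm⟩ ⟨n, hn⟩
        exact ⟨m + n, fun Y => by simp [hm, hn]⟩
      zero_mem' := ⟨0, fun Y => by simp⟩
      smul_mem' := by
        rintro c a ⟨m, hm⟩
        exact ⟨c • m, fun Y => by simp [hm]⟩ }
  have hS : S = ⊤ := by
    apply Submodule.eq_top_of_nonempty_interior'
    refine ⟨x0, mem_interior.2 ⟨ball x0 ρ', fun x hx => ?_, isOpen_ball, mem_ball_self hρ'⟩⟩
    refine ⟨(inner ℂ n0 (Tx x h0) / inner ℂ n0 (T0 h0))⁻¹ • χ x, fun Y => ?_⟩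
    rw [map_smul, hTx x (hsub hx), hprop x hx (Y x), smul_smul, inv_mul_cancel₀ (div_ne_zero (hne x hx) hl0), one_smul]
  have hall : ∀ v : V, ∃ m, ∀ Y, F Y m = T0 (Y v) := fun v => by
    have : v ∈ S := by rw [hS]; trivial
    exact this
  choose p hp using hall
  let b := stdOrthonormalBasis ℂ V
  refine ⟨b.toBasis.constr ℂ fun i => p (b i), fun Y v => ?_⟩
  have e : ((F Y : V' →ₗ[ℂ] W').comp (b.toBasis.constr ℂ fun i => p (b i))) = T0.comp (Y : V →ₗ[ℂ] W) := by
    refine b.toBasis.ext fun i => ?_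
    rw [LinearMap.comp_apply, Module.Basis.constr_basis, LinearMap.comp_apply, OrthonormalBasis.coe_toBasis]
    exact hp (b i) Y
  exact DFunLike.congr_fun e v

theorem T_prop (F : (V →L[ℂ] W) →L[ℂ] (V' →L[ℂ] W')) (hdim : Module.finrank ℂ V' < 2 * Module.finrank ℂ V)
    {P P2 : V →ₗ[ℂ] V'} {T T2 : W →ₗ[ℂ] W'} (hT : T ≠ 0)
    (h : ∀ Y v, F Y (P v) = T (Y v)) (h2 : ∀ Y v, F Y (P2 v) = T2 (Y v)) : ∃ c : ℂ, T2 = c • T := by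
  have hni : ¬ Function.Injective (P.coprod P2) := by
    intro hi
    have := LinearMap.finrank_le_finrank_of_injective hi
    rw [Module.finrank_prod] at this
    omega
  rw [injective_iff_map_eq_zero] at hni
  push Not at hni
  obtain ⟨⟨v, w⟩, hvw, hne⟩ := hni
  have hs : P v + P2 w = 0 := by simpa using hvw
  have key : ∀ u h', inner ℂ u v • T h' + inner ℂ u w • T2 h' = 0 := by
    intro u h'
    have := congrArg (F (rankOne ℂ h' u)) hs
    simpa [h, h2, rankOne_apply] using this
  by_cases hw : w = 0
  · exfalso
    have hv : v ≠ 0 := by rintro rfl; exact hne (by rw [hw]; rfl)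
    apply hT
    ext h'
    have := key v h'
    rw [hw, inner_zero_right, zero_smul, add_zero] at this
    rcases smul_eq_zero.1 this with h3 | h3
    · exact absurd (inner_self_eq_zero.1 h3) hv
    · simpa using h3
  · have hww : inner ℂ w w ≠ 0 := by rw [inner_self_ne_zero]; exact hw
    refine ⟨-((inner ℂ w w)⁻¹ * inner ℂ w v), ?_⟩
    ext h'
    have := key w h'
    have h3 : inner ℂ w w • T2 h' = -(inner ℂ w v • T h') := by
      rw [eq_neg_iff_add_eq_zero, add_comm]; exact this
    have h4 := congrArg (fun z => (inner ℂ w w)⁻¹ • z) h3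
    simp only [smul_smul, inv_mul_cancel₀ hww, one_smul] at h4
    rw [h4, LinearMap.smul_apply, smul_neg, smul_smul, neg_smul]

theorem Good.nhds {f : (V →L[ℂ] W) → (V' →L[ℂ] W')} (hf : PH f) (f0 : f 0 = 0) (h1 : AmbOne f)
    {x : V} (hx : Good f x) : ∀ᶠ y in nhds x, Good f y := by
  obtain ⟨hx0, m, hm, Y, hY⟩ := hx
  obtain ⟨ρ, hρ, χ, hχ0, hχd, hχ⟩ := lift0 hf f0 h1 hx0 hm (by rintro rfl; simp at hY)
  have hc : ContinuousAt (fun y => fderiv ℂ f 0 Y (χ y)) x :=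
    (fderiv ℂ f 0 Y).continuous.continuousAt.comp
      (hχd.continuousOn.continuousAt (isOpen_ball.mem_nhds (mem_ball_self hρ)))
  filter_upwards [hc.eventually_ne (by rw [hχ0]; exact hY), ball_mem_nhds x hρ] with y h2 h3
  exact ⟨(hχ y h3).1, χ y, (hχ y h3).2.2, Y, h2⟩

theorem Good.smul {f : (V →L[ℂ] W) → (V' →L[ℂ] W')} {x : V} (hx : Good f x) {c : ℂ} (hc : c ≠ 0) :
    Good f (c • x) := by
  obtain ⟨hx0, m, hm, Y, hY⟩ := hx
  refine ⟨smul_ne_zero hc hx0, m, ?_, Y, hY⟩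
  rwa [Submodule.span_singleton_smul_eq (IsUnit.mk0 c hc)]

/-- density of good directions on a complex line -/
theorem good_line {f : (V →L[ℂ] W) → (V' →L[ℂ] W')} (hf : PH f) (f0 : f 0 = 0) (h1 : AmbOne f)
    {x w : V} (hx : Good f x) (hne : ∀ t : ℂ, w + t • x ≠ 0) (U : Set ℂ) (hU : U ∈ nhds (0 : ℂ)) :
    ∃ t ∈ U, Good f (w + t • x) := by
  by_contra hcon
  push Not at hcon
  have hAone : ∀ y : V, y ≠ 0 → ∀ k ∈ MS f (ℂ ∙ y) ⊤, ∀ m ∈ MS f (ℂ ∙ y) ⊤, k ≠ 0 → ∃ c : ℂ, m = c • k := by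
    intro y hy k hk m hm hk0
    obtain ⟨c, hc⟩ := h1.mem (A := (y, 0)) (by simpa using hy) (a := (k, 0)) ((Amb_base f0 y (k, 0)).2 ⟨hk, rfl⟩)
      (fun h => hk0 (congrArg Prod.fst h)) ((Amb_base f0 y (m, 0)).2 ⟨hm, rfl⟩)
    exact ⟨c, congrArg Prod.fst hc⟩
  let Bad : Set ℂ := {t | ¬ Good f (w + t • x)}
  have hI : interior Bad = Set.univ := by
    have hsub : Set.univ ⊆ interior Bad := by
      refine isPreconnected_univ.subset_of_closure_inter_subset isOpen_interior ?_ ?_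
      · exact ⟨0, trivial, mem_interior_iff_mem_nhds.2 (Filter.mem_of_superset hU fun t ht => hcon t ht)⟩
      · rintro t ⟨ht, -⟩
        have hA0 : ‖((w + t • x, 0) : V × W).2‖ < ‖((w + t • x, 0) : V × W).1‖ := by simpa using hne t
        obtain ⟨a, ha, ha0⟩ := h1.exists hA0
        obtain ⟨ρ, hρ, χ, -, hχd, hχ⟩ := lift0 hf f0 h1 (hne t) ((Amb_base f0 _ a).1 ha).1 ha0
        have hl : Continuous fun s : ℂ => w + s • x := by fun_prop
        obtain ⟨ε, hε, hb⟩ := Metric.mem_nhds_iff.1 ((hl.tendsto t).eventually (ball_mem_nhds _ hρ))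
        have hb' : ∀ s ∈ ball t ε, w + s • x ∈ ball (w + t • x) ρ := fun s hs => hb hs
        obtain ⟨s0, hs0, hs1⟩ := Metric.mem_closure_iff.1 ht ε hε
        have hs1' : s0 ∈ ball t ε := by rw [mem_ball, dist_comm]; exact hs1
        refine mem_interior.2 ⟨ball t ε, fun s hs => ?_, isOpen_ball, mem_ball_self hε⟩
        rintro ⟨hy0, m, hm, Y, hY⟩
        have hz : ∀ s ∈ ball t ε, fderiv ℂ f 0 Y (χ (w + s • x)) = 0 := by
          refine convex_ident (fun s => fderiv ℂ f 0 Y (χ (w + s • x))) (ball t ε) isOpen_ball (convex_ball _ _) ?_ s0 hs1' ?_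
          · have h3 : DifferentiableOn ℂ (fun s : ℂ => χ (w + s • x)) (ball t ε) :=
              hχd.comp (by fun_prop : Differentiable ℂ fun s : ℂ => w + s • x).differentiableOn hb'
            exact (fderiv ℂ f 0 Y).differentiable.comp_differentiableOn h3
          · filter_upwards [isOpen_interior.mem_nhds hs0, isOpen_ball.mem_nhds hs1'] with s hs hs2
            by_contra hn
            exact interior_subset hs ⟨(hχ _ (hb' s hs2)).1, _, (hχ _ (hb' s hs2)).2.2, Y, hn⟩
        obtain ⟨c, hc⟩ := hAone _ hy0 _ (hχ _ (hb' s hs)).2.2 _ hm (hχ _ (hb' s hs)).2.1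
        apply hY
        rw [hc, map_smul, hz s hs, smul_zero]
    exact Set.univ_subset_iff.1 hsub
  have hl : Continuous fun s : ℂ => x + s • w := by fun_prop
  have hg := (hl.tendsto 0).eventually (by simpa using hx.nhds hf f0 h1 : ∀ᶠ y in nhds (x + (0 : ℂ) • w), Good f y)
  obtain ⟨ε, hε, hb⟩ := Metric.eventually_nhds_iff_ball.1 hg
  have hs : ((ε / 2 : ℝ) : ℂ) ∈ ball (0 : ℂ) ε := by
    rw [mem_ball_zero_iff, Complex.norm_real, Real.norm_of_nonneg (by positivity)]; linarith
  have hs0 : ((ε / 2 : ℝ) : ℂ) ≠ 0 := by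
    intro h
    have : (ε / 2 : ℝ) = 0 := by exact_mod_cast h
    linarith
  have h5 := (hb _ hs).smul (inv_ne_zero hs0)
  rw [smul_add, smul_smul _ _ w, inv_mul_cancel₀ hs0, one_smul, add_comm] at h5
  have h6 : (((ε / 2 : ℝ) : ℂ))⁻¹ ∈ Bad := interior_subset (by rw [hI]; trivial)
  exact h6 h5

theorem good_frame {f : (V →L[ℂ] W) → (V' →L[ℂ] W')} (hf : PH f) (f0 : f 0 = 0) (h1 : AmbOne f)
    {ι : Type} [DecidableEq ι] (i0 : ι) (s : Finset ι) (b : ι → V) (hb : ∀ i, b i ≠ 0)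
    (ho : ∀ i j, i ≠ j → inner ℂ (b i) (b j) = 0) (hi0 : Good f (b i0)) :
    ∃ e : ι → V, (∀ i, e i ≠ 0) ∧ (∀ i j, i ≠ j → inner ℂ (e i) (e j) = 0) ∧ Good f (e i0) ∧
      ∀ i ∈ s, Good f (e i) := by
  induction s using Finset.induction_on with
  | empty => exact ⟨b, hb, ho, hi0, by simp⟩
  | insert j s hj ih =>
    obtain ⟨e, he, heo, h0, hs⟩ := ih
    by_cases hj0 : j = i0
    · refine ⟨e, he, heo, h0, fun i hi => ?_⟩
      rcases Finset.mem_insert.1 hi with rfl | hi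
      · rw [hj0]; exact h0
      · exact hs i hi
    have hji : inner ℂ (e j) (e i0) = 0 := heo j i0 hj0
    have hij : inner ℂ (e i0) (e j) = 0 := heo i0 j (Ne.symm hj0)
    have hjj : inner ℂ (e j) (e j) ≠ 0 := by rw [inner_self_ne_zero]; exact he j
    have hii : inner ℂ (e i0) (e i0) ≠ 0 := by rw [inner_self_ne_zero]; exact he i0
    let c : ℂ → ℂ := fun t => (starRingEnd ℂ) t * (inner ℂ (e i0) (e i0) / inner ℂ (e j) (e j))
    have hcc : Continuous fun t => e i0 - c t • e j := by
      have : Continuous c := by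
        show Continuous fun t => (starRingEnd ℂ) t * (inner ℂ (e i0) (e i0) / inner ℂ (e j) (e j))
        exact Complex.continuous_conj.mul continuous_const
      fun_prop
    have hc0 : e i0 - c 0 • e j = e i0 := by simp [c]
    have hU := (hcc.tendsto 0).eventually (by rw [hc0]; exact h0.nhds hf f0 h1)
    have hne : ∀ t : ℂ, e j + t • e i0 ≠ 0 := by
      intro t ht
      have := congrArg (fun z => inner ℂ (e j) z) ht
      simp only [inner_add_right, inner_smul_right, hji, mul_zero, add_zero, inner_zero_right] at this
      exact hjj this
    obtain ⟨t, htU, htG⟩ := good_line hf f0 h1 h0 hne _ hU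
    have htU' : Good f (e i0 - c t • e j) := htU
    have hreal : ∀ v : V, (starRingEnd ℂ) (inner ℂ v v) = inner ℂ v v := fun v => inner_conj_symm v v
    have horth : inner ℂ (e i0 - c t • e j) (e j + t • e i0) = 0 := by
      simp only [inner_add_right, inner_sub_left, inner_smul_left, inner_smul_right, hij, hji, c, map_mul,
        map_div₀, hreal, Complex.conj_conj]
      field_simp
      ring
    let e' : ι → V := fun i => if i = j then e j + t • e i0 else if i = i0 then e i0 - c t • e j else e i
    have e1 : e' j = e j + t • e i0 := by simp [e']
    have e2 : e' i0 = e i0 - c t • e j := by simp [e', Ne.symm hj0]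
    have e3 : ∀ i, i ≠ j → i ≠ i0 → e' i = e i := fun i h h' => by simp [e', h, h']
    have o1 : ∀ i, i ≠ j → i ≠ i0 → inner ℂ (e i) (e' j) = 0 := by
      intro i h h'
      rw [e1, inner_add_right, inner_smul_right, heo i j h, heo i i0 h']; simp
    have o2 : ∀ i, i ≠ j → i ≠ i0 → inner ℂ (e i) (e' i0) = 0 := by
      intro i h h'
      rw [e2, inner_sub_right, inner_smul_right, heo i j h, heo i i0 h']; simp
    refine ⟨e', ?_, ?_, ?_, ?_⟩
    · intro i
      by_cases h : i = j
      · rw [h, e1]; exact hne t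
      by_cases h' : i = i0
      · rw [h', e2]; exact htU'.1
      rw [e3 i h h']; exact he i
    · intro i k hik
      by_cases h : i = j
      · subst h
        by_cases h' : k = i0
        · rw [h', e1, e2]; exact inner_eq_zero_symm.1 horth
        · rw [e3 k (Ne.symm hik) h']; exact inner_eq_zero_symm.1 (o1 k (Ne.symm hik) h')
      by_cases h' : i = i0
      · subst h'
        by_cases hk : k = j
        · rw [hk, e1, e2]; exact horth
        · rw [e3 k hk (Ne.symm hik)]; exact inner_eq_zero_symm.1 (o2 k hk (Ne.symm hik))
      rw [e3 i h h']
      by_cases hk : k = j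
      · rw [hk]; exact o1 i h h'
      by_cases hk' : k = i0
      · rw [hk']; exact o2 i h h'
      rw [e3 k hk hk']; exact heo i k hik
    · rw [e2]; exact htU'
    · intro i hi
      by_cases h : i = j
      · rw [h, e1]; exact htG
      by_cases h' : i = i0
      · rw [h', e2]; exact htU'
      rw [e3 i h h']
      exact hs i ((Finset.mem_insert.1 hi).resolve_left h)

/-- an orthonormal basis of good vectors with a common linear model -/
theorem good_basis {f : (V →L[ℂ] W) → (V' →L[ℂ] W')} (hf : PH f) (f0 : f 0 = 0) (h1 : AmbOne f)
    (hdim : Module.finrank ℂ V' + 2 ≤ 2 * Module.finrank ℂ V) {x : V} (hx : Good f x) :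
    ∃ (e : OrthonormalBasis (Fin (Module.finrank ℂ V)) ℂ V) (m : Fin (Module.finrank ℂ V) → V')
      (T : W →ₗ[ℂ] W'), T ≠ 0 ∧ ∀ i, m i ∈ MS f (ℂ ∙ (e i)) ⊤ ∧ ∀ Y, fderiv ℂ f 0 Y (m i) = T (Y (e i)) := by
  classical
  have hxn : ‖x‖ ≠ 0 := norm_ne_zero_iff.2 hx.1
  have hxn' : ((‖x‖ : ℝ) : ℂ)⁻¹ ≠ 0 := inv_ne_zero (by exact_mod_cast hxn)
  have hux : ‖((‖x‖ : ℝ) : ℂ)⁻¹ • x‖ = 1 := by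
    rw [norm_smul, norm_inv, Complex.norm_real, norm_norm, inv_mul_cancel₀ hxn]
  obtain ⟨b, i0, hbi⟩ := exists_onb_with hux
  obtain ⟨e0, he0, heo, -, hg⟩ := good_frame hf f0 h1 i0 Finset.univ b (fun i => by
      intro h; have := b.orthonormal.1 i; rw [h, norm_zero] at this; exact zero_ne_one this)
    (fun i j hij => b.orthonormal.2 hij) (by rw [hbi]; exact hx.smul hxn')
  let e1 : Fin (Module.finrank ℂ V) → V := fun i => ((‖e0 i‖ : ℝ) : ℂ)⁻¹ • e0 i
  have hon : Orthonormal ℂ e1 := by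
    refine ⟨fun i => ?_, fun i j hij => ?_⟩
    · show ‖((‖e0 i‖ : ℝ) : ℂ)⁻¹ • e0 i‖ = 1
      rw [norm_smul, norm_inv, Complex.norm_real, norm_norm, inv_mul_cancel₀ (norm_ne_zero_iff.2 (he0 i))]
    · show inner ℂ (((‖e0 i‖ : ℝ) : ℂ)⁻¹ • e0 i) (((‖e0 j‖ : ℝ) : ℂ)⁻¹ • e0 j) = 0
      rw [inner_smul_left, inner_smul_right, heo i j hij]; simp
  have hg1 : ∀ i, Good f (e1 i) := fun i => (hg i (Finset.mem_univ i)).smul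
    (inv_ne_zero (by exact_mod_cast norm_ne_zero_iff.2 (he0 i)))
  obtain ⟨e, he⟩ : ∃ e : OrthonormalBasis (Fin (Module.finrank ℂ V)) ℂ V, ⇑e = e1 := by
    refine ⟨OrthonormalBasis.mk hon ?_, OrthonormalBasis.coe_mk _ _⟩
    rw [hon.linearIndependent.span_eq_top_of_card_eq_finrank' (by simp)]
  rw [← he] at hg1
  have hex : ∀ i, ∃ m ∈ MS f (ℂ ∙ (e i)) ⊤, ∃ T : W →ₗ[ℂ] W', T ≠ 0 ∧
      ∀ Y, fderiv ℂ f 0 Y m = T (Y (e i)) := by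
    intro i
    obtain ⟨h0, m, hm, Y, hY⟩ := hg1 i
    obtain ⟨T, hT⟩ := Tx_exists hf h0 hm
    refine ⟨m, hm, T, ?_, hT⟩
    rintro rfl
    rw [hT] at hY; simp at hY
  choose m hm T hT0 hT using hex
  have hP : ∀ i, ∃ P : V →ₗ[ℂ] V', ∀ Y v, fderiv ℂ f 0 Y (P v) = T i (Y v) := fun i =>
    good_linear hf f0 h1 hdim (hg1 i).1 (hm i) (hT i) (hT0 i)
  choose P hP using hP
  have hc : ∀ i, ∃ c : ℂ, T i0 = c • T i := fun i => T_prop (fderiv ℂ f 0) (by omega) (hT0 i) (hP i) (hP i0)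
  choose c hc using hc
  refine ⟨e, fun i => c i • m i, T i0, hT0 i0, fun i => ⟨Submodule.smul_mem _ _ (hm i), fun Y => ?_⟩⟩
  rw [map_smul, hT, hc i, LinearMap.smul_apply]
end

open Metric InnerProductSpace

section
variable {V W V' W' : Type} [NormedAddCommGroup V] [InnerProductSpace ℂ V] [FiniteDimensional ℂ V]
  [NormedAddCommGroup W] [InnerProductSpace ℂ W] [FiniteDimensional ℂ W]
  [NormedAddCommGroup V'] [InnerProductSpace ℂ V'] [FiniteDimensional ℂ V']
  [NormedAddCommGroup W'] [InnerProductSpace ℂ W'] [FiniteDimensional ℂ W']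

theorem card_le_of_orth {ι : Type} [Fintype ι] (B : Submodule ℂ V') (v : ι → V') (hB : ∀ i, v i ∈ B)
    (hn : ∀ i, v i ≠ 0) (ho : ∀ i j, i ≠ j → inner ℂ (v i) (v j) = 0) :
    Fintype.card ι ≤ Module.finrank ℂ B := by
  have hl : LinearIndependent ℂ (fun i => (⟨v i, hB i⟩ : B)) := by
    refine linearIndependent_of_ne_zero_of_inner_eq_zero (fun i h => hn i (congrArg Subtype.val h)) ?_
    intro i j hij
    exact ho i j hij
  exact hl.fintype_card_le_finrank

theorem card_le_of_neg {n : ℕ} (B : Submodule ℂ V') (v : Fin n → V') (hB : ∀ i, v i ∈ B) {c : ℝ} (hc : 0 < c)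
    (ho : ∀ i j, i ≠ j → inner ℂ (v i) (v j) = -(c : ℂ)) : n ≤ Module.finrank ℂ B + 1 := by
  let L : (Fin n → ℂ) →ₗ[ℂ] B × ℂ :=
    { toFun := fun a => (∑ i, a i • (⟨v i, hB i⟩ : B), ∑ i, a i)
      map_add' := by intro a b; ext <;> simp [add_smul, Finset.sum_add_distrib]
      map_smul' := by intro r a; ext <;> simp [mul_smul, Finset.smul_sum, Finset.mul_sum] }
  have hL : Function.Injective L := by
    rw [injective_iff_map_eq_zero]
    intro a ha
    have h1 : ∑ i, a i • (⟨v i, hB i⟩ : B) = 0 := congrArg Prod.fst ha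
    have h2 : ∑ i, a i = 0 := congrArg Prod.snd ha
    have h1' : ∑ i, a i • v i = 0 := by
      have := congrArg (B.subtype) h1
      simpa using this
    funext j
    have h3 := congrArg (fun z => inner ℂ (v j) z) h1'
    simp only [inner_sum, inner_smul_right, inner_zero_right] at h3
    have h4 : ∑ i, a i * inner ℂ (v j) (v i) = ∑ i, (a i * (-(c : ℂ)) + if i = j then a j * (inner ℂ (v j) (v j) + c) else 0) := by
      refine Finset.sum_congr rfl fun i _ => ?_
      by_cases h : i = j
      · subst h; simp only [if_true]; ring
      · rw [if_neg h, ho j i (Ne.symm h), add_zero]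
    rw [h4, Finset.sum_add_distrib, ← Finset.sum_mul, h2, zero_mul, zero_add, Finset.sum_ite_eq' Finset.univ j, if_pos (Finset.mem_univ j)] at h3
    rcases mul_eq_zero.1 h3 with h5 | h5
    · exact h5
    · exfalso
      rw [inner_self_eq_norm_sq_to_K] at h5
      have h6 : ‖v j‖ ^ 2 + c = 0 := by
        apply Complex.ofReal_injective
        push_cast
        simpa using h5
      nlinarith [sq_nonneg ‖v j‖]
  have := LinearMap.finrank_le_finrank_of_injective hL
  simpa [Module.finrank_prod] using this

theorem line_tendsto (A η : V × W) : Filter.Tendsto (fun t : ℂ => A + t • η) (nhds 0) (nhds A) := by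
  have : Continuous (fun t : ℂ => A + t • η) := by fun_prop
  simpa using this.tendsto 0

theorem line_hasDeriv {Φ : V × W → V' × W'} {A : V × W} (hΦ : DifferentiableAt ℂ Φ A) (η : V × W) :
    HasDerivAt (fun t : ℂ => Φ (A + t • η)) (fderiv ℂ Φ A η) 0 := by
  have e : HasDerivAt (fun t : ℂ => A + t • η) η 0 := by
    simpa using ((hasDerivAt_id (0 : ℂ)).smul_const η).const_add A
  have h2 : HasFDerivAt Φ (fderiv ℂ Φ A) (A + (0 : ℂ) • η) := by
    simpa using hΦ.hasFDerivAt
  exact h2.comp_hasDerivAt (0 : ℂ) e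

theorem LF.dat {f : (V →L[ℂ] W) → (V' →L[ℂ] W')} {A : V × W} {Φ : V × W → V' × W'} (h : LF f A Φ) :
    DifferentiableAt ℂ Φ A := h.diff.self_of_nhds

theorem LF.nrm_deriv {f : (V →L[ℂ] W) → (V' →L[ℂ] W')} {A : V × W} {Φ : V × W → V' × W'} (h : LF f A Φ)
    (η : V × W) : inner ℂ (Φ A).1 (fderiv ℂ Φ A η).1 = 0 := by
  have h6 : HasDerivAt (fun t : ℂ => innerSL ℂ (Φ A).1 (Φ (A + t • η)).1)
      (innerSL ℂ (Φ A).1 (fderiv ℂ Φ A η).1) 0 :=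
    (innerSL ℂ (Φ A).1).hasFDerivAt.comp_hasDerivAt (0 : ℂ) (line_hasDeriv h.dat η).fst
  have h7 : HasDerivAt (fun t : ℂ => innerSL ℂ (Φ A).1 (Φ (A + t • η)).1) 0 0 := by
    refine (hasDerivAt_const (0 : ℂ) (inner ℂ (Φ A).1 (Φ A).1)).congr_of_eventuallyEq ?_
    filter_upwards [(line_tendsto A η).eventually h.nrm] with t ht
    simpa using ht
  simpa using h6.unique h7

theorem LF.orth {f : (V →L[ℂ] W) → (V' →L[ℂ] W')} (hf : PH f) (h1 : AmbOne f)
    (hqp : Module.finrank ℂ V' < Module.finrank ℂ W) {A B : V × W} {Φ : V × W → V' × W'} (h : LF f A Φ)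
    (η : V × W) (hB : ‖B.2‖ < ‖B.1‖) {b : V' × W'} (hb : b ∈ Amb f B)
    (ho : ∀ᶠ t : ℂ in nhds 0, hform (A + t • η) B = 0) : hform b (fderiv ℂ Φ A η) = 0 := by
  refine hform_deriv h.dat η b ?_
  filter_upwards [ho, (line_tendsto A η).eventually h.mem] with t ht ht2
  exact hform_conj _ _ (Amb_orth hf h1 hqp ht2.1 hB ht ht2.2 hb)

theorem LF.orth2 {f : (V →L[ℂ] W) → (V' →L[ℂ] W')} (hf : PH f) (h1 : AmbOne f)
    (hqp : Module.finrank ℂ V' < Module.finrank ℂ W) {A B : V × W} {Φ Ψ : V × W → V' × W'} (h : LF f A Φ)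
    (h' : LF f B Ψ) (η θ : V × W) (ho : ∀ s t : ℂ, hform (A + s • η) (B + t • θ) = 0) :
    hform (fderiv ℂ Φ A η) (fderiv ℂ Ψ B θ) = 0 := by
  refine hform_deriv h'.dat θ _ ?_
  filter_upwards [(line_tendsto B θ).eventually h'.mem] with t ht
  refine hform_conj _ _ (h.orth hf h1 hqp η ht.1 ht.2 (Filter.Eventually.of_forall fun s => ho s t))

section rigid
variable {f : (V →L[ℂ] W) → (V' →L[ℂ] W')} {x : V} {m : V'} {T : W →ₗ[ℂ] W'}
  {Φ : V × W → V' × W'}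

theorem LF.snd_W (hf : PH f) (f0 : f 0 = 0) (h : LF f (x, 0) Φ) (hx : inner ℂ x x = (1 : ℂ)) (h0 : Φ (x, 0) = (m, 0))
    (hT : ∀ Y, fderiv ℂ f 0 Y m = T (Y x)) (w : W) : (fderiv ℂ Φ (x, 0) (0, w)).2 = T w := by
  have h3 := line_deriv hf (Z := 0) (by simp) (rkL x w) (line_hasDeriv h.dat (0, w)) (by
    filter_upwards [(line_tendsto (x, (0 : W)) (0, w)).eventually h.mem,
      small_line (Z := (0 : V →L[ℂ] W)) (by simp) (rkL x w)] with t ht ht1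
    refine ht.2 _ ht1 ?_
    show (0 + t • rkL x w) (x + t • (0 : V)) = 0 + t • w
    rw [smul_zero, add_zero, zero_add, zero_add, ContinuousLinearMap.smul_apply, rkL_apply, hx, one_smul])
  rw [f0] at h3
  simp only [zero_smul, add_zero, ContinuousLinearMap.zero_apply] at h3
  rw [h0, hT, rkL_apply, hx, one_smul] at h3
  exact h3.symm

theorem LF.snd_V (hf : PH f) (f0 : f 0 = 0) (h : LF f (x, 0) Φ) (v : V) : (fderiv ℂ Φ (x, 0) (v, 0)).2 = 0 := by
  have h3 := line_deriv hf (Z := 0) (by simp) 0 (line_hasDeriv h.dat (v, 0)) (by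
    filter_upwards [(line_tendsto (x, (0 : W)) (v, 0)).eventually h.mem] with t ht
    refine ht.2 _ (by simp) ?_
    simp)
  rw [f0] at h3
  simpa using h3.symm

theorem LF.cross (hf : PH f) (f0 : f 0 = 0) (h : LF f (x, 0) Φ) (hx : inner ℂ x x = (1 : ℂ)) (h0 : Φ (x, 0) = (m, 0))
    (hT : ∀ Y, fderiv ℂ f 0 Y m = T (Y x)) {y : V} (hy : inner ℂ y y = (1 : ℂ)) (hxy : inner ℂ x y = 0) (w : W) :
    fderiv ℂ f 0 (rkL y w) (fderiv ℂ Φ (x, 0) (y, 0)).1 = T w := by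
  have hyx : inner ℂ y x = 0 := inner_eq_zero_symm.1 hxy
  have hd := (line_hasDeriv h.dat (y, 0)).fst
  have e1 : HasDerivAt (fun t : ℂ => fderiv ℂ f 0 (rkL y w) (Φ ((x, 0) + t • (y, 0))).1)
      (fderiv ℂ f 0 (rkL y w) (fderiv ℂ Φ (x, 0) (y, 0)).1) 0 :=
    (fderiv ℂ f 0 (rkL y w)).hasFDerivAt.comp_hasDerivAt (0 : ℂ) hd
  have e2 : HasDerivAt (fun t : ℂ => fderiv ℂ f 0 (rkL x w) (Φ ((x, 0) + t • (y, 0))).1)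
      (fderiv ℂ f 0 (rkL x w) (fderiv ℂ Φ (x, 0) (y, 0)).1) 0 :=
    (fderiv ℂ f 0 (rkL x w)).hasFDerivAt.comp_hasDerivAt (0 : ℂ) hd
  have e3 := (hasDerivAt_id (0 : ℂ)).smul e2
  have e4 := e1.unique (e3.congr_of_eventuallyEq (by
    filter_upwards [(line_tendsto (x, (0 : W)) (y, 0)).eventually h.mem] with t ht
    have hm : (Φ ((x, 0) + t • (y, 0))).1 ∈ MS f (ℂ ∙ (x + t • y)) ⊤ := by
      have h5 : Φ ((x, 0) + t • (y, 0)) ∈ Amb f (x + t • y, 0) := by simpa using ht.2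
      exact ((Amb_base f0 _ _).1 h5).1
    have h6 := fderiv_MS hf hm (Y := rkL y w - t • rkL x w) ⟨by
      intro k hk
      obtain ⟨c, rfl⟩ := Submodule.mem_span_singleton.1 hk
      rw [map_smul, ContinuousLinearMap.sub_apply, ContinuousLinearMap.smul_apply, rkL_apply, rkL_apply,
        inner_add_right, inner_add_right, inner_smul_right, inner_smul_right, hx, hy, hxy, hyx]
      simp, fun v => Submodule.mem_top⟩
    rw [map_sub, map_smul] at h6
    exact sub_eq_zero.1 h6))
  rw [e4]
  simp only [id, zero_smul, one_smul, add_zero, zero_add]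
  rw [h0, hT, rkL_apply, hx, one_smul]
end rigid
end

open Metric InnerProductSpace

section
variable {V W V' W' : Type} [NormedAddCommGroup V] [InnerProductSpace ℂ V] [FiniteDimensional ℂ V]
  [NormedAddCommGroup W] [InnerProductSpace ℂ W] [FiniteDimensional ℂ W]
  [NormedAddCommGroup V'] [InnerProductSpace ℂ V'] [FiniteDimensional ℂ V']
  [NormedAddCommGroup W'] [InnerProductSpace ℂ W'] [FiniteDimensional ℂ W']

theorem exists_third {n : ℕ} (hn : 3 ≤ n) (i j : Fin n) : ∃ l, l ≠ i ∧ l ≠ j := by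
  by_contra hcon
  push Not at hcon
  have h1 : (Finset.univ : Finset (Fin n)) ⊆ {i, j} := by
    intro l _
    by_cases h : l = i
    · simp [h]
    · simp [hcon l h]
  have h2 := Finset.card_le_card h1
  have h3 : ({i, j} : Finset (Fin n)).card ≤ 2 := Finset.card_le_two
  simp at h2
  omega

theorem ob_inner {n : ℕ} (e : OrthonormalBasis (Fin n) ℂ V) (i : Fin n) : inner ℂ (e i) (e i) = (1 : ℂ) := by
  rw [inner_self_eq_norm_sq_to_K, e.orthonormal.1 i]; simp

section rig2
variable {f : (V →L[ℂ] W) → (V' →L[ℂ] W')} {n : ℕ} {e : OrthonormalBasis (Fin n) ℂ V} {m : Fin n → V'}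
  {T : W →ₗ[ℂ] W'} {Φ : Fin n → V × W → V' × W'}

theorem rig_kap (hf : PH f) (f0 : f 0 = 0) (h1 : AmbOne f) (hqp : Module.finrank ℂ V' < Module.finrank ℂ W)
    (hL : ∀ i, LF f (e i, 0) (Φ i)) (h0 : ∀ i, Φ i (e i, 0) = (m i, 0))
    (hT : ∀ i Y, fderiv ℂ f 0 Y (m i) = T (Y (e i))) {i j l : Fin n} (hij : i ≠ j) (hil : i ≠ l) (hjl : j ≠ l)
    (h k : W) :
    inner ℂ (fderiv ℂ (Φ i) (e i, 0) (0, h)).1 (fderiv ℂ (Φ j) (e j, 0) (0, k)).1 - inner ℂ (T h) (T k) =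
      - (inner ℂ (fderiv ℂ (Φ i) (e i, 0) (e l, 0)).1 (fderiv ℂ (Φ j) (e j, 0) (e l, 0)).1 * inner ℂ h k) := by
  let S1 : (ℂ × W) →ₗ⋆[ℂ] (ℂ × W) →ₗ[ℂ] ℂ := LinearMap.mk₂'ₛₗ (starRingEnd ℂ) (RingHom.id ℂ)
    (fun η θ => starRingEnd ℂ η.1 * θ.1 - inner ℂ η.2 θ.2)
    (by intro a b c; simp [inner_add_left]; ring) (by intro a b c; simp [inner_smul_left]; ring)
    (by intro a b c; simp [inner_add_right]; ring) (by intro a b c; simp [inner_smul_right]; ring)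
  let J : (ℂ × W) →ₗ[ℂ] V × W :=
    { toFun := fun η => (η.1 • e l, η.2)
      map_add' := by intro a b; simp [add_smul]
      map_smul' := by intro a b; simp [mul_smul] }
  let Hf : (V' × W') →ₗ⋆[ℂ] (V' × W') →ₗ[ℂ] ℂ := LinearMap.mk₂'ₛₗ (starRingEnd ℂ) (RingHom.id ℂ)
    (fun η θ => hform η θ)
    (by intro a b c; simp [hform, inner_add_left]; ring) (by intro a b c; simp [hform, inner_smul_left]; ring)
    (by intro a b c; simp [hform, inner_add_right]; ring) (by intro a b c; simp [hform, inner_smul_right]; ring)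
  let S2 : (ℂ × W) →ₗ⋆[ℂ] (ℂ × W) →ₗ[ℂ] ℂ :=
    LinearMap.mk₂'ₛₗ (starRingEnd ℂ) (RingHom.id ℂ)
    (fun η θ => Hf (fderiv ℂ (Φ i) (e i, 0) (J η)) (fderiv ℂ (Φ j) (e j, 0) (J θ)))
    (by intro a b c; simp only [map_add, LinearMap.add_apply])
    (by intro r a c; simp only [map_smul, LinearMap.map_smulₛₗ, LinearMap.smul_apply])
    (by intro a b c; simp only [map_add]) (by intro r a c; simp only [map_smul, RingHom.id_apply])
  have hS2 : ∀ η θ, S2 η θ = hform (fderiv ℂ (Φ i) (e i, 0) (η.1 • e l, η.2)) (fderiv ℂ (Φ j) (e j, 0) (θ.1 • e l, θ.2)) :=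
    fun η θ => rfl
  have hS1 : ∀ η θ, S1 η θ = starRingEnd ℂ η.1 * θ.1 - inner ℂ η.2 θ.2 := fun η θ => rfl
  obtain ⟨κ, hκ⟩ := sesq_prop S1 S2 (by
    intro η θ h
    rw [hS1] at h
    rw [hS2]
    refine (hL i).orth2 hf h1 hqp (hL j) _ _ ?_
    intro s t
    have e1 : inner ℂ (e i) (e j) = 0 := e.orthonormal.2 hij
    have e2 : inner ℂ (e i) (e l) = 0 := e.orthonormal.2 hil
    have e3 : inner ℂ (e l) (e j) = 0 := e.orthonormal.2 hjl.symm
    have e4 := ob_inner e l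
    unfold hform
    simp only [Prod.fst_add, Prod.snd_add, Prod.smul_fst, Prod.smul_snd, inner_add_left, inner_add_right,
      inner_smul_left, inner_smul_right, e1, e2, e3, e4, inner_zero_left, inner_zero_right]
    linear_combination (starRingEnd ℂ s * t) * h)
  have hA := hκ (0, h) (0, k)
  have hB := hκ (1, 0) (1, 0)
  rw [hS2, hS1] at hA hB
  simp only [zero_smul, one_smul, map_zero, map_one, inner_zero_left, zero_mul, zero_sub, sub_zero, mul_one] at hA hB
  unfold hform at hA hB
  rw [(hL i).snd_V hf f0, (hL j).snd_V hf f0, inner_zero_left, sub_zero] at hB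
  rw [(hL i).snd_W hf f0 (ob_inner e i) (h0 i) (hT i), (hL j).snd_W hf f0 (ob_inner e j) (h0 j) (hT j)] at hA
  rw [hA, hB]; ring

theorem rig_two (hf : PH f) (f0 : f 0 = 0) (h1 : AmbOne f) (hqp : Module.finrank ℂ V' < Module.finrank ℂ W)
    (hL : ∀ i, LF f (e i, 0) (Φ i)) (h0 : ∀ i, Φ i (e i, 0) = (m i, 0))
    {i j l : Fin n} (hij : i ≠ j) (hil : i ≠ l) (hjl : j ≠ l) :
    inner ℂ (fderiv ℂ (Φ i) (e i, 0) (e l, 0)).1 (fderiv ℂ (Φ j) (e j, 0) (e l, 0)).1 =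
      inner ℂ (fderiv ℂ (Φ i) (e i, 0) (e j, 0)).1 (m j) := by
  have e1 : inner ℂ (e i) (e j) = 0 := e.orthonormal.2 hij
  have e2 : inner ℂ (e i) (e l) = 0 := e.orthonormal.2 hil
  have e3 : inner ℂ (e l) (e j) = 0 := e.orthonormal.2 hjl.symm
  have e3' : inner ℂ (e j) (e l) = 0 := e.orthonormal.2 hjl
  have e4 := ob_inner e l
  have e5 := ob_inner e j
  have hd := (line_hasDeriv (hL j).dat (e l, 0)).fst
  set u := (fderiv ℂ (Φ i) (e i, 0) (e l, 0)).1 with hu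
  set v := (fderiv ℂ (Φ i) (e i, 0) (e j, 0)).1 with hv
  have d1 : HasDerivAt (fun t : ℂ => innerSL ℂ u (Φ j ((e j, 0) + t • (e l, 0))).1)
      (innerSL ℂ u (fderiv ℂ (Φ j) (e j, 0) (e l, 0)).1) 0 :=
    (innerSL ℂ u).hasFDerivAt.comp_hasDerivAt (0 : ℂ) hd
  have d2 : HasDerivAt (fun t : ℂ => innerSL ℂ v (Φ j ((e j, 0) + t • (e l, 0))).1)
      (innerSL ℂ v (fderiv ℂ (Φ j) (e j, 0) (e l, 0)).1) 0 :=
    (innerSL ℂ v).hasFDerivAt.comp_hasDerivAt (0 : ℂ) hd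
  have d3 := (hasDerivAt_id (0 : ℂ)).mul d2
  have d4 := d1.unique (d3.congr_of_eventuallyEq (by
    filter_upwards [(line_tendsto (e j, (0 : W)) (e l, 0)).eventually (hL j).mem] with t ht
    have h5 := (hL i).orth hf h1 hqp ((e l, 0) - (starRingEnd ℂ t) • (e j, 0)) ht.1 ht.2
      (Filter.Eventually.of_forall fun s => by
        unfold hform
        simp only [Prod.fst_add, Prod.snd_add, Prod.smul_fst, Prod.smul_snd, Prod.fst_sub, Prod.snd_sub,
          inner_add_left, inner_add_right, inner_sub_left,
          inner_smul_left, inner_smul_right, e1, e2, e3, e3', e4, e5, inner_zero_left, inner_zero_right]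
        simp
        ring)
    have h6 := hform_conj _ _ h5
    rw [map_sub, map_smul] at h6
    unfold hform at h6
    simp only [Prod.fst_sub, Prod.snd_sub, Prod.smul_fst, Prod.smul_snd] at h6
    rw [(hL i).snd_V hf f0, (hL i).snd_V hf f0, smul_zero, sub_zero, inner_zero_left, sub_zero, inner_sub_left,
      inner_smul_left, Complex.conj_conj] at h6
    exact sub_eq_zero.1 h6))
  have d5 : innerSL ℂ u (fderiv ℂ (Φ j) (e j, 0) (e l, 0)).1 = innerSL ℂ v (m j) := by
    rw [d4]
    simp [h0]
  simpa using d5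

theorem rig_inj (hf : PH f) (f0 : f 0 = 0) (h1 : AmbOne f) (hqp : Module.finrank ℂ V' < Module.finrank ℂ W)
    (hn : 3 ≤ n) (hdim : Module.finrank ℂ V' + 2 ≤ 2 * n) (hT0 : T ≠ 0)
    (hm : ∀ i, m i ∈ MS f (ℂ ∙ (e i)) ⊤)
    (hT : ∀ i Y, fderiv ℂ f 0 Y (m i) = T (Y (e i))) : Function.Injective T := by
  classical
  have hen : ∀ i, e i ≠ 0 := fun i h => by
    have := e.orthonormal.1 i; rw [h, norm_zero] at this; exact zero_ne_one this
  obtain ⟨w0, hw0⟩ : ∃ w, T w ≠ 0 := by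
    by_contra hc; push Not at hc; exact hT0 (LinearMap.ext hc)
  have hm0 : ∀ i, m i ≠ 0 := by
    intro i h
    have := hT i (rkL (e i) w0)
    rw [h, map_zero, rkL_apply, ob_inner, one_smul] at this
    exact hw0 this.symm
  have hpos : ∀ i, ‖((e i, 0) : V × W).2‖ < ‖((e i, 0) : V × W).1‖ := by
    intro i; simpa using hen i
  have hAm : ∀ i, ((m i, 0) : V' × W') ∈ Amb f (e i, 0) := fun i => (Amb_base f0 _ _).2 ⟨hm i, rfl⟩
  have hex : ∀ i, ∃ Φ, LF f (e i, 0) Φ ∧ Φ (e i, 0) = (m i, 0) := fun i =>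
    exists_LF hf h1 (hpos i) (hAm i) (fun h => hm0 i (congrArg Prod.fst h))
  choose Φ hL h0 using hex
  have hmo : ∀ i j, i ≠ j → inner ℂ (m i) (m j) = 0 := fun i j hij =>
    Amb_orth0 hf f0 h1 hqp (hen i) (e.orthonormal.2 hij) (hm i) (hm j)
  set S : Submodule ℂ V' := Submodule.span ℂ (Set.range m) with hS
  have hSn : Module.finrank ℂ S = n := by
    have hli : LinearIndependent ℂ m :=
      linearIndependent_of_ne_zero_of_inner_eq_zero hm0 (fun i j hij => hmo i j hij)
    have := finrank_span_eq_card hli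
    simpa using this
  have hBn : Module.finrank ℂ S + Module.finrank ℂ (Sᗮ : Submodule ℂ V') = Module.finrank ℂ V' :=
    Submodule.finrank_add_finrank_orthogonal S
  have hmem : ∀ v : V', (∀ k, inner ℂ (m k) v = 0) → v ∈ Sᗮ := by
    intro v hv
    rw [Submodule.mem_orthogonal]
    intro u hu
    induction hu using Submodule.span_induction with
    | mem x hx => obtain ⟨k, rfl⟩ := hx; exact hv k
    | zero => simp
    | add x y _ _ hx hy => rw [inner_add_left, hx, hy, add_zero]
    | smul a x _ hx => rw [inner_smul_left, hx, mul_zero]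
  -- the components b
  have hbB : ∀ i h, (fderiv ℂ (Φ i) (e i, 0) (0, h)).1 ∈ Sᗮ := by
    intro i h
    refine hmem _ fun k => ?_
    by_cases hk : k = i
    · subst hk
      have := (hL k).nrm_deriv (0, h)
      rwa [h0] at this
    · have h5 := (hL i).orth hf h1 hqp (0, h) (hpos k) (hAm k) (Filter.Eventually.of_forall fun s => by
        have : inner ℂ (e i) (e k) = 0 := e.orthonormal.2 (Ne.symm hk)
        simp [hform, this])
      simpa [hform] using h5
  have hdW : Module.finrank ℂ (Sᗮ : Submodule ℂ V') < Module.finrank ℂ W := by omega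
  have hker : ∀ i, ∃ h : W, h ≠ 0 ∧ (fderiv ℂ (Φ i) (e i, 0) (0, h)).1 = 0 := by
    intro i
    let b : W →ₗ[ℂ] (Sᗮ : Submodule ℂ V') :=
      LinearMap.codRestrict _ ((LinearMap.fst ℂ V' W') ∘ₗ (fderiv ℂ (Φ i) (e i, 0)).toLinearMap ∘ₗ (LinearMap.inr ℂ V W))
        (fun h => hbB i h)
    have hk := LinearMap.ker_ne_bot_of_finrank_lt (f := b) hdW
    obtain ⟨h, hh, hh0⟩ := Submodule.exists_mem_ne_zero_of_ne_bot hk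
    exact ⟨h, hh0, congrArg Subtype.val (LinearMap.mem_ker.1 hh)⟩
  choose hh hh0 hhb using hker
  have hkc : ∀ i j l, i ≠ j → i ≠ l → j ≠ l → ∀ w : W, w ≠ 0 →
      inner ℂ (fderiv ℂ (Φ i) (e i, 0) (0, w)).1 (fderiv ℂ (Φ j) (e j, 0) (0, w)).1 = 0 →
      inner ℂ (fderiv ℂ (Φ i) (e i, 0) (e l, 0)).1 (fderiv ℂ (Φ j) (e j, 0) (e l, 0)).1
        = ((‖T w‖ ^ 2 / ‖w‖ ^ 2 : ℝ) : ℂ) := by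
    intro i j l hij hil hjl w hw hz
    have h5 := rig_kap hf f0 h1 hqp hL h0 hT hij hil hjl w w
    rw [hz, zero_sub, neg_inj, inner_self_eq_norm_sq_to_K, inner_self_eq_norm_sq_to_K] at h5
    have hw1 : ((‖w‖ : ℝ) : ℂ) ≠ 0 := by exact_mod_cast norm_ne_zero_iff.2 hw
    push_cast
    rw [eq_div_iff (pow_ne_zero 2 hw1)]
    exact h5.symm
  obtain ⟨c, hc0, hc⟩ : ∃ c : ℝ, 0 ≤ c ∧ ∀ i j l, i ≠ j → i ≠ l → j ≠ l →
      inner ℂ (fderiv ℂ (Φ i) (e i, 0) (e l, 0)).1 (fderiv ℂ (Φ j) (e j, 0) (e l, 0)).1 = (c : ℂ) := by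
    set i0 : Fin n := ⟨0, by omega⟩
    have hcc : ∀ i j l, i ≠ j → i ≠ l → j ≠ l →
        ‖T (hh i)‖ ^ 2 / ‖hh i‖ ^ 2 = ‖T (hh j)‖ ^ 2 / ‖hh j‖ ^ 2 := by
      intro i j l hij hil hjl
      have a1 := hkc i j l hij hil hjl (hh i) (hh0 i) (by rw [hhb i, inner_zero_left])
      have a2 := hkc i j l hij hil hjl (hh j) (hh0 j) (by rw [hhb j, inner_zero_right])
      exact Complex.ofReal_injective (a1.symm.trans a2)
    have hce : ∀ i, ‖T (hh i)‖ ^ 2 / ‖hh i‖ ^ 2 = ‖T (hh i0)‖ ^ 2 / ‖hh i0‖ ^ 2 := by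
      intro i
      by_cases h : i = i0
      · rw [h]
      · obtain ⟨l, hl1, hl2⟩ := exists_third hn i i0
        exact hcc i i0 l h hl1.symm hl2.symm
    refine ⟨‖T (hh i0)‖ ^ 2 / ‖hh i0‖ ^ 2, by positivity, ?_⟩
    intro i j l hij hil hjl
    rw [← hce i]
    exact hkc i j l hij hil hjl (hh i) (hh0 i) (by rw [hhb i, inner_zero_left])
  rcases hc0.eq_or_lt with hcz | hcp
  · exfalso
    subst hcz
    set l : Fin n := ⟨0, by omega⟩
    have hcard := card_le_of_orth (ι := {i : Fin n // i ≠ l}) (Sᗮ : Submodule ℂ V')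
      (fun i => (fderiv ℂ (Φ i.1) (e i.1, 0) (e l, 0)).1) (by
        intro ⟨i, hi⟩
        refine hmem _ fun k => ?_
        show inner ℂ (m k) (fderiv ℂ (Φ i) (e i, 0) (e l, 0)).1 = 0
        by_cases hk : k = i
        · subst hk
          have := (hL k).nrm_deriv (e l, 0)
          rwa [h0] at this
        · by_cases hkl : k = l
          · subst hkl
            obtain ⟨j, hj1, hj2⟩ := exists_third hn i l
            have h5 := rig_two hf f0 h1 hqp hL h0 hi hj1.symm hj2.symm
            rw [hc i l j hi hj1.symm hj2.symm] at h5
            exact inner_eq_zero_symm.1 (by rw [← h5]; simp)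
          · have h5 := (hL i).orth hf h1 hqp (e l, 0) (hpos k) (hAm k) (Filter.Eventually.of_forall fun s => by
              have a1 : inner ℂ (e i) (e k) = 0 := e.orthonormal.2 (Ne.symm hk)
              have a2 : inner ℂ (e l) (e k) = 0 := e.orthonormal.2 (Ne.symm hkl)
              simp [hform, a1, a2, inner_add_left, inner_smul_left])
            simpa [hform] using h5)
      (by
        intro ⟨i, hi⟩ hz
        have h5 := (hL i).cross hf f0 (ob_inner e i) (h0 i) (hT i) (ob_inner e l) (e.orthonormal.2 hi) w0
        replace hz : (fderiv ℂ (Φ i) (e i, 0) (e l, 0)).1 = 0 := hz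
        rw [hz, map_zero] at h5
        exact hw0 h5.symm)
      (by
        intro ⟨i, hi⟩ ⟨j, hj⟩ hij
        have hij' : i ≠ j := fun h => hij (Subtype.ext h)
        have := hc i j l hij' hi hj
        simpa using this)
    have hcd : Fintype.card {i : Fin n // i ≠ l} = n - 1 := by
      simp
    omega
  · rw [injective_iff_map_eq_zero]
    intro w hw
    by_contra hwn
    have hw1 : 0 < ‖w‖ := norm_pos_iff.2 hwn
    have hcard := card_le_of_neg (n := n) (Sᗮ : Submodule ℂ V') (fun i => (fderiv ℂ (Φ i) (e i, 0) (0, w)).1)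
      (fun i => hbB i w) (c := c * ‖w‖ ^ 2) (by positivity) (by
        intro i j hij
        obtain ⟨l, hl1, hl2⟩ := exists_third hn i j
        have h5 := rig_kap hf f0 h1 hqp hL h0 hT hij hl1.symm hl2.symm w w
        rw [hw, inner_zero_left, sub_zero, hc i j l hij hl1.symm hl2.symm, inner_self_eq_norm_sq_to_K] at h5
        rw [h5]; push_cast; rfl)
    omega
end rig2

theorem GB_of_basis {f : (V →L[ℂ] W) → (V' →L[ℂ] W')} (hf : PH f) (f0 : f 0 = 0) (h1 : AmbOne f)
    (hqp : Module.finrank ℂ V' < Module.finrank ℂ W) (hq : 3 ≤ Module.finrank ℂ V)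
    (hdim : Module.finrank ℂ V' + 2 ≤ 2 * Module.finrank ℂ V) {x : V} (hx : Good f x) : GB f 0 := by
  obtain ⟨e, m, T, hT0, hm⟩ := good_basis hf f0 h1 hdim hx
  have hTi := rig_inj hf f0 h1 hqp hq hdim hT0 (fun i => (hm i).1) (fun i => (hm i).2)
  refine ⟨⊥, by simp; omega, e.toBasis.constr ℂ m, T, hTi, ?_⟩
  intro Y _ v
  have : (fderiv ℂ f 0 Y).toLinearMap ∘ₗ (e.toBasis.constr ℂ m) = T ∘ₗ Y.toLinearMap := by
    refine e.toBasis.ext fun i => ?_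
    rw [LinearMap.comp_apply, Module.Basis.constr_basis]
    simpa using (hm i).2 Y
  exact congrArg (fun L => L v) this
end

open Metric InnerProductSpace

section
variable {V W V' W' : Type} [NormedAddCommGroup V] [InnerProductSpace ℂ V] [FiniteDimensional ℂ V]
  [NormedAddCommGroup W] [InnerProductSpace ℂ W] [FiniteDimensional ℂ W]
  [NormedAddCommGroup V'] [InnerProductSpace ℂ V'] [FiniteDimensional ℂ V']
  [NormedAddCommGroup W'] [InnerProductSpace ℂ W'] [FiniteDimensional ℂ W']

/-- restriction of `f` to operators on `K` and to `M` -/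
noncomputable def resM (f : (V →L[ℂ] W) → (V' →L[ℂ] W')) (K : Submodule ℂ V) (M : Submodule ℂ V') :
    (K →L[ℂ] W) → (M →L[ℂ] W') :=
  fun Y => (f (Y.comp K.orthogonalProjection)).comp M.subtypeL

theorem norm_comp_proj (K : Submodule ℂ V) (Y : K →L[ℂ] W) : ‖Y.comp K.orthogonalProjection‖ = ‖Y‖ := by
  apply le_antisymm
  · refine (ContinuousLinearMap.opNorm_comp_le _ _).trans ?_
    exact mul_le_of_le_one_right (norm_nonneg _) K.orthogonalProjection_norm_le
  · refine ContinuousLinearMap.opNorm_le_bound _ (norm_nonneg _) fun v => ?_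
    have := (Y.comp K.orthogonalProjection).le_opNorm (v : V)
    simpa using this

/-- composition as a continuous linear map -/
noncomputable def compProj (K : Submodule ℂ V) : (K →L[ℂ] W) →L[ℂ] (V →L[ℂ] W) :=
  (ContinuousLinearMap.compL ℂ V K W).flip K.orthogonalProjection

theorem compProj_apply (K : Submodule ℂ V) (Y : K →L[ℂ] W) : compProj K Y = Y.comp K.orthogonalProjection := rfl

noncomputable def resR (M : Submodule ℂ V') : (V' →L[ℂ] W') →L[ℂ] (M →L[ℂ] W') :=
  (ContinuousLinearMap.compL ℂ M V' W').flip M.subtypeL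

theorem resM_PH {f : (V →L[ℂ] W) → (V' →L[ℂ] W')} (hf : PH f) (K : Submodule ℂ V) :
    PH (resM f Kᗮ (MS f K ⊤)ᗮ) := by
  set M := MS f K ⊤ with hM
  have hz : ∀ Y : (Kᗮ : Submodule ℂ V) →L[ℂ] W, ‖Y‖ < 1 → ‖resM f Kᗮ Mᗮ Y‖ = ‖f (Y.comp Kᗮ.orthogonalProjection)‖ := by
    intro Y hY
    have hfe : f (Y.comp Kᗮ.orthogonalProjection) = (resM f Kᗮ Mᗮ Y).comp Mᗮ.orthogonalProjection := by
      ext m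
      have h1 : m - ((Mᗮ.orthogonalProjection m : Mᗮ) : V') ∈ M := by
        have := Submodule.sub_starProjection_mem_orthogonal (K := Mᗮ) m
        rwa [Submodule.orthogonal_orthogonal] at this
      have h2 := h1 (Y.comp Kᗮ.orthogonalProjection) (by rw [norm_comp_proj]; exact hY) ⟨by
        intro k hk
        have : Kᗮ.orthogonalProjection k = 0 := by
          rw [Submodule.orthogonalProjection_eq_zero_iff, Submodule.orthogonal_orthogonal]
          exact hk
        simp [this], fun v => Submodule.mem_top⟩
      rw [map_sub, sub_eq_zero] at h2
      exact h2
    rw [hfe, norm_comp_proj]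
  refine ⟨?_, ?_, ?_⟩
  · have h1 : DifferentiableOn ℂ (fun Y : (Kᗮ : Submodule ℂ V) →L[ℂ] W => f (compProj Kᗮ Y)) (ball 0 1) := by
      refine DifferentiableOn.comp (E := (Kᗮ : Submodule ℂ V) →L[ℂ] W) (F := V →L[ℂ] W) (G := V' →L[ℂ] W') (g := f)
        (f := compProj (W := W) Kᗮ) hf.diff (compProj (W := W) Kᗮ).differentiable.differentiableOn ?_
      intro Y hY
      have hY' : ‖Y‖ < 1 := by
        have h9 : dist Y 0 = ‖Y‖ := dist_zero_right Y
        rw [← h9]; exact hY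
      refine mem_ball_zero_iff.2 ?_
      rw [compProj_apply, norm_comp_proj]; exact hY'
    exact Differentiable.comp_differentiableOn (𝕜 := ℂ) (E := (Kᗮ : Submodule ℂ V) →L[ℂ] W) (F := V' →L[ℂ] W')
      (G := (Mᗮ : Submodule ℂ V') →L[ℂ] W') (resR (W' := W') Mᗮ).differentiable h1
  · intro Y hY
    rw [hz Y hY]
    exact hf.maps _ (by rw [norm_comp_proj]; exact hY)
  · intro r hr
    obtain ⟨ρ, hρ, h⟩ := hf.prop r hr
    refine ⟨ρ, hρ, fun Y hY hY2 => ?_⟩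
    rw [hz Y hY]
    exact h _ (by rw [norm_comp_proj]; exact hY) (by rw [norm_comp_proj]; exact hY2)

theorem resM_GB {f : (V →L[ℂ] W) → (V' →L[ℂ] W')} (hf : PH f) {x : V} (hx : x ≠ 0) (M : Submodule ℂ V')
    (K : Submodule ℂ V) (hK : K = (ℂ ∙ x)ᗮ)
    {Z : K →L[ℂ] W} (hZ : ‖Z‖ < 1) (h : GB (resM f K M) Z) :
    GB f (Z.comp K.orthogonalProjection) := by
  have hKK : Kᗮ = (ℂ ∙ x) := by rw [hK, Submodule.orthogonal_orthogonal]
  obtain ⟨R, hR, P, T, hT, hY⟩ := h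
  have hKf : Module.finrank ℂ K + 1 = Module.finrank ℂ V := by
    have := Submodule.finrank_add_finrank_orthogonal (ℂ ∙ x)
    rw [finrank_span_singleton hx] at this
    rw [hK]; omega
  refine ⟨R.map K.subtype ⊔ (ℂ ∙ x), ?_, M.subtype ∘ₗ P ∘ₗ K.orthogonalProjection.toLinearMap, T, hT, ?_⟩
  · have h1 := Submodule.finrank_add_le_finrank_add_finrank (R.map K.subtype) (ℂ ∙ x)
    rw [finrank_span_singleton hx] at h1
    have h2 := Submodule.finrank_map_le K.subtype R
    omega
  · intro Y hYR v
    have hYx : ∀ v, Y v = Y (K.orthogonalProjection v : K) := by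
      intro v
      have h1 : v - ((K.orthogonalProjection v : K) : V) ∈ (ℂ ∙ x) := by
        have := Submodule.sub_starProjection_mem_orthogonal (K := K) v
        rwa [hKK] at this
      have h2 := hYR _ (Submodule.mem_sup_right h1)
      rw [map_sub, sub_eq_zero] at h2
      exact h2
    have h3 := hY (Y.comp K.subtypeL) (by
      intro r hr
      exact hYR _ (Submodule.mem_sup_left ⟨r, hr, rfl⟩)) (K.orthogonalProjection v)
    have hd : HasFDerivAt (resM f K M) ((resR M).comp ((fderiv ℂ f (compProj K Z)).comp (compProj K))) Z := by
      have h4 : HasFDerivAt f (fderiv ℂ f (compProj K Z)) (compProj K Z) :=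
        (hf.diffAt (by rw [compProj_apply, norm_comp_proj]; exact hZ)).hasFDerivAt
      have h5 : HasFDerivAt (fun Y : K →L[ℂ] W => f (compProj K Y)) ((fderiv ℂ f (compProj K Z)).comp (compProj K)) Z :=
        HasFDerivAt.comp (E := K →L[ℂ] W) (F := V →L[ℂ] W) (G := V' →L[ℂ] W') Z h4 (compProj (W := W) K).hasFDerivAt
      exact HasFDerivAt.comp (E := K →L[ℂ] W) (F := V' →L[ℂ] W') (G := M →L[ℂ] W') Z
        (resR (W' := W') M).hasFDerivAt h5
    rw [hd.fderiv] at h3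
    have h5 : compProj K (Y.comp K.subtypeL) = Y := by
      ext v; exact (hYx v).symm
    rw [ContinuousLinearMap.comp_apply, ContinuousLinearMap.comp_apply, h5] at h3
    rw [hYx v]
    exact h3

theorem GB_of_linear {f : (V →L[ℂ] W) → (V' →L[ℂ] W')} (hV : 2 ≤ Module.finrank ℂ V) (T : W →ₗᵢ[ℂ] W') (U : V' ≃ₗᵢ[ℂ] V)
    (h : ∀ Z, ‖Z‖ < 1 → ∀ m, f Z m = T (Z (U m))) : GB f 0 := by
  let L : (V →L[ℂ] W) →L[ℂ] (V' →L[ℂ] W') :=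
    (ContinuousLinearMap.compL ℂ V' W W' T.toContinuousLinearMap).comp
      ((ContinuousLinearMap.compL ℂ V' V W).flip (U.toContinuousLinearEquiv : V' →L[ℂ] V))
  refine GB_congr (f := L) (by simp) ?_ ?_
  · intro Z hZ
    ext m
    rw [h Z hZ]; rfl
  · refine ⟨⊥, by simpa using hV, (U.symm.toLinearEquiv : V →ₗ[ℂ] V'), T.toLinearMap, T.injective, ?_⟩
    intro Y _ v
    rw [L.fderiv]
    show T (Y (U (U.symm v))) = T (Y v)
    rw [U.apply_symm_apply]

theorem finrank_le_of_PH {f : (V →L[ℂ] W) → (V' →L[ℂ] W')} (hf : PH f)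
    (hqp : Module.finrank ℂ V' < Module.finrank ℂ W) : Module.finrank ℂ V ≤ Module.finrank ℂ V' := by
  by_contra hlt
  obtain ⟨g, g', hg, hg', e0, hP, h0, -⟩ := normalise_at hf (Z0 := 0) (by simp)
  have := RI_aux hP h0 (Module.finrank ℂ V' + 1) ⊥ ⊤ (by simp; omega) (by simp; omega)
  omega

theorem GB_step {f : (V →L[ℂ] W) → (V' →L[ℂ] W')} (hf : PH f) (h1 : AmbOne f)
    (hqp : Module.finrank ℂ V' < Module.finrank ℂ W) (hq : 3 ≤ Module.finrank ℂ V)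
    (hdim : Module.finrank ℂ V' + 2 ≤ 2 * Module.finrank ℂ V) : ∃ Z, ‖Z‖ < 1 ∧ GB f Z := by
  obtain ⟨g, g', hg, hg', e0, hP, h0, -⟩ := normalise_at hf (Z0 := 0) (by simp)
  have : Nontrivial V := Module.nontrivial_of_finrank_pos (R := ℂ) (by omega)
  obtain ⟨x, hx⟩ := exists_ne (0 : V)
  obtain ⟨g2, g2', hg2, hg2', hP2, h02, hA2, y, hy, hgood⟩ := exists_good hP h0 (h1.mob hf hg hg') hqp hx
  have h3 := GB_of_basis hP2 h02 hA2 hqp hq hdim (x := y) ⟨hy, hgood⟩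
  have h4 := GB_back hP hg2 hg2' (by simp) h3
  exact ⟨_, hg.maps (hg2.maps (by simp)), GB_back hf hg hg' (hg2.maps (by simp)) h4⟩
end

theorem exists_GB {W W' : Type} [NormedAddCommGroup W] [InnerProductSpace ℂ W] [FiniteDimensional ℂ W]
    [NormedAddCommGroup W'] [InnerProductSpace ℂ W'] [FiniteDimensional ℂ W'] (n : ℕ) :
    ∀ (V V' : Type) [NormedAddCommGroup V] [InnerProductSpace ℂ V] [FiniteDimensional ℂ V]
      [NormedAddCommGroup V'] [InnerProductSpace ℂ V'] [FiniteDimensional ℂ V']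
      (f : (V →L[ℂ] W) → (V' →L[ℂ] W')), PH f → Module.finrank ℂ V = n → 2 ≤ n →
      Module.finrank ℂ V' < Module.finrank ℂ W → Module.finrank ℂ V' + 2 ≤ 2 * n → ∃ Z, ‖Z‖ < 1 ∧ GB f Z := by
  induction n with
  | zero => intros; omega
  | succ n ih =>
    intro V V' _ _ _ _ _ _ f hf hn h2 hqp hdim
    have hle := finrank_le_of_PH hf hqp
    rcases hle.eq_or_lt with heq | hlt
    · obtain ⟨g, g', hg, hg', T, U, h⟩ := CA hf (by omega) heq.symm (by omega)
      exact ⟨_, hg.maps (by simp), GB_back hf hg hg' (by simp) (GB_of_linear (by omega) T U h)⟩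
    · by_cases h1 : AmbOne f
      · exact GB_step hf h1 hqp (by omega) (by omega)
      · unfold AmbOne at h1
        push Not at h1
        obtain ⟨A, hA, hA1⟩ := h1
        obtain ⟨g, g', x, hg, hg', hP, h0, hx, h3, h4⟩ := Amb_finrank_pos hf hqp hA
        have e1 := Submodule.finrank_add_finrank_orthogonal (MS (fun Z => act g' (f (act g Z))) (ℂ ∙ x) ⊤)
        have e2 := Submodule.finrank_add_finrank_orthogonal (ℂ ∙ x)
        rw [finrank_span_singleton hx] at e2
        obtain ⟨Z, hZ, hG⟩ := ih _ _ _ (resM_PH hP (ℂ ∙ x)) (by omega) (by omega) (by omega) (by omega)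
        have h5 := resM_GB hP hx _ _ rfl hZ hG
        have hn5 : ‖Z.comp (ℂ ∙ x)ᗮ.orthogonalProjection‖ < 1 := by rw [norm_comp_proj]; exact hZ
        exact ⟨_, hg.maps hn5, GB_back hf hg hg' hn5 h5⟩

open Metric InnerProductSpace

section
variable {V W V' W' : Type} [NormedAddCommGroup V] [InnerProductSpace ℂ V] [FiniteDimensional ℂ V]
  [NormedAddCommGroup W] [InnerProductSpace ℂ W] [FiniteDimensional ℂ W]
  [NormedAddCommGroup V'] [InnerProductSpace ℂ V'] [FiniteDimensional ℂ V']
  [NormedAddCommGroup W'] [InnerProductSpace ℂ W'] [FiniteDimensional ℂ W']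

variable [CompleteSpace V] [CompleteSpace W] [CompleteSpace V'] [CompleteSpace W']
open ContinuousLinearMap in
/-- the transposed map -/
noncomputable def trM (f : (V →L[ℂ] W) → (V' →L[ℂ] W')) : (W →L[ℂ] V) → (W' →L[ℂ] V') :=
  fun Y => adjoint (f (adjoint Y))

theorem trM_hasFDeriv {f : (V →L[ℂ] W) → (V' →L[ℂ] W')} {Y0 : W →L[ℂ] V}
    {L : (V →L[ℂ] W) →L[ℂ] (V' →L[ℂ] W')} (h : HasFDerivAt f L (ContinuousLinearMap.adjoint Y0)) :
    ∃ L' : (W →L[ℂ] V) →L[ℂ] (W' →L[ℂ] V'), HasFDerivAt (trM f) L' Y0 ∧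
      ∀ Y, L' Y = ContinuousLinearMap.adjoint (L (ContinuousLinearMap.adjoint Y)) := by
  let L0 : (W →L[ℂ] V) →ₗ[ℂ] (W' →L[ℂ] V') :=
    { toFun := fun Y => ContinuousLinearMap.adjoint (L (ContinuousLinearMap.adjoint Y))
      map_add' := by intro a b; simp
      map_smul' := by intro r a; simp [LinearIsometryEquiv.map_smulₛₗ] }
  refine ⟨LinearMap.toContinuousLinearMap L0, ?_, fun Y => rfl⟩
  rw [hasFDerivAt_iff_isLittleO] at h ⊢
  have hc : Filter.Tendsto (fun Y : W →L[ℂ] V => ContinuousLinearMap.adjoint Y) (nhds Y0)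
      (nhds (ContinuousLinearMap.adjoint Y0)) :=
    (ContinuousLinearMap.adjoint (𝕜 := ℂ) (E := W) (F := V)).continuous.tendsto Y0
  have h2 := h.comp_tendsto hc
  rw [← Asymptotics.isLittleO_norm_norm] at h2 ⊢
  refine h2.congr ?_ ?_
  · intro Y
    show ‖f (ContinuousLinearMap.adjoint Y) - f (ContinuousLinearMap.adjoint Y0) -
      L (ContinuousLinearMap.adjoint Y - ContinuousLinearMap.adjoint Y0)‖ =
      ‖ContinuousLinearMap.adjoint (f (ContinuousLinearMap.adjoint Y)) -
        ContinuousLinearMap.adjoint (f (ContinuousLinearMap.adjoint Y0)) -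
        ContinuousLinearMap.adjoint (L (ContinuousLinearMap.adjoint (Y - Y0)))‖
    rw [← map_sub, ← map_sub, ← map_sub, LinearIsometryEquiv.norm_map]
  · intro Y
    show ‖ContinuousLinearMap.adjoint Y - ContinuousLinearMap.adjoint Y0‖ = ‖Y - Y0‖
    rw [← map_sub, LinearIsometryEquiv.norm_map]

theorem norm_trM (f : (V →L[ℂ] W) → (V' →L[ℂ] W')) (Y : W →L[ℂ] V) :
    ‖trM f Y‖ = ‖f (ContinuousLinearMap.adjoint Y)‖ := by
  unfold trM; rw [LinearIsometryEquiv.norm_map]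

theorem norm_adj (Y : W →L[ℂ] V) : ‖ContinuousLinearMap.adjoint Y‖ = ‖Y‖ := by
  rw [LinearIsometryEquiv.norm_map]

theorem trM_PH {f : (V →L[ℂ] W) → (V' →L[ℂ] W')} (hf : PH f) : PH (trM f) := by
  refine ⟨?_, ?_, ?_⟩
  · intro Y hY
    have hY' : ‖Y‖ < 1 := mem_ball_zero_iff.1 hY
    obtain ⟨L', hL', -⟩ := trM_hasFDeriv (hf.diffAt (Z := ContinuousLinearMap.adjoint Y)
      (by rw [norm_adj]; exact hY')).hasFDerivAt
    exact hL'.differentiableAt.differentiableWithinAt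
  · intro Y hY
    rw [norm_trM]
    exact hf.maps _ (by rw [norm_adj]; exact hY)
  · intro r hr
    obtain ⟨ρ, hρ, h⟩ := hf.prop r hr
    refine ⟨ρ, hρ, fun Y hY hY2 => ?_⟩
    rw [norm_trM]
    exact h _ (by rw [norm_adj]; exact hY) (by rw [norm_adj]; exact hY2)

theorem adj_rkL (w : V) (u : W) : ContinuousLinearMap.adjoint (rkL u w) = (rkL w u : V →L[ℂ] W) := by
  refine (ContinuousLinearMap.eq_adjoint_iff _ _).2 ?_ |>.symm
  intro a b
  rw [rkL_apply, rkL_apply, inner_smul_left, inner_smul_right, inner_conj_symm]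
  ring

theorem exists_orth_two (R : Submodule ℂ V) (hR : Module.finrank ℂ R + 2 ≤ Module.finrank ℂ V) (x : V) :
    ∃ w : V, w ≠ 0 ∧ (∀ r ∈ R, inner ℂ w r = 0) ∧ inner ℂ w x = 0 := by
  have h1 := Submodule.finrank_add_le_finrank_add_finrank R (ℂ ∙ x)
  have h2 : Module.finrank ℂ (ℂ ∙ x) ≤ 1 := by
    have := finrank_span_le_card (R := ℂ) ({x} : Set V)
    simpa using this
  have h3 := Submodule.finrank_add_finrank_orthogonal (R ⊔ (ℂ ∙ x))
  have h4 : (R ⊔ (ℂ ∙ x))ᗮ ≠ ⊥ := by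
    intro h; rw [h, finrank_bot] at h3; omega
  obtain ⟨w, hw, hw0⟩ := Submodule.exists_mem_ne_zero_of_ne_bot h4
  refine ⟨w, hw0, fun r hr => ?_, ?_⟩
  · exact inner_eq_zero_symm.1 (hw r (Submodule.mem_sup_left hr))
  · exact inner_eq_zero_symm.1 (hw x (Submodule.mem_sup_right (Submodule.mem_span_singleton_self x)))

theorem CB0 {f : (V →L[ℂ] W) → (V' →L[ℂ] W')} (hf : PH f) (f0 : f 0 = 0) (hV : 2 ≤ Module.finrank ℂ V)
    (hW : 2 ≤ Module.finrank ℂ W) (hWW : Module.finrank ℂ W = Module.finrank ℂ W') (hG : GB f 0) :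
    ∃ (T : W →ₗᵢ[ℂ] W') (S : V →ₗᵢ[ℂ] V'), ∀ Z, ‖Z‖ < 1 → ∀ m,
      f Z m = T (Z (ContinuousLinearMap.adjoint S.toContinuousLinearMap m)) := by
  obtain ⟨R, hR, P0, T0, hT0, hY⟩ := hG
  have hfT := trM_PH hf
  have fT0 : trM f 0 = 0 := by unfold trM; simp [f0]
  let Te : W ≃ₗ[ℂ] W' := LinearEquiv.ofInjectiveOfFinrankEq T0 hT0 hWW
  have hTe : ∀ w, Te w = T0 w := fun w => rfl
  let Pl : W →ₗ[ℂ] W' := LinearMap.adjoint (Te.symm : W' →ₗ[ℂ] W)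
  have hPl : ∀ u w, inner ℂ (Pl u) (T0 w) = inner ℂ u w := by
    intro u w
    rw [LinearMap.adjoint_inner_left, ← hTe]
    simp
  have hPi : Function.Injective Pl := by
    rw [injective_iff_map_eq_zero]
    intro u hu
    have := hPl u u
    rw [hu, inner_zero_left] at this
    exact inner_self_eq_zero.1 this.symm
  let P : W ≃ₗ[ℂ] W' := LinearEquiv.ofInjectiveOfFinrankEq Pl hPi hWW
  have hP : ∀ w, P w = Pl w := fun w => rfl
  have hM : ∀ (u : W) (x : V), x ≠ 0 → u ≠ 0 → MS (trM f) (ℂ ∙ u) (ℂ ∙ x)ᗮ = ℂ ∙ (P u) := by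
    intro u x hx hu
    have hle : MS (trM f) (ℂ ∙ u) (ℂ ∙ x)ᗮ ≤ ℂ ∙ (P u) := by
      intro ω hω
      obtain ⟨n, rfl⟩ := P.surjective ω
      have hn : n ∈ ((ℂ ∙ u)ᗮ)ᗮ := by
        rw [Submodule.mem_orthogonal]
        intro u' hu'
        have hu2 : inner ℂ u u' = 0 := Submodule.mem_orthogonal_singleton_iff_inner_right.1 hu'
        obtain ⟨w, hw0, hwR, hwx⟩ := exists_orth_two R hR x
        have h1 := fderiv_MS hfT hω (Y := rkL u' w) ⟨by
          intro k hk
          obtain ⟨c, rfl⟩ := Submodule.mem_span_singleton.1 hk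
          rw [map_smul, rkL_apply, inner_eq_zero_symm.1 hu2, zero_smul, smul_zero], by
          intro v
          rw [rkL_apply, Submodule.mem_orthogonal_singleton_iff_inner_right, inner_smul_right,
            inner_eq_zero_symm.1 hwx, mul_zero]⟩
        obtain ⟨L', hL', hL2⟩ := trM_hasFDeriv (Y0 := 0) (f := f) (L := fderiv ℂ f 0) (by
          rw [map_zero]; exact (hf.diffAt (by simp)).hasFDerivAt)
        rw [hL'.fderiv, hL2, adj_rkL] at h1
        have h2 := hY (rkL w u') (by intro r hr; rw [rkL_apply, hwR r hr, zero_smul]) w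
        have h3 : inner ℂ (P n) (fderiv ℂ f 0 (rkL w u') (P0 w)) = 0 := by
          rw [← ContinuousLinearMap.adjoint_inner_left, h1, inner_zero_left]
        rw [h2, rkL_apply, map_smul, inner_smul_right, hP, hPl] at h3
        rcases mul_eq_zero.1 h3 with h4 | h4
        · exact absurd (inner_self_eq_zero.1 h4) hw0
        · exact inner_eq_zero_symm.1 h4
      rw [Submodule.orthogonal_orthogonal] at hn
      obtain ⟨c, rfl⟩ := Submodule.mem_span_singleton.1 hn
      rw [map_smul]
      exact Submodule.smul_mem _ _ (Submodule.mem_span_singleton_self _)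
    refine le_antisymm hle ?_
    obtain ⟨ω, hω0, hω, -⟩ := KL hfT fT0 (u := x) (x := u) hx hu
    obtain ⟨c, rfl⟩ := Submodule.mem_span_singleton.1 (hle hω)
    have hc : c ≠ 0 := fun h => hω0 (by rw [h, zero_smul])
    rw [Submodule.span_singleton_le_iff_mem]
    have := Submodule.smul_mem _ c⁻¹ hω
    rwa [smul_smul, inv_mul_cancel₀ hc, one_smul] at this
  obtain ⟨S, U, h⟩ := FL0 hfT fT0 hW hV P hM
  refine ⟨U.symm.toLinearIsometry, S, fun Z hZ m => ?_⟩
  refine ext_inner_left ℂ fun ω => ?_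
  have h1 := h (ContinuousLinearMap.adjoint Z) (by rw [norm_adj]; exact hZ) ω
  unfold trM at h1
  rw [ContinuousLinearMap.adjoint_adjoint] at h1
  rw [← ContinuousLinearMap.adjoint_inner_left, h1]
  show inner ℂ (S.toContinuousLinearMap _) m = inner ℂ ω (U.symm _)
  rw [← ContinuousLinearMap.adjoint_inner_right, ContinuousLinearMap.adjoint_inner_left,
    ← U.inner_map_map ω, U.apply_symm_apply]

theorem CB {f : (V →L[ℂ] W) → (V' →L[ℂ] W')} (hf : PH f) (hV : 2 ≤ Module.finrank ℂ V)
    (hWW : Module.finrank ℂ W = Module.finrank ℂ W') (hqp : Module.finrank ℂ V' < Module.finrank ℂ W)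
    (hdim : Module.finrank ℂ V' + 2 ≤ 2 * Module.finrank ℂ V) :
    ∃ (g : (V × W) ≃L[ℂ] (V × W)) (g' : (V' × W') ≃L[ℂ] (V' × W')), IsMob g ∧ IsMob g' ∧
    ∃ (T : W →ₗᵢ[ℂ] W') (S : V →ₗᵢ[ℂ] V'), ∀ Z, ‖Z‖ < 1 → ∀ m,
      act g' (f (act g Z)) m = T (Z (ContinuousLinearMap.adjoint S.toContinuousLinearMap m)) := by
  have hle := finrank_le_of_PH hf hqp
  obtain ⟨Z0, hZ0, hG⟩ := exists_GB _ V V' f hf rfl hV hqp hdim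
  obtain ⟨g, g', hg, hg', e0, hP, h0, -⟩ := normalise_at hf hZ0
  refine ⟨g, g', hg, hg', ?_⟩
  exact CB0 hP h0 hV (by omega) hWW (GB_mob hf hg hg' (by simp) (by rw [e0]; exact hG))

theorem CAB {f : (V →L[ℂ] W) → (V' →L[ℂ] W')} (hf : PH f) (hV : 2 ≤ Module.finrank ℂ V)
    (hWW : Module.finrank ℂ V = Module.finrank ℂ V' ∨ Module.finrank ℂ W = Module.finrank ℂ W')
    (hqp : Module.finrank ℂ V' < Module.finrank ℂ W)
    (hdim : Module.finrank ℂ V' + 2 ≤ 2 * Module.finrank ℂ V) :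
    ∃ (g : (V × W) ≃L[ℂ] (V × W)) (g' : (V' × W') ≃L[ℂ] (V' × W')), IsMob g ∧ IsMob g' ∧
    ∃ (T : W →ₗᵢ[ℂ] W') (S : V →ₗᵢ[ℂ] V'), ∀ Z, ‖Z‖ < 1 → ∀ m,
      act g' (f (act g Z)) m = T (Z (ContinuousLinearMap.adjoint S.toContinuousLinearMap m)) := by
  rcases hWW with h | h
  · obtain ⟨g, g', hg, hg', T, U, hh⟩ := CA hf hV h.symm (by omega)
    refine ⟨g, g', hg, hg', T, U.symm.toLinearIsometry, fun Z hZ m => ?_⟩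
    rw [hh Z hZ m]
    congr 2
    refine ext_inner_left ℂ fun ω => ?_
    rw [ContinuousLinearMap.adjoint_inner_right]
    show _ = inner ℂ (U.symm ω) m
    rw [← U.inner_map_map, U.apply_symm_apply]
  · exact CB hf hV h hqp hdim
end

open Metric InnerProductSpace
/-- matrices as operators -/
noncomputable def matC (m n : ℕ) : Matrix (Fin m) (Fin n) ℂ ≃L[ℂ] (EuclideanSpace ℂ (Fin n) →L[ℂ] EuclideanSpace ℂ (Fin m)) :=
  (Matrix.toEuclideanLin.trans LinearMap.toContinuousLinearMap).toContinuousLinearEquiv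

theorem matC_apply {m n : ℕ} (Z : Matrix (Fin m) (Fin n) ℂ) (v : EuclideanSpace ℂ (Fin n)) :
    matC m n Z v = WithLp.toLp 2 (Z *ᵥ v.ofLp) := rfl

theorem matC_dom {m n : ℕ} (Z : Matrix (Fin m) (Fin n) ℂ) : ‖matC m n Z‖ < 1 ↔ Z ∈ typeIDomain m n := by
  have key : ∀ v : EuclideanSpace ℂ (Fin n),
      star v.ofLp ⬝ᵥ ((1 - Zᴴ * Z) *ᵥ v.ofLp) = ((‖v‖ ^ 2 - ‖matC m n Z v‖ ^ 2 : ℝ) : ℂ) := by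
    intro v
    have e1 : ∀ k (w : EuclideanSpace ℂ (Fin k)), ((‖w‖ ^ 2 : ℝ) : ℂ) = star w.ofLp ⬝ᵥ w.ofLp := by
      intro k w
      have := inner_self_eq_norm_sq_to_K (𝕜 := ℂ) w
      push_cast
      rw [EuclideanSpace.inner_eq_star_dotProduct, dotProduct_comm] at this
      exact this.symm
    rw [Complex.ofReal_sub, e1, e1, matC_apply, Matrix.sub_mulVec, Matrix.one_mulVec, dotProduct_sub,
      ← Matrix.mulVec_mulVec, Matrix.dotProduct_mulVec, ← Matrix.star_mulVec]
  constructor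
  · intro h
    refine Matrix.posDef_iff_dotProduct_mulVec.2 ⟨?_, ?_⟩
    · exact Matrix.isHermitian_one.sub (Matrix.isHermitian_conjTranspose_mul_self Z)
    · intro x hx
      have h1 := pt_of_norm_lt_one h (v := WithLp.toLp 2 x) (by
        intro h0; exact hx (congrArg WithLp.ofLp h0))
      have h2 := key (WithLp.toLp 2 x)
      replace h2 : star x ⬝ᵥ ((1 - Zᴴ * Z) *ᵥ x) = _ := h2
      rw [h2]
      have : 0 < ‖(WithLp.toLp 2 x : EuclideanSpace ℂ (Fin n))‖ ^ 2 - ‖matC m n Z (WithLp.toLp 2 x)‖ ^ 2 := by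
        nlinarith [norm_nonneg (matC m n Z (WithLp.toLp 2 x))]
      exact_mod_cast this
  · intro h
    refine norm_lt_one_of_pt _ fun v hv => ?_
    have h1 := (Matrix.posDef_iff_dotProduct_mulVec.1 h).2 (x := v.ofLp) (by
      intro h0; apply hv; ext i; simp [h0])
    rw [key] at h1
    have h2 : 0 < ‖v‖ ^ 2 - ‖matC m n Z v‖ ^ 2 := by exact_mod_cast h1
    by_contra hc
    nlinarith [norm_nonneg v]

theorem matC_mapsTo {m n : ℕ} : Set.MapsTo (matC m n) (typeIDomain m n) (ball 0 1) :=
  fun Z hZ => mem_ball_zero_iff.2 ((matC_dom Z).2 hZ)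

theorem matC_symm_mapsTo {m n : ℕ} : Set.MapsTo (matC m n).symm (ball 0 1) (typeIDomain m n) :=
  fun Z hZ => (matC_dom _).1 (by simpa using hZ)

theorem matC_conj_diff {m n m' n' : ℕ}
    {F : (EuclideanSpace ℂ (Fin n) →L[ℂ] EuclideanSpace ℂ (Fin m)) → (EuclideanSpace ℂ (Fin n') →L[ℂ] EuclideanSpace ℂ (Fin m'))}
    (hF : DifferentiableOn ℂ F (ball 0 1)) :
    DifferentiableOn ℂ (fun Z => (matC m' n').symm (F (matC m n Z))) (typeIDomain m n) := by
  have h1 : DifferentiableOn ℂ (fun Z => F (matC m n Z)) (typeIDomain m n) :=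
    DifferentiableOn.comp (𝕜 := ℂ) (E := Matrix (Fin m) (Fin n) ℂ)
      (F := EuclideanSpace ℂ (Fin n) →L[ℂ] EuclideanSpace ℂ (Fin m))
      (G := EuclideanSpace ℂ (Fin n') →L[ℂ] EuclideanSpace ℂ (Fin m')) hF
      (matC m n).differentiable.differentiableOn matC_mapsTo
  exact Differentiable.comp_differentiableOn (𝕜 := ℂ) (E := Matrix (Fin m) (Fin n) ℂ)
    (F := EuclideanSpace ℂ (Fin n') →L[ℂ] EuclideanSpace ℂ (Fin m')) (G := Matrix (Fin m') (Fin n') ℂ)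
    (matC m' n').symm.differentiable h1

theorem aut_of {m n : ℕ}
    {G H : (EuclideanSpace ℂ (Fin n) →L[ℂ] EuclideanSpace ℂ (Fin m)) → (EuclideanSpace ℂ (Fin n) →L[ℂ] EuclideanSpace ℂ (Fin m))}
    (hG : DifferentiableOn ℂ G (ball 0 1)) (hH : DifferentiableOn ℂ H (ball 0 1))
    (mG : ∀ Z, ‖Z‖ < 1 → ‖G Z‖ < 1) (mH : ∀ Z, ‖Z‖ < 1 → ‖H Z‖ < 1)
    (h1 : ∀ Z, ‖Z‖ < 1 → H (G Z) = Z) (h2 : ∀ Z, ‖Z‖ < 1 → G (H Z) = Z) :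
    IsAutOf (fun Z => (matC m n).symm (G (matC m n Z))) := by
  refine ⟨?_, matC_conj_diff hG, fun Z => (matC m n).symm (H (matC m n Z)), ?_, matC_conj_diff hH, ?_, ?_⟩
  · intro Z hZ
    exact (matC_dom _).1 (by simpa using mG _ ((matC_dom Z).2 hZ))
  · intro Z hZ
    exact (matC_dom _).1 (by simpa using mH _ ((matC_dom Z).2 hZ))
  · intro Z hZ
    simp [h1 _ ((matC_dom Z).2 hZ)]
  · intro Z hZ
    simp [h2 _ ((matC_dom Z).2 hZ)]

theorem PH_of_proper {p q p' q' : ℕ} {f : Matrix (Fin p) (Fin q) ℂ → Matrix (Fin p') (Fin q') ℂ}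
    (hf : DifferentiableOn ℂ f (typeIDomain p q))
    (hfp : ProperOn f (typeIDomain p q) (typeIDomain p' q')) :
    PH (fun Z => matC p' q' (f ((matC p q).symm Z))) := by
  refine ⟨?_, ?_, ?_⟩
  · have h1 : DifferentiableOn ℂ (fun Z => f ((matC p q).symm Z)) (ball 0 1) :=
      DifferentiableOn.comp (𝕜 := ℂ) (F := Matrix (Fin p) (Fin q) ℂ)
        (E := EuclideanSpace ℂ (Fin q) →L[ℂ] EuclideanSpace ℂ (Fin p))
        (G := Matrix (Fin p') (Fin q') ℂ) hf
        (matC p q).symm.differentiable.differentiableOn matC_symm_mapsTo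
    exact Differentiable.comp_differentiableOn (𝕜 := ℂ) (E := EuclideanSpace ℂ (Fin q) →L[ℂ] EuclideanSpace ℂ (Fin p))
      (G := EuclideanSpace ℂ (Fin q') →L[ℂ] EuclideanSpace ℂ (Fin p')) (F := Matrix (Fin p') (Fin q') ℂ)
      (matC p' q').differentiable h1
  · intro Z hZ
    exact (matC_dom _).2 (hfp.1 (matC_symm_mapsTo (mem_ball_zero_iff.2 hZ)))
  · intro r hr
    have hK : IsCompact ((matC p' q') ⁻¹' (closedBall 0 r)) :=
      (matC p' q').toHomeomorph.isClosedEmbedding.isCompact_preimage (isCompact_closedBall _ _)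
    have hc := hfp.2 _ (by
      intro Y hY
      refine (matC_dom Y).1 (lt_of_le_of_lt ?_ hr)
      exact mem_closedBall_zero_iff.1 hY) hK
    set S := typeIDomain p q ∩ f ⁻¹' ((matC p' q') ⁻¹' (closedBall 0 r)) with hS
    have hcont : ContinuousOn (fun Z => ‖matC p q Z‖) S :=
      (continuous_norm.comp (matC p q).continuous).continuousOn
    obtain ⟨ρ, hρ, hb⟩ : ∃ ρ < (1 : ℝ), ∀ Z ∈ S, ‖matC p q Z‖ ≤ ρ := by
      rcases S.eq_empty_or_nonempty with he | hne
      · exact ⟨0, zero_lt_one, fun Z hZ => by rw [he] at hZ; exact absurd hZ (Set.notMem_empty _)⟩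
      · obtain ⟨Z0, hZ0, hmax⟩ := hc.exists_isMaxOn hne hcont
        exact ⟨_, (matC_dom Z0).2 hZ0.1, fun Z hZ => hmax hZ⟩
    refine ⟨ρ, hρ, fun Z hZ hZ2 => ?_⟩
    by_contra hlt
    have := hb ((matC p q).symm Z) ⟨matC_symm_mapsTo (mem_ball_zero_iff.2 hZ), by
      show matC p' q' _ ∈ closedBall 0 r
      exact mem_closedBall_zero_iff.2 (not_lt.1 hlt)⟩
    rw [ContinuousLinearEquiv.apply_symm_apply] at this
    linarith

theorem exists_incl (p a : ℕ) : ∃ ι : EuclideanSpace ℂ (Fin p) →ₗᵢ[ℂ] EuclideanSpace ℂ (Fin (p + a)),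
    ∀ v, (∀ i, (ι v) (Fin.castAdd a i) = v i) ∧ ∀ j, (ι v) (Fin.natAdd p j) = 0 := by
  let L : EuclideanSpace ℂ (Fin p) →ₗ[ℂ] EuclideanSpace ℂ (Fin (p + a)) :=
    { toFun := fun v => WithLp.toLp 2 (Fin.append v.ofLp 0)
      map_add' := by
        intro v w; ext i
        refine Fin.addCases (fun i => ?_) (fun i => ?_) i <;> simp
      map_smul' := by
        intro r v; ext i
        refine Fin.addCases (fun i => ?_) (fun i => ?_) i <;> simp }
  refine ⟨⟨L, ?_⟩, fun v => ⟨fun i => ?_, fun j => ?_⟩⟩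
  · intro v
    rw [EuclideanSpace.norm_eq, EuclideanSpace.norm_eq, Fin.sum_univ_add]
    simp [L]
  · show Fin.append v.ofLp 0 (Fin.castAdd a i) = _
    simp
  · show Fin.append v.ofLp 0 (Fin.natAdd p j) = 0
    simp

theorem matC_diagBlock {p q a b p' q' : ℕ} (hp : p + a = p') (hq : q + b = q') :
    ∃ (ι : EuclideanSpace ℂ (Fin p) →ₗᵢ[ℂ] EuclideanSpace ℂ (Fin p'))
      (κ : EuclideanSpace ℂ (Fin q) →ₗᵢ[ℂ] EuclideanSpace ℂ (Fin q')), ∀ Z m,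
      matC p' q' (diagBlock hp hq Z 0) m = ι (matC p q Z (ContinuousLinearMap.adjoint κ.toContinuousLinearMap m)) := by
  subst hp hq
  obtain ⟨ι, hι⟩ := exists_incl p a
  obtain ⟨κ, hκ⟩ := exists_incl q b
  refine ⟨ι, κ, fun Z m => ?_⟩
  have had : ∀ j, (ContinuousLinearMap.adjoint κ.toContinuousLinearMap m) j = m (Fin.castAdd b j) := by
    intro j
    have h1 : inner ℂ (EuclideanSpace.single j (1 : ℂ)) (ContinuousLinearMap.adjoint κ.toContinuousLinearMap m)
        = inner ℂ (κ (EuclideanSpace.single j (1 : ℂ))) m := by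
      rw [ContinuousLinearMap.adjoint_inner_right]; rfl
    rw [EuclideanSpace.inner_single_left] at h1
    rw [PiLp.inner_apply, Fin.sum_univ_add] at h1
    simp only [(hκ _).1, (hκ _).2] at h1
    simpa [Pi.single_apply, EuclideanSpace.single_apply, apply_ite, ite_apply] using h1
  have hdb : ∀ i j, diagBlock rfl rfl Z (0 : Matrix (Fin a) (Fin b) ℂ) i j =
      Matrix.fromBlocks Z 0 0 0 (finSumFinEquiv.symm i) (finSumFinEquiv.symm j) := fun i j => rfl
  ext i
  rw [matC_apply]
  show ∑ j, diagBlock rfl rfl Z (0 : Matrix (Fin a) (Fin b) ℂ) i j * m j = _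
  rw [Fin.sum_univ_add]
  refine Fin.addCases (fun i => ?_) (fun i => ?_) i
  · rw [(hι _).1, matC_apply]
    show _ = ∑ j, Z i j * (ContinuousLinearMap.adjoint κ.toContinuousLinearMap m) j
    simp [hdb, had]
  · rw [(hι _).2]
    simp [hdb]

theorem ext_iso {X Y : Type} [NormedAddCommGroup X] [InnerProductSpace ℂ X] [NormedAddCommGroup Y]
    [InnerProductSpace ℂ Y] [FiniteDimensional ℂ Y] (ι T : X →ₗᵢ[ℂ] Y) :
    ∃ A : Y ≃ₗᵢ[ℂ] Y, ∀ x, A (ι x) = T x := by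
  let L : (LinearMap.range ι.toLinearMap) →ₗᵢ[ℂ] Y :=
    T.comp ι.equivRange.symm.toLinearIsometry
  refine ⟨LinearIsometry.toLinearIsometryEquiv L.extend rfl, fun x => ?_⟩
  have h1 := LinearIsometry.extend_apply L (ι.equivRange x)
  have h2 : L (ι.equivRange x) = T x := by
    show T (ι.equivRange.symm (ι.equivRange x)) = T x
    rw [LinearIsometryEquiv.symm_apply_apply]
  exact h1.trans h2

/-- A proper holomorphic map `f : D^I_{p,q} → D^I_{p',q'}` with `p ≥ q ≥ 2`,
`q' < min {p, 2q-1}` and `q = q'` or `p = p'` is standard, i.e. equivalent to the standard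
embedding `Z ↦ [[Z,0],[0,0]]`. -/
theorem stmt_7 (p q p' q' : ℕ) (h0p : 0 < p) (h0q : 0 < q) (h0p' : 0 < p') (h0q' : 0 < q')
    (hqp : q ≤ p) (h2q : 2 ≤ q) (hq' : q' < min p (2 * q - 1))
    (heq : q = q' ∨ p = p')
    (f : Matrix (Fin p) (Fin q) ℂ → Matrix (Fin p') (Fin q') ℂ)
    (hf : DifferentiableOn ℂ f (typeIDomain p q))
    (hfp : ProperOn f (typeIDomain p q) (typeIDomain p' q')) :
    ∃ (hpp : p + (p' - p) = p') (hqq : q + (q' - q) = q')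
      (Φ : Matrix (Fin p') (Fin q') ℂ → Matrix (Fin p') (Fin q') ℂ)
      (ψ : Matrix (Fin p) (Fin q) ℂ → Matrix (Fin p) (Fin q) ℂ),
      IsAutOf Φ ∧ IsAutOf ψ ∧
      ∀ Z ∈ typeIDomain p q, f Z = Φ (diagBlock hpp hqq (ψ Z) 0) := by
  have hF := PH_of_proper hf hfp
  have fr : ∀ n : ℕ, Module.finrank ℂ (EuclideanSpace ℂ (Fin n)) = n := fun n => by simp
  obtain ⟨g, g', hg, hg', T, S, h⟩ := CAB hF (by rw [fr]; exact h2q) (by rw [fr, fr, fr, fr]; exact heq)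
    (by rw [fr, fr]; omega) (by rw [fr, fr]; omega)
  have hpp : p ≤ p' := by
    have := LinearMap.finrank_le_finrank_of_injective (f := T.toLinearMap) T.injective
    simpa [fr] using this
  have hqq : q ≤ q' := by
    have := LinearMap.finrank_le_finrank_of_injective (f := S.toLinearMap) S.injective
    simpa [fr] using this
  have hpp' : p + (p' - p) = p' := by omega
  have hqq' : q + (q' - q) = q' := by omega
  obtain ⟨ι, κ, hικ⟩ := matC_diagBlock hpp' hqq'
  obtain ⟨A, hA⟩ := ext_iso ι T
  obtain ⟨B, hB⟩ := ext_iso κ S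
  have hSB : ∀ m, ContinuousLinearMap.adjoint S.toContinuousLinearMap m =
      ContinuousLinearMap.adjoint κ.toContinuousLinearMap (B.symm m) := by
    intro m
    refine ext_inner_left ℂ fun v => ?_
    rw [ContinuousLinearMap.adjoint_inner_right, ContinuousLinearMap.adjoint_inner_right]
    show inner ℂ (S v) m = inner ℂ (κ v) (B.symm m)
    rw [← hB, ← B.inner_map_map (κ v), B.apply_symm_apply]
  let M (A : EuclideanSpace ℂ (Fin p') ≃ₗᵢ[ℂ] EuclideanSpace ℂ (Fin p'))
      (B : EuclideanSpace ℂ (Fin q') ≃ₗᵢ[ℂ] EuclideanSpace ℂ (Fin q')) :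
      (EuclideanSpace ℂ (Fin q') →L[ℂ] EuclideanSpace ℂ (Fin p')) →L[ℂ] (EuclideanSpace ℂ (Fin q') →L[ℂ] EuclideanSpace ℂ (Fin p')) :=
    (ContinuousLinearMap.compL ℂ (EuclideanSpace ℂ (Fin q')) (EuclideanSpace ℂ (Fin p')) (EuclideanSpace ℂ (Fin p'))
        (A.toContinuousLinearEquiv : EuclideanSpace ℂ (Fin p') →L[ℂ] EuclideanSpace ℂ (Fin p'))).comp
      ((ContinuousLinearMap.compL ℂ (EuclideanSpace ℂ (Fin q')) (EuclideanSpace ℂ (Fin q')) (EuclideanSpace ℂ (Fin p'))).flip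
        (B.toContinuousLinearEquiv : EuclideanSpace ℂ (Fin q') →L[ℂ] EuclideanSpace ℂ (Fin q')))
  have hM : ∀ A B Y m, M A B Y m = A (Y (B m)) := fun A B Y m => rfl
  have hMn : ∀ A B Y, ‖Y‖ < 1 → ‖M A B Y‖ < 1 := by
    intro A B Y hY
    refine norm_lt_one_of_pt _ fun v hv => ?_
    rw [hM, A.norm_map, ← B.norm_map v]
    exact pt_of_norm_lt_one hY (by simpa using hv)
  have hMM : ∀ A B Y, M A.symm B.symm (M A B Y) = Y := by
    intro A B Y; ext1 m; simp [hM]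
  have hMb : ∀ A B, Set.MapsTo (M A B) (ball 0 1) (ball 0 1) := fun A B Y hY =>
    mem_ball_zero_iff.2 (hMn A B Y (mem_ball_zero_iff.1 hY))
  refine ⟨hpp', hqq', fun Z => (matC p' q').symm (act g'.symm (M A B.symm (matC p' q' Z))),
    fun Z => (matC p q).symm (act g.symm (matC p q Z)), ?_, ?_, ?_⟩
  · refine aut_of (G := fun Z => act g'.symm (M A B.symm Z)) (H := fun Z => M A.symm B (act g' Z)) ?_ ?_ ?_ ?_ ?_ ?_
    · exact DifferentiableOn.comp (𝕜 := ℂ) (E := EuclideanSpace ℂ (Fin q') →L[ℂ] EuclideanSpace ℂ (Fin p'))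
        (F := EuclideanSpace ℂ (Fin q') →L[ℂ] EuclideanSpace ℂ (Fin p'))
        (G := EuclideanSpace ℂ (Fin q') →L[ℂ] EuclideanSpace ℂ (Fin p')) hg'.symm.diffOn
        (M A B.symm).differentiable.differentiableOn (hMb _ _)
    · exact Differentiable.comp_differentiableOn (𝕜 := ℂ) (E := EuclideanSpace ℂ (Fin q') →L[ℂ] EuclideanSpace ℂ (Fin p'))
        (F := EuclideanSpace ℂ (Fin q') →L[ℂ] EuclideanSpace ℂ (Fin p'))
        (G := EuclideanSpace ℂ (Fin q') →L[ℂ] EuclideanSpace ℂ (Fin p')) (M A.symm B).differentiable hg'.diffOn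
    · exact fun Z hZ => hg'.symm.maps (hMn _ _ _ hZ)
    · exact fun Z hZ => hMn _ _ _ (hg'.maps hZ)
    · intro Z hZ
      show M A.symm B (act g' (act g'.symm (M A B.symm Z))) = Z
      rw [hg'.act_symm (hMn _ _ _ hZ)]
      exact hMM A B.symm Z
    · intro Z hZ
      show act g'.symm (M A B.symm (M A.symm B (act g' Z))) = Z
      have := hMM A.symm B (act g' Z)
      rw [LinearIsometryEquiv.symm_symm] at this
      rw [this, hg'.symm_act hZ]
  · exact aut_of (G := act g.symm) (H := act g) hg.symm.diffOn hg.diffOn (fun Z hZ => hg.symm.maps hZ)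
      (fun Z hZ => hg.maps hZ) (fun Z hZ => hg.act_symm hZ) (fun Z hZ => hg.symm_act hZ)
  · intro Z hZ
    have hZ1 := (matC_dom Z).2 hZ
    have hF2 : matC p' q' (f Z) = act g'.symm (M A B.symm (matC p' q' (diagBlock hpp' hqq' ((matC p q).symm (act g.symm (matC p q Z))) 0))) := by
      have h1 : act g' (matC p' q' (f Z)) = M A B.symm (matC p' q' (diagBlock hpp' hqq' ((matC p q).symm (act g.symm (matC p q Z))) 0)) := by
        ext1 m
        have h2 := h (act g.symm (matC p q Z)) (hg.symm.maps hZ1) m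
        rw [hg.act_symm hZ1, ContinuousLinearEquiv.symm_apply_apply] at h2
        rw [h2, hM, hικ, ContinuousLinearEquiv.apply_symm_apply, hA, hSB]
      rw [← h1, hg'.symm_act (hF.maps (matC p q Z) hZ1 |> fun h => by simpa using h)]
    show f Z = (matC p' q').symm _
    rw [← hF2, ContinuousLinearEquiv.symm_apply_apply]
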